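/- arXiv:math/0009065 — 2 statements merged into one kernel-verified Lean document; each statement's English description precedes it below -/
import Mathlib

section
/- For every f ∈ C_0^∞(ℝ²) and every λ ∈ ℝ, ‖e^{λx} f‖_{L⁸(ℝ²)} ≤ c ‖e^{λx} (∂_t f + ∂_x³ f)‖_{L^{8/7}(ℝ²)}, where the constant c is independent of λ. -/
open MeasureTheory

noncomputable def pdx (f : ℝ × ℝ → ℝ) : ℝ × ℝ → ℝ := fun p => deriv (fun x => f (x, p.2)) p.1
noncomputable def pdt (f : ℝ × ℝ → ℝ) : ℝ × ℝ → ℝ := fun p => deriv (fun t => f (p.1, t)) p.2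

section CubicPhase
open Complex Set

theorem hasDerivAt_cexp_cubic (c x : ℝ) :
    HasDerivAt (fun x : ℝ => cexp (I * (x ^ 3 + c * x : ℝ)))
      (cexp (I * (x ^ 3 + c * x : ℝ)) * (I * (3 * x ^ 2 + c : ℝ))) x := by
  have h : HasDerivAt (fun x : ℝ => x ^ 3 + c * x) (3 * x ^ 2 + c) x := by
    simpa using! (hasDerivAt_pow 3 x).add ((hasDerivAt_id x).const_mul c)
  exact (h.ofReal_comp.const_mul I).cexp

theorem norm_cexp_I_mul_ofReal (x : ℝ) : ‖cexp (I * (x : ℂ))‖ = 1 := by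
  rw [mul_comm]; exact norm_exp_ofReal_mul_I x

theorem continuous_cexp_cubic (t c : ℝ) :
    Continuous (fun x : ℝ => cexp (I * (t * x ^ 3 + c * x : ℝ))) := by fun_prop

/-- First derivative test for the phase `x ^ 3 + c * x`. -/
theorem norm_integral_cexp_cubic_le_of_one_le {c a b : ℝ} (hab : a ≤ b) (ha : 0 ≤ a)
    (h : ∀ x ∈ Icc a b, 1 ≤ |3 * x ^ 2 + c|) :
    ‖∫ x in a..b, cexp (I * (x ^ 3 + c * x : ℝ))‖ ≤ 4 := by
  have hne : ∀ x ∈ Icc a b, 3 * x ^ 2 + c ≠ 0 := fun x hx h0 => by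
    have := h x hx; rw [h0] at this; norm_num at this
  have hd : ∀ x : ℝ, HasDerivAt (fun x : ℝ => 3 * x ^ 2 + c) (6 * x) x := fun x => by
    have := ((hasDerivAt_pow 2 x).const_mul 3).add_const c
    simpa [← mul_assoc, show (3 * 2 : ℝ) = 6 by norm_num] using this
  have hI : ∀ x ∈ Icc a b, ‖((3 * x ^ 2 + c : ℝ) : ℂ)⁻¹‖ ≤ 1 := fun x hx => by
    rw [norm_inv, norm_real, Real.norm_eq_abs]
    exact inv_le_one_of_one_le₀ (h x hx)
  have hcont : ContinuousOn (fun x : ℝ => 6 * x / (3 * x ^ 2 + c) ^ 2) (Icc a b) :=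
    ContinuousOn.div (by fun_prop) (by fun_prop) fun x hx => pow_ne_zero _ (hne x hx)
  have hcontC : ContinuousOn (fun x : ℝ => cexp (I * (x ^ 3 + c * x : ℝ)) *
      (I * (6 * x / (3 * x ^ 2 + c) ^ 2 : ℝ))) (Icc a b) := by
    refine ContinuousOn.mul (by fun_prop) (continuousOn_const.mul ?_)
    exact continuous_ofReal.comp_continuousOn hcont
  have hF : ∀ x ∈ uIcc a b, HasDerivAt
      (fun x : ℝ => -I * (cexp (I * (x ^ 3 + c * x : ℝ)) * ((3 * x ^ 2 + c : ℝ) : ℂ)⁻¹))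
      (cexp (I * (x ^ 3 + c * x : ℝ)) + cexp (I * (x ^ 3 + c * x : ℝ)) *
      (I * (6 * x / (3 * x ^ 2 + c) ^ 2 : ℝ))) x := fun x hx => by
    rw [uIcc_of_le hab] at hx
    have h0 : ((3 * x ^ 2 + c : ℝ) : ℂ) ≠ 0 := ofReal_ne_zero.2 (hne x hx)
    have := ((hasDerivAt_cexp_cubic c x).mul ((hd x).ofReal_comp.inv h0)).const_mul (-I)
    convert! this using 1
    simp only [Pi.inv_apply]
    rw [ofReal_div, ofReal_pow]
    generalize ((3 * x ^ 2 + c : ℝ) : ℂ) = d at h0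
    generalize cexp _ = e
    field_simp
    linear_combination (e * d ^ 2) * I_sq
  have h1 := intervalIntegral.integral_eq_sub_of_hasDerivAt hF (by
    apply ContinuousOn.intervalIntegrable
    rw [uIcc_of_le hab]
    exact (Continuous.continuousOn (by fun_prop)).add hcontC)
  rw [intervalIntegral.integral_add (Continuous.intervalIntegrable (by fun_prop) _ _)
    (by apply ContinuousOn.intervalIntegrable; rwa [uIcc_of_le hab])] at h1
  have h2 : ‖∫ x in a..b, cexp (I * (x ^ 3 + c * x : ℝ)) *
      (I * (6 * x / (3 * x ^ 2 + c) ^ 2 : ℝ))‖ ≤ 2 := by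
    have h3 : ∀ x ∈ uIcc a b, HasDerivAt (fun x : ℝ => -(3 * x ^ 2 + c)⁻¹)
        (6 * x / (3 * x ^ 2 + c) ^ 2) x := fun x hx => by
      rw [uIcc_of_le hab] at hx
      convert! ((hd x).inv (hne x hx)).neg using 1
      ring
    have hint : IntervalIntegrable (fun x : ℝ => 6 * x / (3 * x ^ 2 + c) ^ 2) volume a b := by
      apply ContinuousOn.intervalIntegrable; rwa [uIcc_of_le hab]
    have h4 := intervalIntegral.integral_eq_sub_of_hasDerivAt h3 hint
    calc _ ≤ ∫ x in a..b, 6 * x / (3 * x ^ 2 + c) ^ 2 := by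
          apply intervalIntegral.norm_integral_le_of_norm_le hab _ hint
          filter_upwards with x hx
          rw [norm_mul, norm_cexp_I_mul_ofReal, norm_mul, norm_I, norm_real, one_mul, one_mul,
            Real.norm_of_nonneg]
          have : 0 ≤ x := ha.trans hx.1.le
          positivity
      _ ≤ 2 := by
          rw [h4]
          have := hI a (left_mem_Icc.2 hab)
          have h' := hI b (right_mem_Icc.2 hab)
          rw [← ofReal_inv, norm_real, Real.norm_eq_abs, abs_le] at this h'
          linarith
  rw [← eq_sub_iff_add_eq] at h1
  rw [h1]
  have hB : ∀ x ∈ Icc a b,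
      ‖-I * (cexp (I * (x ^ 3 + c * x : ℝ)) * ((3 * x ^ 2 + c : ℝ) : ℂ)⁻¹)‖ ≤ 1 := fun x hx => by
    rw [norm_mul, norm_neg, norm_I, norm_mul, norm_cexp_I_mul_ofReal, one_mul, one_mul]
    exact hI x hx
  refine (norm_sub_le _ _).trans ((add_le_add ((norm_sub_le _ _).trans
    (add_le_add (hB b (right_mem_Icc.2 hab)) (hB a (left_mem_Icc.2 hab)))) h2).trans ?_)
  norm_num

theorem norm_integral_cexp_cubic_le (c : ℝ) {b : ℝ} (hb : 0 ≤ b) :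
    ‖∫ x in (0 : ℝ)..b, cexp (I * (x ^ 3 + c * x : ℝ))‖ ≤ 9 := by
  set p := √((-c - 1) / 3) with hp
  set q := √((1 - c) / 3) with hq
  have hpq : p ≤ q := Real.sqrt_le_sqrt (by linarith)
  have hp0 : 0 ≤ p := Real.sqrt_nonneg _
  have hint : ∀ u v : ℝ, IntervalIntegrable (fun x : ℝ => cexp (I * (x ^ 3 + c * x : ℝ)))
      volume u v := fun u v => Continuous.intervalIntegrable (by fun_prop) _ _
  have hqp : q ≤ p + 1 := by
    rw [hq, Real.sqrt_le_left (by positivity)]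
    rcases le_total 0 ((-c - 1) / 3) with h | h
    · have := Real.sq_sqrt h
      rw [← hp] at this
      nlinarith
    · nlinarith
  have h1 : ∀ y, 0 ≤ y → y ≤ p → ‖∫ x in (0 : ℝ)..y, cexp (I * (x ^ 3 + c * x : ℝ))‖ ≤ 4 := by
    intro y hy hyp
    rcases hy.eq_or_lt with rfl | hy
    · simp
    refine norm_integral_cexp_cubic_le_of_one_le hy.le le_rfl fun x hx => ?_
    have hp1 : 0 < p := hy.trans_le hyp
    have h := Real.sq_sqrt (Real.sqrt_pos.1 hp1).le
    rw [← hp] at h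
    have : x ^ 2 ≤ p ^ 2 := pow_le_pow_left₀ hx.1 (hx.2.trans hyp) 2
    rw [le_abs]; right; linarith
  have h2 : ∀ y, p ≤ y → y ≤ q → ‖∫ x in p..y, cexp (I * (x ^ 3 + c * x : ℝ))‖ ≤ 1 := by
    intro y hpy hyq
    refine (intervalIntegral.norm_integral_le_of_norm_le_const (C := 1) fun x _ =>
      (norm_cexp_I_mul_ofReal _).le).trans ?_
    rw [abs_of_nonneg (by linarith)]; linarith
  have h3 : ∀ y, q ≤ y → ‖∫ x in q..y, cexp (I * (x ^ 3 + c * x : ℝ))‖ ≤ 4 := by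
    intro y hy
    refine norm_integral_cexp_cubic_le_of_one_le hy (Real.sqrt_nonneg _) fun x hx => ?_
    have : (1 - c) / 3 ≤ x ^ 2 := (Real.sqrt_le_left ((Real.sqrt_nonneg _).trans hx.1)).1 hx.1
    rw [le_abs]; left; linarith
  rcases le_total b p with h | h
  · linarith [h1 b hb h]
  rw [← intervalIntegral.integral_add_adjacent_intervals (hint 0 p) (hint p b)]
  rcases le_total b q with h' | h'
  · linarith [norm_add_le (∫ x in (0 : ℝ)..p, cexp (I * (x ^ 3 + c * x : ℝ)))
      (∫ x in p..b, cexp (I * (x ^ 3 + c * x : ℝ))), h1 p hp0 le_rfl, h2 b h h']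
  rw [← intervalIntegral.integral_add_adjacent_intervals (hint p q) (hint q b), ← add_assoc]
  linarith [norm_add₃_le (a := ∫ x in (0 : ℝ)..p, cexp (I * (x ^ 3 + c * x : ℝ)))
      (b := ∫ x in p..q, cexp (I * (x ^ 3 + c * x : ℝ)))
      (c := ∫ x in q..b, cexp (I * (x ^ 3 + c * x : ℝ))), h1 p hp0 le_rfl, h2 q hpq le_rfl,
      h3 b h']

theorem norm_integral_cexp_cubic_le_of_ne_zero {t : ℝ} (ht : t ≠ 0) (c : ℝ) {b : ℝ} (hb : 0 ≤ b) :
    ‖∫ x in (0 : ℝ)..b, cexp (I * (t * x ^ 3 + c * x : ℝ))‖ ≤ 9 * |t| ^ (-1 / 3 : ℝ) := by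
  have hpos : ∀ (t c : ℝ), 0 < t →
      ‖∫ x in (0 : ℝ)..b, cexp (I * (t * x ^ 3 + c * x : ℝ))‖ ≤ 9 * |t| ^ (-1 / 3 : ℝ) := by
    intro t c ht
    set m := t ^ (1 / 3 : ℝ) with hm
    have hm0 : 0 < m := by positivity
    have hm3 : m ^ 3 = t := by
      rw [hm, ← Real.rpow_natCast, ← Real.rpow_mul ht.le]; norm_num
    have hmi : |t| ^ (-1 / 3 : ℝ) = m⁻¹ := by
      rw [abs_of_pos ht, hm, ← Real.rpow_neg ht.le]; norm_num
    have := intervalIntegral.integral_comp_mul_left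
      (fun x : ℝ => cexp (I * (x ^ 3 + c / m * x : ℝ))) (a := 0) (b := b) hm0.ne'
    have h2 : ∀ x : ℝ, (m * x) ^ 3 + c / m * (m * x) = t * x ^ 3 + c * x := fun x => by
      rw [← hm3]; field_simp
    simp only [h2, mul_zero] at this
    rw [this, norm_smul, hmi, Real.norm_of_nonneg (by positivity), mul_comm]
    gcongr
    exact norm_integral_cexp_cubic_le _ (by positivity)
  rcases ht.lt_or_gt with h | h
  · have := hpos (-t) (-c) (by linarith)
    rw [abs_neg] at this
    convert this using 1
    rw [← Complex.norm_conj, ← intervalIntegral.intervalIntegral_conj]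
    congr 2
    ext x
    rw [← exp_conj, map_mul, conj_I, conj_ofReal]
    congr 1
    push_cast; ring
  · exact hpos t c h

theorem norm_setIntegral_sq_lt_cexp_cubic_le {t : ℝ} (ht : t ≠ 0) (c b : ℝ) :
    ‖∫ x in {x : ℝ | x ^ 2 < b}, cexp (I * (t * x ^ 3 + c * x : ℝ))‖
      ≤ 18 * |t| ^ (-1 / 3 : ℝ) := by
  have hs : {x : ℝ | x ^ 2 < b} = Ioo (-√b) (√b) := by
    ext x
    rw [mem_ofPred_eq, mem_Ioo, ← abs_lt, Real.lt_sqrt (abs_nonneg x), sq_abs]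
  have hb := Real.sqrt_nonneg b
  rw [hs, ← integral_Ioc_eq_integral_Ioo, ← intervalIntegral.integral_of_le (by linarith),
    ← intervalIntegral.integral_add_adjacent_intervals (b := 0)
      ((continuous_cexp_cubic t c).intervalIntegrable _ _)
      ((continuous_cexp_cubic t c).intervalIntegrable _ _)]
  have h := intervalIntegral.integral_comp_neg (a := 0) (b := √b)
    (fun x : ℝ => cexp (I * (t * x ^ 3 + c * x : ℝ)))
  rw [neg_zero] at h
  have h1 := norm_integral_cexp_cubic_le_of_ne_zero ht c hb
  have h2 := norm_integral_cexp_cubic_le_of_ne_zero (neg_ne_zero.2 ht) (-c) hb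
  rw [abs_neg] at h2
  rw [← h]
  have h3 : ∀ x : ℝ, t * (-x) ^ 3 + c * (-x) = -t * x ^ 3 + -c * x := fun x => by ring
  simp only [h3]
  linarith [norm_add_le (∫ x in (0 : ℝ)..√b, cexp (I * (-t * x ^ 3 + -c * x : ℝ)))
    (∫ x in (0 : ℝ)..√b, cexp (I * (t * x ^ 3 + c * x : ℝ)))]

theorem measurableSet_sq_annulus (a b : ℝ) : MeasurableSet {x : ℝ | a < x ^ 2 ∧ x ^ 2 < b} :=
  (measurableSet_lt measurable_const (measurable_id.pow_const 2)).inter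
    (measurableSet_lt (measurable_id.pow_const 2) measurable_const)

theorem isBounded_sq_lt (b : ℝ) : Bornology.IsBounded {x : ℝ | x ^ 2 < b} := by
  refine (Metric.isBounded_Icc (-√b) (√b)).subset fun x hx => ?_
  rw [mem_Icc, ← abs_le]
  exact (Real.lt_sqrt (abs_nonneg x)).2 (by rw [sq_abs]; exact hx) |>.le

theorem norm_setIntegral_annulus_cexp_cubic_le {t : ℝ} (ht : t ≠ 0) (c a b : ℝ) :
    ‖∫ x in {x : ℝ | a < x ^ 2 ∧ x ^ 2 < b}, cexp (I * (t * x ^ 3 + c * x : ℝ))‖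
      ≤ 36 * |t| ^ (-1 / 3 : ℝ) := by
  rcases le_or_gt b a with hab | hab
  · have : {x : ℝ | a < x ^ 2 ∧ x ^ 2 < b} = ∅ := by
      ext x; simp only [mem_ofPred_eq, mem_empty_iff_false, iff_false]; intro h; linarith
    rw [this]; simp; positivity
  have hint : IntegrableOn (fun x : ℝ => cexp (I * (t * x ^ 3 + c * x : ℝ)))
      {x : ℝ | x ^ 2 < b} :=
    ((continuous_cexp_cubic t c).locallyIntegrable.integrableOn_isCompact
      (isBounded_sq_lt b).isCompact_closure).mono_set subset_closure
  have hae : {x : ℝ | a < x ^ 2 ∧ x ^ 2 < b} =ᵐ[volume]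
      ({x : ℝ | x ^ 2 < b} \ {x : ℝ | x ^ 2 < a} : Set ℝ) := by
    have h0 : ∀ᵐ x : ℝ, x ^ 2 ≠ a := by
      refine (Set.Finite.countable (s := {x : ℝ | x ^ 2 = a}) ?_).ae_notMem volume
      refine (Set.toFinite {√a, -√a}).subset fun x hx => ?_
      have hx : x ^ 2 = a := hx
      have : x ^ 2 = (√a) ^ 2 := by rw [Real.sq_sqrt (hx ▸ sq_nonneg x), hx]
      exact sq_eq_sq_iff_eq_or_eq_neg.1 this
    filter_upwards [h0] with x hx
    refine propext ⟨fun h => ⟨h.2, not_lt.2 h.1.le⟩, fun h => ⟨?_, h.1⟩⟩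
    exact lt_of_le_of_ne (not_lt.1 h.2) (Ne.symm hx)
  rw [setIntegral_congr_set hae, setIntegral_sdiff (measurableSet_lt (by fun_prop) measurable_const)
    hint (fun x hx => lt_trans hx hab)]
  linarith [norm_sub_le (∫ x in {x : ℝ | x ^ 2 < b}, cexp (I * (t * x ^ 3 + c * x : ℝ)))
    (∫ x in {x : ℝ | x ^ 2 < a}, cexp (I * (t * x ^ 3 + c * x : ℝ))),
    norm_setIntegral_sq_lt_cexp_cubic_le ht c a, norm_setIntegral_sq_lt_cexp_cubic_le ht c b]

end CubicPhase

section LayerCake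
open Set ENNReal

theorem lintegral_Ioo_ofReal_rpow {s c : ℝ} (hs : -1 < s) (hc : 0 ≤ c) :
    ∫⁻ b in Ioo 0 c, ENNReal.ofReal (b ^ s) = ENNReal.ofReal (c ^ (s + 1) / (s + 1)) := by
  have h := integral_rpow (a := 0) (b := c) (r := s) (Or.inl hs)
  rw [Real.zero_rpow (by linarith), sub_zero, intervalIntegral.integral_of_le hc,
    integral_Ioc_eq_integral_Ioo] at h
  rw [← h, ofReal_integral_eq_lintegral_ofReal]
  · exact ((intervalIntegral.intervalIntegrable_rpow' hs).1).mono_set Ioo_subset_Ioc_self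
  · filter_upwards [ae_restrict_mem measurableSet_Ioo] with b hb
    exact Real.rpow_nonneg hb.1.le _

theorem ENNReal.rpow_half_mul_rpow_half_le (x y : ℝ≥0∞) {c : ℝ} (hc : 0 < c) :
    x ^ (1 / 2 : ℝ) * y ^ (1 / 2 : ℝ) ≤
      ENNReal.ofReal (c / 2) * x + ENNReal.ofReal (c⁻¹ / 2) * y := by
  have h := ENNReal.young_inequality ((ENNReal.ofReal c * x) ^ (1 / 2 : ℝ))
    ((ENNReal.ofReal c⁻¹ * y) ^ (1 / 2 : ℝ)) Real.HolderConjugate.two_two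
  rw [← ENNReal.mul_rpow_of_nonneg _ _ (by norm_num), mul_mul_mul_comm,
    ← ENNReal.ofReal_mul hc.le, mul_inv_cancel₀ hc.ne', ofReal_one, one_mul,
    ENNReal.mul_rpow_of_nonneg _ _ (by norm_num), ← ENNReal.rpow_mul, ← ENNReal.rpow_mul,
    one_div_mul_cancel two_ne_zero, ENNReal.rpow_one, ENNReal.rpow_one] at h
  refine h.trans (le_of_eq ?_)
  rw [ENNReal.ofReal_div_of_pos two_pos, ENNReal.ofReal_div_of_pos two_pos,
    ENNReal.mul_div_right_comm, ENNReal.mul_div_right_comm]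

theorem lintegral_Ioi_hyperbola {a r : ℝ} (ha : 0 < a) (hr : 0 < r) :
    ∫⁻ b in Ioi (0 : ℝ), {b : ℝ | a * b < r ^ 7}.indicator
      (fun b => ENNReal.ofReal ((a / b) ^ (4 / 7 : ℝ))) b
      = ENNReal.ofReal (7 / 3 * r ^ 3) * ENNReal.ofReal (a ^ (1 / 7 : ℝ)) := by
  have hR : 0 < r ^ 7 / a := by positivity
  have hm : MeasurableSet {b : ℝ | a * b < r ^ 7} :=
    measurableSet_lt (measurable_id.const_mul a) measurable_const
  rw [setLIntegral_indicator hm]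
  have hs : {b : ℝ | a * b < r ^ 7} ∩ Ioi 0 = Ioo 0 (r ^ 7 / a) := by
    ext b
    simp only [mem_inter_iff, mem_ofPred_eq, mem_Ioi, mem_Ioo, lt_div_iff₀' ha]
    tauto
  rw [hs]
  have h1 : ∀ b ∈ Ioo (0 : ℝ) (r ^ 7 / a), ENNReal.ofReal ((a / b) ^ (4 / 7 : ℝ)) =
      ENNReal.ofReal (a ^ (4 / 7 : ℝ)) * ENNReal.ofReal (b ^ (-4 / 7 : ℝ)) := fun b hb => by
    rw [← ENNReal.ofReal_mul (by positivity), Real.div_rpow ha.le hb.1.le, div_eq_mul_inv,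
      ← Real.rpow_neg hb.1.le]
    norm_num
  rw [setLIntegral_congr_fun measurableSet_Ioo h1, lintegral_const_mul _ (by fun_prop),
    lintegral_Ioo_ofReal_rpow (by norm_num) hR.le, ← ENNReal.ofReal_mul (by positivity),
    ← ENNReal.ofReal_mul (by positivity)]
  congr 1
  have h2 : (r ^ 7) ^ (3 / 7 : ℝ) = r ^ 3 := by
    rw [← Real.rpow_natCast, ← Real.rpow_mul hr.le, ← Real.rpow_natCast]; norm_num
  have h3 : a ^ (4 / 7 : ℝ) = a ^ (3 / 7 : ℝ) * a ^ (1 / 7 : ℝ) := by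
    rw [← Real.rpow_add ha]; norm_num
  rw [show (-4 / 7 + 1 : ℝ) = 3 / 7 by norm_num, Real.div_rpow (by positivity) ha.le, h2, h3]
  have : a ^ (3 / 7 : ℝ) ≠ 0 := by positivity
  field_simp

theorem lintegral_lintegral_min_le {u v : ℝ → ℝ≥0∞} (hu : Measurable u) (hv : Measurable v)
    {A r ρ : ℝ} (hA : 0 ≤ A) (hr : 0 < r) (hρ : 0 < ρ) :
    ∫⁻ a in Ioi (0 : ℝ), ∫⁻ b in Ioi (0 : ℝ),
        min (ENNReal.ofReal A * (u a * v b)) (u a ^ (1 / 2 : ℝ) * v b ^ (1 / 2 : ℝ)) ≤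
      ENNReal.ofReal (A / r) * ((∫⁻ a in Ioi (0 : ℝ), u a * ENNReal.ofReal (a ^ (1 / 7 : ℝ))) *
        ∫⁻ b in Ioi (0 : ℝ), v b * ENNReal.ofReal (b ^ (1 / 7 : ℝ))) +
      (ENNReal.ofReal (7 / 6 * r ^ 3 * ρ) *
        (∫⁻ a in Ioi (0 : ℝ), u a * ENNReal.ofReal (a ^ (1 / 7 : ℝ))) +
      ENNReal.ofReal (7 / 6 * r ^ 3 * ρ⁻¹) *
        ∫⁻ b in Ioi (0 : ℝ), v b * ENNReal.ofReal (b ^ (1 / 7 : ℝ))) := by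
  have hm : MeasurableSet {p : ℝ × ℝ | p.1 * p.2 < r ^ 7} :=
    measurableSet_lt (by fun_prop) measurable_const
  set k : ℝ → ℝ → ℝ≥0∞ := fun a b => {b : ℝ | a * b < r ^ 7}.indicator
      (fun b => ENNReal.ofReal ((a / b) ^ (4 / 7 : ℝ))) b with hk
  have hkm : Measurable (Function.uncurry k) := by
    have : Function.uncurry k = {p : ℝ × ℝ | p.1 * p.2 < r ^ 7}.indicator
        (fun p => ENNReal.ofReal ((p.1 / p.2) ^ (4 / 7 : ℝ))) := by
      ext p; simp [Function.uncurry, hk, indicator]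
    rw [this]
    exact Measurable.indicator (by fun_prop) hm
  have hkm1 : ∀ a, Measurable (k a) := fun a => hkm.comp measurable_prodMk_left
  have hkm2 : ∀ b, Measurable (fun a => k a b) := fun b => hkm.comp measurable_prodMk_right
  have hkm' : Measurable fun p : ℝ × ℝ => k p.1 p.2 := hkm
  have hkm'' : Measurable fun p : ℝ × ℝ => k p.2 p.1 := hkm.comp measurable_swap
  have hpt : ∀ a ∈ Ioi (0 : ℝ), ∀ b ∈ Ioi (0 : ℝ),
      min (ENNReal.ofReal A * (u a * v b)) (u a ^ (1 / 2 : ℝ) * v b ^ (1 / 2 : ℝ)) ≤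
      ENNReal.ofReal (A / r) * (u a * ENNReal.ofReal (a ^ (1 / 7 : ℝ)) *
        (v b * ENNReal.ofReal (b ^ (1 / 7 : ℝ)))) +
      (ENNReal.ofReal (ρ / 2) * u a * k a b + ENNReal.ofReal (ρ⁻¹ / 2) * (v b * k b a)) := by
    intro a ha b hb
    have ha : 0 < a := ha
    have hb : 0 < b := hb
    rcases lt_or_ge (a * b) (r ^ 7) with h | h
    · refine (min_le_right _ _).trans (le_add_left ?_)
      have e1 : k a b = ENNReal.ofReal ((a / b) ^ (4 / 7 : ℝ)) := 
        indicator_of_mem (show b ∈ {b : ℝ | a * b < r ^ 7} from h) _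
      have e2 : k b a = ENNReal.ofReal ((b / a) ^ (4 / 7 : ℝ)) :=
        indicator_of_mem (show a ∈ {a : ℝ | b * a < r ^ 7} by rwa [mem_ofPred_eq, mul_comm]) _
      have := ENNReal.rpow_half_mul_rpow_half_le (u a) (v b)
        (c := ρ * (a / b) ^ (4 / 7 : ℝ)) (by positivity)
      refine this.trans (le_of_eq ?_)
      rw [e1, e2, mul_right_comm, mul_left_comm, ← ENNReal.ofReal_mul (by positivity), mul_comm (v b),
        ← ENNReal.ofReal_mul (by positivity), mul_inv, ← Real.inv_rpow (by positivity), inv_div,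
        mul_div_right_comm, mul_div_right_comm]
    · refine (min_le_left _ _).trans (le_add_right ?_)
      have h1 : r ≤ (a * b) ^ (1 / 7 : ℝ) := by
        calc r = (r ^ 7) ^ (1 / 7 : ℝ) := by
              rw [← Real.rpow_natCast, ← Real.rpow_mul hr.le]; norm_num
          _ ≤ _ := by gcongr
      have h2 : A ≤ A / r * (a ^ (1 / 7 : ℝ) * b ^ (1 / 7 : ℝ)) := by
        rw [← Real.mul_rpow ha.le hb.le, div_mul_eq_mul_div, le_div_iff₀ hr]
        gcongr
      calc _ ≤ ENNReal.ofReal (A / r * (a ^ (1 / 7 : ℝ) * b ^ (1 / 7 : ℝ))) * (u a * v b) := by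
            gcongr
        _ = _ := by
            rw [ENNReal.ofReal_mul (by positivity), ENNReal.ofReal_mul (by positivity)]; ring
  have h1 : ∀ a ∈ Ioi (0 : ℝ), ∫⁻ b in Ioi (0 : ℝ), k a b =
      ENNReal.ofReal (7 / 3 * r ^ 3) * ENNReal.ofReal (a ^ (1 / 7 : ℝ)) := fun a ha =>
    lintegral_Ioi_hyperbola ha hr
  calc _ ≤ ∫⁻ a in Ioi (0 : ℝ), ∫⁻ b in Ioi (0 : ℝ),
        (ENNReal.ofReal (A / r) * (u a * ENNReal.ofReal (a ^ (1 / 7 : ℝ)) *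
        (v b * ENNReal.ofReal (b ^ (1 / 7 : ℝ)))) +
      (ENNReal.ofReal (ρ / 2) * u a * k a b + ENNReal.ofReal (ρ⁻¹ / 2) * (v b * k b a))) :=
        setLIntegral_mono' measurableSet_Ioi fun a ha =>
          setLIntegral_mono' measurableSet_Ioi fun b hb => hpt a ha b hb
    _ = (∫⁻ a in Ioi (0 : ℝ), ∫⁻ b in Ioi (0 : ℝ),
        ENNReal.ofReal (A / r) * (u a * ENNReal.ofReal (a ^ (1 / 7 : ℝ)) *
        (v b * ENNReal.ofReal (b ^ (1 / 7 : ℝ))))) +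
      ((∫⁻ a in Ioi (0 : ℝ), ∫⁻ b in Ioi (0 : ℝ), ENNReal.ofReal (ρ / 2) * u a * k a b) +
       ∫⁻ a in Ioi (0 : ℝ), ∫⁻ b in Ioi (0 : ℝ), ENNReal.ofReal (ρ⁻¹ / 2) * (v b * k b a)) := by
        rw [← lintegral_add_left (Measurable.lintegral_prod_right' (f := fun p : ℝ × ℝ =>
          ENNReal.ofReal (ρ / 2) * u p.1 * k p.1 p.2) (by fun_prop)),
          ← lintegral_add_left (Measurable.lintegral_prod_right' (f := fun p : ℝ × ℝ =>
          ENNReal.ofReal (A / r) * (u p.1 * ENNReal.ofReal (p.1 ^ (1 / 7 : ℝ)) *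
        (v p.2 * ENNReal.ofReal (p.2 ^ (1 / 7 : ℝ))))) (by fun_prop))]
        refine lintegral_congr fun a => ?_
        rw [← lintegral_add_left (by have := hkm1 a; fun_prop), ← lintegral_add_left (by fun_prop)]
    _ = _ := by
        congr 1
        · simp_rw [lintegral_const_mul' _ _ ofReal_ne_top]
          rw [← lintegral_mul_const _ (by fun_prop)]
          congr 1
          refine lintegral_congr fun a => ?_
          rw [lintegral_const_mul _ (by fun_prop)]
        · congr 1
          · rw [← lintegral_const_mul _ (by fun_prop)]
            refine setLIntegral_congr_fun measurableSet_Ioi fun a ha => ?_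
            rw [lintegral_const_mul _ (hkm1 a), h1 a ha,
              show 7 / 6 * r ^ 3 * ρ = ρ / 2 * (7 / 3 * r ^ 3) by ring,
              ENNReal.ofReal_mul (p := ρ / 2) (by positivity)]
            ring
          · rw [lintegral_lintegral_swap (by fun_prop), ← lintegral_const_mul _ (by fun_prop)]
            refine setLIntegral_congr_fun measurableSet_Ioi fun b hb => ?_
            rw [lintegral_const_mul' _ _ ofReal_ne_top, lintegral_const_mul _ (hkm1 b), h1 b hb,
              show 7 / 6 * r ^ 3 * ρ⁻¹ = ρ⁻¹ / 2 * (7 / 3 * r ^ 3) by ring,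
              ENNReal.ofReal_mul (p := ρ⁻¹ / 2) (by positivity)]
            ring

/-- The parameters of `lintegral_lintegral_min_le` optimized. -/
theorem lintegral_lintegral_min_le_of_le {u v : ℝ → ℝ≥0∞} (hu : Measurable u) (hv : Measurable v)
    {α x y : ℝ} (hα : 0 < α) (hx : 0 < x) (hy : 0 < y)
    (hux : ∫⁻ a in Ioi (0 : ℝ), u a * ENNReal.ofReal (a ^ (1 / 7 : ℝ)) ≤ ENNReal.ofReal (x ^ 8))
    (hvy : ∫⁻ a in Ioi (0 : ℝ), v a * ENNReal.ofReal (a ^ (1 / 7 : ℝ)) ≤ ENNReal.ofReal (y ^ 8)) :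
    ∫⁻ a in Ioi (0 : ℝ), ∫⁻ b in Ioi (0 : ℝ),
        min (ENNReal.ofReal (α ^ 4) * (u a * v b)) (u a ^ (1 / 2 : ℝ) * v b ^ (1 / 2 : ℝ)) ≤
      ENNReal.ofReal (4 * α ^ 3 * x ^ 7 * y ^ 7) := by
  refine (lintegral_lintegral_min_le hu hv (A := α ^ 4) (r := α * x * y) (ρ := y ^ 4 / x ^ 4)
    (by positivity) (by positivity) (by positivity)).trans ?_
  calc _ ≤ ENNReal.ofReal (α ^ 4 / (α * x * y)) * (ENNReal.ofReal (x ^ 8) * ENNReal.ofReal (y ^ 8))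
        + (ENNReal.ofReal (7 / 6 * (α * x * y) ^ 3 * (y ^ 4 / x ^ 4)) * ENNReal.ofReal (x ^ 8)
        + ENNReal.ofReal (7 / 6 * (α * x * y) ^ 3 * (y ^ 4 / x ^ 4)⁻¹) * ENNReal.ofReal (y ^ 8)) := by
        gcongr
    _ = ENNReal.ofReal (10 / 3 * (α ^ 3 * x ^ 7 * y ^ 7)) := by
        rw [← ENNReal.ofReal_mul (by positivity), ← ENNReal.ofReal_mul (by positivity),
          ← ENNReal.ofReal_mul (by positivity), ← ENNReal.ofReal_mul (by positivity),
          ← ENNReal.ofReal_add (by positivity) (by positivity),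
          ← ENNReal.ofReal_add (by positivity) (by positivity)]
        congr 1
        field_simp
        norm_num
    _ ≤ _ := by
        apply ENNReal.ofReal_le_ofReal
        have : 0 < α ^ 3 * x ^ 7 * y ^ 7 := by positivity
        linarith
end LayerCake

section FractionalIntegration
open Set ENNReal

theorem setLIntegral_Ioc_rpow_three_quarters_le {v : ℝ → ℝ≥0∞} (hv : Measurable v) {c : ℝ}
    (hc : 0 ≤ c) :
    ∫⁻ b in Ioc 0 c, v b ^ (3 / 4 : ℝ) ≤ ENNReal.ofReal (2 * c ^ (1 / 7 : ℝ)) *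
      (∫⁻ b in Ioi (0 : ℝ), v b * ENNReal.ofReal (b ^ (1 / 7 : ℝ))) ^ (3 / 4 : ℝ) := by
  have hpq : Real.HolderConjugate (4 / 3) 4 := by
    rw [Real.holderConjugate_iff]; norm_num
  have h := ENNReal.lintegral_mul_le_Lp_mul_Lq (volume.restrict (Ioo 0 c)) hpq
    (f := fun b => (v b * ENNReal.ofReal (b ^ (1 / 7 : ℝ))) ^ (3 / 4 : ℝ))
    (g := fun b => ENNReal.ofReal (b ^ (-3 / 28 : ℝ))) (by fun_prop) (by fun_prop)
  rw [setLIntegral_congr Ioo_ae_eq_Ioc.symm]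
  calc _ = ∫⁻ b in Ioo 0 c, ((fun b => (v b * ENNReal.ofReal (b ^ (1 / 7 : ℝ))) ^ (3 / 4 : ℝ)) *
          (fun b => ENNReal.ofReal (b ^ (-3 / 28 : ℝ)))) b := by
        refine setLIntegral_congr_fun measurableSet_Ioo fun b hb => ?_
        have hb : 0 < b := hb.1
        rw [Pi.mul_apply, ENNReal.mul_rpow_of_nonneg _ _ (by norm_num),
          ENNReal.ofReal_rpow_of_pos (by positivity), mul_assoc,
          ← ENNReal.ofReal_mul (by positivity), ← Real.rpow_mul hb.le, ← Real.rpow_add hb]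
        norm_num
    _ ≤ _ := h
    _ ≤ _ := by
        rw [mul_comm]
        gcongr ?_ * ?_
        · have h1 : ∀ b ∈ Ioo 0 c, ENNReal.ofReal (b ^ (-3 / 28 : ℝ)) ^ (4 : ℝ) =
              ENNReal.ofReal (b ^ (-3 / 7 : ℝ)) := fun b hb => by
            have hb : 0 < b := hb.1
            rw [ENNReal.ofReal_rpow_of_pos (by positivity), ← Real.rpow_mul hb.le]
            norm_num
          rw [setLIntegral_congr_fun measurableSet_Ioo h1,
            lintegral_Ioo_ofReal_rpow (by norm_num) hc,
            ENNReal.ofReal_rpow_of_nonneg (by norm_num; positivity) (by norm_num)]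
          apply ENNReal.ofReal_le_ofReal
          rw [show (-3 / 7 + 1 : ℝ) = 4 / 7 by norm_num,
            Real.div_rpow (by positivity) (by norm_num), ← Real.rpow_mul hc]
          norm_num
          rw [div_eq_inv_mul]
          gcongr
          rw [← Real.inv_rpow (by norm_num)]
          calc ((4 / 7 : ℝ)⁻¹) ^ (1 / 4 : ℝ) ≤ ((4 / 7 : ℝ)⁻¹) ^ (1 : ℝ) :=
                Real.rpow_le_rpow_of_exponent_le (by norm_num) (by norm_num)
            _ ≤ 2 := by norm_num
        · simp_rw [← ENNReal.rpow_mul]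
          norm_num
          exact ENNReal.rpow_le_rpow (lintegral_mono_set Ioo_subset_Ioi_self) (by norm_num)

theorem setLIntegral_abs_sub_rpow_le (E : Set ℝ) (t : ℝ) :
    ∫⁻ s in E, ENNReal.ofReal (|t - s| ^ (-1 / 4 : ℝ)) ≤ 4 * volume E ^ (3 / 4 : ℝ) := by
  rcases eq_or_ne (volume E) ⊤ with h | hfin
  · rw [h, ENNReal.top_rpow_of_pos (by norm_num), ENNReal.mul_top (by norm_num)]; exact le_top
  rcases eq_or_ne (volume E) 0 with h | h0
  · rw [setLIntegral_measure_zero _ _ h]; exact zero_le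
  set r := (volume E).toReal with hr
  have hr0 : 0 < r := ENNReal.toReal_pos h0 hfin
  set h : ℝ → ℝ≥0∞ := (Ioo 0 r).indicator fun s => ENNReal.ofReal (s ^ (-1 / 4 : ℝ)) with hh
  have hhm : Measurable h := Measurable.indicator (by fun_prop) measurableSet_Ioo
  have hhi : ∫⁻ s, h s = ENNReal.ofReal (4 / 3 * r ^ (3 / 4 : ℝ)) := by
    rw [lintegral_indicator measurableSet_Ioo, lintegral_Ioo_ofReal_rpow (by norm_num) hr0.le]
    rw [show (-1 / 4 + 1 : ℝ) = 3 / 4 by norm_num]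
    congr 1; ring
  have hpt : ∀ s, ENNReal.ofReal (|t - s| ^ (-1 / 4 : ℝ)) ≤
      (h (t - s) + h (s - t)) + ENNReal.ofReal (r ^ (-1 / 4 : ℝ)) := by
    intro s
    rcases lt_or_ge |t - s| r with hlt | hge
    · apply le_add_right
      rcases lt_trichotomy (t - s) 0 with hs | hs | hs
      · apply le_add_left
        rw [abs_of_neg hs] at hlt ⊢
        rw [hh, indicator_of_mem (show s - t ∈ Ioo 0 r by constructor <;> linarith), neg_sub]
      · rw [hs, abs_zero, Real.zero_rpow (by norm_num)]; simp
      · apply le_add_right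
        rw [abs_of_pos hs] at hlt ⊢
        rw [hh, indicator_of_mem (show t - s ∈ Ioo 0 r from ⟨hs, hlt⟩)]
    · apply le_add_left
      apply ENNReal.ofReal_le_ofReal
      exact Real.rpow_le_rpow_of_nonpos hr0 hge (by norm_num)
  have hvE : volume E = ENNReal.ofReal r := (ENNReal.ofReal_toReal hfin).symm
  calc _ ≤ ∫⁻ s in E, ((h (t - s) + h (s - t)) + ENNReal.ofReal (r ^ (-1 / 4 : ℝ))) :=
        lintegral_mono hpt
    _ = (∫⁻ s in E, (h (t - s) + h (s - t))) + ENNReal.ofReal (r ^ (-1 / 4 : ℝ)) * volume E := by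
        rw [lintegral_add_right _ measurable_const, setLIntegral_const]
    _ ≤ (∫⁻ s, (h (t - s) + h (s - t))) + ENNReal.ofReal (r ^ (-1 / 4 : ℝ)) * volume E := by
        gcongr; exact Measure.restrict_le_self
    _ = ENNReal.ofReal (11 / 3 * r ^ (3 / 4 : ℝ)) := by
        rw [lintegral_add_left (by fun_prop), lintegral_sub_left_eq_self h t,
          lintegral_sub_right_eq_self h t, hhi, hvE, ← ENNReal.ofReal_mul (by positivity),
          ← ENNReal.ofReal_add (by positivity) (by positivity),
          ← ENNReal.ofReal_add (by positivity) (by positivity)]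
        congr 1
        have : r ^ (-1 / 4 : ℝ) * r = r ^ (3 / 4 : ℝ) := by
          nth_rw 2 [← Real.rpow_one r]
          rw [← Real.rpow_add hr0]; norm_num
        rw [this]; ring
    _ ≤ _ := by
        rw [hvE, ENNReal.ofReal_rpow_of_pos hr0, show (4 : ℝ≥0∞) = ENNReal.ofReal 4 by simp,
          ← ENNReal.ofReal_mul (by norm_num)]
        apply ENNReal.ofReal_le_ofReal
        gcongr; norm_num

theorem lintegral_mul_ofReal_eq_lintegral_superlevel {α : Type*} [MeasurableSpace α]
    (μ : Measure α) {w : α → ℝ≥0∞} {f : α → ℝ} (hw : Measurable w) (hf : Measurable f)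
    (hf0 : ∀ s, 0 ≤ f s) :
    ∫⁻ s, w s * ENNReal.ofReal (f s) ∂μ = ∫⁻ a in Ioi (0 : ℝ), ∫⁻ s in {s | a < f s}, w s ∂μ := by
  have h := lintegral_eq_lintegral_meas_lt (μ.withDensity w) (f := f) (ae_of_all _ hf0)
    hf.aemeasurable
  rw [lintegral_withDensity_eq_lintegral_mul _ hw (by fun_prop)] at h
  simp only [Pi.mul_apply] at h
  rw [h]
  exact lintegral_congr fun a => withDensity_apply _ (measurableSet_lt measurable_const hf)

theorem lintegral_lintegral_min_rpow_le {u v : ℝ → ℝ≥0∞} (hu : Measurable u) (hv : Measurable v)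
    {σ : ℝ} (hσ : 0 < σ) :
    ∫⁻ a in Ioi (0 : ℝ), ∫⁻ b in Ioi (0 : ℝ),
        min (u a * v b ^ (3 / 4 : ℝ)) (u a ^ (3 / 4 : ℝ) * v b) ≤
      ENNReal.ofReal (2 * σ) *
        (∫⁻ b in Ioi (0 : ℝ), v b * ENNReal.ofReal (b ^ (1 / 7 : ℝ))) ^ (3 / 4 : ℝ) *
        (∫⁻ a in Ioi (0 : ℝ), u a * ENNReal.ofReal (a ^ (1 / 7 : ℝ))) +
      ENNReal.ofReal (2 * σ⁻¹) *
        (∫⁻ a in Ioi (0 : ℝ), u a * ENNReal.ofReal (a ^ (1 / 7 : ℝ))) ^ (3 / 4 : ℝ) *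
        (∫⁻ b in Ioi (0 : ℝ), v b * ENNReal.ofReal (b ^ (1 / 7 : ℝ))) := by
  have hm1 : MeasurableSet {p : ℝ × ℝ | p.2 ≤ σ ^ 7 * p.1} :=
    measurableSet_le (by fun_prop) (by fun_prop)
  have hm2 : MeasurableSet {p : ℝ × ℝ | p.1 ≤ σ⁻¹ ^ 7 * p.2} :=
    measurableSet_le (by fun_prop) (by fun_prop)
  set F₁ : ℝ × ℝ → ℝ≥0∞ := {p : ℝ × ℝ | p.2 ≤ σ ^ 7 * p.1}.indicator
    (fun p => u p.1 * v p.2 ^ (3 / 4 : ℝ)) with hF₁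
  set F₂ : ℝ × ℝ → ℝ≥0∞ := {p : ℝ × ℝ | p.1 ≤ σ⁻¹ ^ 7 * p.2}.indicator
    (fun p => u p.1 ^ (3 / 4 : ℝ) * v p.2) with hF₂
  have hF₁m : Measurable F₁ := Measurable.indicator (by fun_prop) hm1
  have hF₂m : Measurable F₂ := Measurable.indicator (by fun_prop) hm2
  have hpow : ∀ {τ a : ℝ}, 0 < τ → 0 < a → (τ ^ 7 * a) ^ (1 / 7 : ℝ) = τ * a ^ (1 / 7 : ℝ) := by
    intro τ a hτ ha
    rw [Real.mul_rpow (by positivity) ha.le, ← Real.rpow_natCast, ← Real.rpow_mul hτ.le]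
    norm_num
  have hpt : ∀ a b, min (u a * v b ^ (3 / 4 : ℝ)) (u a ^ (3 / 4 : ℝ) * v b) ≤
      F₁ (a, b) + F₂ (a, b) := by
    intro a b
    rcases le_total b (σ ^ 7 * a) with h | h
    · refine (min_le_left _ _).trans (le_add_right ?_)
      rw [hF₁, indicator_of_mem (show (a, b) ∈ {p : ℝ × ℝ | p.2 ≤ σ ^ 7 * p.1} from h)]
    · refine (min_le_right _ _).trans (le_add_left ?_)
      have h' : (a, b) ∈ {p : ℝ × ℝ | p.1 ≤ σ⁻¹ ^ 7 * p.2} := by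
        change a ≤ σ⁻¹ ^ 7 * b
        rw [inv_pow, ← div_eq_inv_mul, le_div_iff₀' (by positivity)]
        exact h
      rw [hF₂, indicator_of_mem h']
  calc _ ≤ ∫⁻ a in Ioi (0 : ℝ), ∫⁻ b in Ioi (0 : ℝ), (F₁ (a, b) + F₂ (a, b)) :=
        lintegral_mono fun a => lintegral_mono fun b => hpt a b
    _ = (∫⁻ a in Ioi (0 : ℝ), ∫⁻ b in Ioi (0 : ℝ), F₁ (a, b)) +
        ∫⁻ b in Ioi (0 : ℝ), ∫⁻ a in Ioi (0 : ℝ), F₂ (a, b) := by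
        rw [lintegral_lintegral_swap (f := fun b a => F₂ (a, b))
            (hF₂m.comp measurable_swap).aemeasurable,
          ← lintegral_add_left (Measurable.lintegral_prod_right' hF₁m)]
        exact lintegral_congr fun a => lintegral_add_left (hF₁m.comp measurable_prodMk_left) _
    _ ≤ _ := by
        gcongr ?_ + ?_
        · rw [← lintegral_const_mul _ (by fun_prop)]
          refine setLIntegral_mono' measurableSet_Ioi fun a ha => ?_
          have ha : 0 < a := ha
          have e : ∀ b, F₁ (a, b) = (Iic (σ ^ 7 * a)).indicator
            (fun b => u a * v b ^ (3 / 4 : ℝ)) b := fun b => by simp [hF₁, indicator]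
          simp_rw [e]
          rw [setLIntegral_indicator measurableSet_Iic, inter_comm, Ioi_inter_Iic,
            lintegral_const_mul _ (by fun_prop)]
          refine (mul_le_mul_right (setLIntegral_Ioc_rpow_three_quarters_le hv
            (by positivity)) _).trans (le_of_eq ?_)
          rw [hpow hσ ha, ← mul_assoc 2, ENNReal.ofReal_mul (p := 2 * σ) (by positivity)]
          ring
        · rw [← lintegral_const_mul _ (by fun_prop)]
          refine setLIntegral_mono' measurableSet_Ioi fun b hb => ?_
          have hb : 0 < b := hb
          have e : ∀ a, F₂ (a, b) = (Iic (σ⁻¹ ^ 7 * b)).indicator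
            (fun a => u a ^ (3 / 4 : ℝ) * v b) a := fun b => by simp [hF₂, indicator]
          simp_rw [e]
          rw [setLIntegral_indicator measurableSet_Iic, inter_comm, Ioi_inter_Iic,
            lintegral_mul_const _ (by fun_prop)]
          refine (mul_le_mul_left (setLIntegral_Ioc_rpow_three_quarters_le hu
            (by positivity)) _).trans (le_of_eq ?_)
          rw [hpow (inv_pos.2 hσ) hb, ← mul_assoc 2,
            ENNReal.ofReal_mul (p := 2 * σ⁻¹) (by positivity)]
          ring

theorem measurable_volume_superlevel (f : ℝ → ℝ) : Measurable fun a => volume {s | a < f s} :=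
  Antitone.measurable fun _ _ h => measure_mono fun _ hs => lt_of_le_of_lt h hs

theorem lintegral_superlevel_mul_rpow_le {f : ℝ → ℝ} (hf : Measurable f) (hf0 : ∀ s, 0 ≤ f s) :
    ∫⁻ a in Ioi (0 : ℝ), volume {s | a < f s} * ENNReal.ofReal (a ^ (1 / 7 : ℝ)) ≤
      ∫⁻ s, ENNReal.ofReal (f s ^ (8 / 7 : ℝ)) := by
  rw [lintegral_rpow_eq_lintegral_meas_lt_mul volume (ae_of_all _ hf0) hf.aemeasurable
    (by norm_num), show (8 / 7 - 1 : ℝ) = 1 / 7 by norm_num]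
  refine le_mul_of_one_le_left zero_le ?_
  rw [ENNReal.one_le_ofReal]; norm_num

/-- The Hardy–Littlewood–Sobolev inequality on the line, from `L^{8/7}` to `L^8`. -/
theorem lintegral_lintegral_abs_sub_rpow_mul_le {f g : ℝ → ℝ} (hf : Measurable f)
    (hg : Measurable g) (hf0 : ∀ s, 0 ≤ f s) (hg0 : ∀ s, 0 ≤ g s)
    (hf' : ∫⁻ s, ENNReal.ofReal (f s ^ (8 / 7 : ℝ)) ≠ ⊤)
    (hg' : ∫⁻ s, ENNReal.ofReal (g s ^ (8 / 7 : ℝ)) ≠ ⊤) :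
    ∫⁻ t, (∫⁻ s, ENNReal.ofReal (|t - s| ^ (-1 / 4 : ℝ)) * ENNReal.ofReal (f s)) *
        ENNReal.ofReal (g t) ≤
      16 * (∫⁻ s, ENNReal.ofReal (f s ^ (8 / 7 : ℝ))) ^ (7 / 8 : ℝ) *
        (∫⁻ s, ENNReal.ofReal (g s ^ (8 / 7 : ℝ))) ^ (7 / 8 : ℝ) := by
  set k : ℝ → ℝ → ℝ≥0∞ := fun t s => ENNReal.ofReal (|t - s| ^ (-1 / 4 : ℝ)) with hk
  set u : ℝ → ℝ≥0∞ := fun a => volume {s | a < f s}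
  set v : ℝ → ℝ≥0∞ := fun a => volume {s | a < g s}
  have hu : Measurable u := measurable_volume_superlevel f
  have hv : Measurable v := measurable_volume_superlevel g
  have hkm : Measurable (Function.uncurry k) := by
    simp only [hk, Function.uncurry_def]; fun_prop
  have hEf : ∀ a, MeasurableSet {s | a < f s} := fun a => measurableSet_lt measurable_const hf
  have hEg : ∀ a, MeasurableSet {s | a < g s} := fun a => measurableSet_lt measurable_const hg
  have hΦ : Measurable fun p : ℝ × ℝ => ∫⁻ s in {s | p.2 < f s}, k p.1 s := by
    simp_rw [← lintegral_indicator (hEf _)]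
    refine Measurable.lintegral_prod_right' (f := fun q : (ℝ × ℝ) × ℝ =>
      {s | q.1.2 < f s}.indicator (fun s => k q.1.1 s) q.2) ?_
    have : (fun q : (ℝ × ℝ) × ℝ => {s | q.1.2 < f s}.indicator (fun s => k q.1.1 s) q.2) =
        {q : (ℝ × ℝ) × ℝ | q.1.2 < f q.2}.indicator fun q => k q.1.1 q.2 := by
      ext q; simp [indicator]
    rw [this]
    exact Measurable.indicator
      (hkm.comp ((measurable_fst.comp measurable_fst).prodMk measurable_snd))
      (measurableSet_lt (by fun_prop) (by fun_prop))
  have hlayer : ∫⁻ t, (∫⁻ s, k t s * ENNReal.ofReal (f s)) * ENNReal.ofReal (g t) =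
      ∫⁻ a in Ioi (0 : ℝ), ∫⁻ b in Ioi (0 : ℝ),
        ∫⁻ t in {t | b < g t}, ∫⁻ s in {s | a < f s}, k t s := by
    have h1 : ∀ t, ∫⁻ s, k t s * ENNReal.ofReal (f s) =
        ∫⁻ a in Ioi (0 : ℝ), ∫⁻ s in {s | a < f s}, k t s := fun t =>
      lintegral_mul_ofReal_eq_lintegral_superlevel volume (hkm.comp measurable_prodMk_left) hf hf0
    simp_rw [h1]
    have h2 : ∀ t, (∫⁻ a in Ioi (0 : ℝ), ∫⁻ s in {s | a < f s}, k t s) * ENNReal.ofReal (g t) =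
        ∫⁻ a in Ioi (0 : ℝ), (∫⁻ s in {s | a < f s}, k t s) * ENNReal.ofReal (g t) := fun t =>
      (lintegral_mul_const _ (hΦ.comp measurable_prodMk_left)).symm
    simp_rw [h2]
    rw [lintegral_lintegral_swap (hΦ.mul (by fun_prop)).aemeasurable]
    exact lintegral_congr fun a => lintegral_mul_ofReal_eq_lintegral_superlevel volume
      (hΦ.comp measurable_prodMk_right) hg hg0
  have hbound : ∀ a b, ∫⁻ t in {t | b < g t}, ∫⁻ s in {s | a < f s}, k t s ≤
      4 * min (u a * v b ^ (3 / 4 : ℝ)) (u a ^ (3 / 4 : ℝ) * v b) := by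
    intro a b
    rw [mul_min_of_nonneg _ _ (zero_le : (0 : ℝ≥0∞) ≤ 4)]
    refine le_min ?_ ?_
    · rw [lintegral_lintegral_swap hkm.aemeasurable]
      calc _ ≤ ∫⁻ s in {s | a < f s}, 4 * v b ^ (3 / 4 : ℝ) := by
            refine lintegral_mono fun s => ?_
            simp only [hk, abs_sub_comm _ s]
            exact setLIntegral_abs_sub_rpow_le _ s
        _ = _ := by rw [setLIntegral_const]; ring
    · calc _ ≤ ∫⁻ t in {t | b < g t}, 4 * u a ^ (3 / 4 : ℝ) :=
            lintegral_mono fun t => setLIntegral_abs_sub_rpow_le _ t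
        _ = _ := by rw [setLIntegral_const]; ring
  have hU := lintegral_superlevel_mul_rpow_le hf hf0
  have hV := lintegral_superlevel_mul_rpow_le hg hg0
  rw [hlayer]
  set U := ∫⁻ s, ENNReal.ofReal (f s ^ (8 / 7 : ℝ))
  set V := ∫⁻ s, ENNReal.ofReal (g s ^ (8 / 7 : ℝ))
  have key : ∀ σ : ℝ, 0 < σ → ∫⁻ a in Ioi (0 : ℝ), ∫⁻ b in Ioi (0 : ℝ),
        ∫⁻ t in {t | b < g t}, ∫⁻ s in {s | a < f s}, k t s ≤
      4 * (ENNReal.ofReal (2 * σ) * V ^ (3 / 4 : ℝ) * U +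
        ENNReal.ofReal (2 * σ⁻¹) * U ^ (3 / 4 : ℝ) * V) := by
    intro σ hσ
    calc _ ≤ ∫⁻ a in Ioi (0 : ℝ), ∫⁻ b in Ioi (0 : ℝ),
          4 * min (u a * v b ^ (3 / 4 : ℝ)) (u a ^ (3 / 4 : ℝ) * v b) :=
          lintegral_mono fun a => lintegral_mono fun b => hbound a b
      _ = 4 * ∫⁻ a in Ioi (0 : ℝ), ∫⁻ b in Ioi (0 : ℝ),
          min (u a * v b ^ (3 / 4 : ℝ)) (u a ^ (3 / 4 : ℝ) * v b) := by
          simp_rw [lintegral_const_mul' _ _ (show (4 : ℝ≥0∞) ≠ ⊤ by norm_num)]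
      _ ≤ _ := by
          gcongr
          refine (lintegral_lintegral_min_rpow_le hu hv hσ).trans ?_
          gcongr
  rcases eq_or_ne U 0 with hU0 | hU0
  · refine (key 1 one_pos).trans ?_
    rw [hU0, ENNReal.zero_rpow_of_pos (by norm_num)]; simp
  rcases eq_or_ne V 0 with hV0 | hV0
  · refine (key 1 one_pos).trans ?_
    rw [hV0, ENNReal.zero_rpow_of_pos (by norm_num)]; simp
  have hx : 0 < U.toReal := ENNReal.toReal_pos hU0 hf'
  have hy : 0 < V.toReal := ENNReal.toReal_pos hV0 hg'
  have hUx : U = ENNReal.ofReal U.toReal := (ENNReal.ofReal_toReal hf').symm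
  have hVy : V = ENNReal.ofReal V.toReal := (ENNReal.ofReal_toReal hg').symm
  generalize U.toReal = X at *
  generalize V.toReal = Y at *
  refine (key (Y ^ (1 / 8 : ℝ) / X ^ (1 / 8 : ℝ)) (by positivity)).trans (le_of_eq ?_)
  rw [hUx, hVy]
  simp only [ENNReal.ofReal_rpow_of_pos hx, ENNReal.ofReal_rpow_of_pos hy]
  rw [show (4 : ℝ≥0∞) = ENNReal.ofReal 4 by simp, show (16 : ℝ≥0∞) = ENNReal.ofReal 16 by simp]
  have e : ∀ {Z : ℝ}, 0 < Z → ∀ n : ℕ, Z ^ ((n : ℝ) / 8) = (Z ^ (1 / 8 : ℝ)) ^ n := fun {Z} hZ n => by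
    rw [← Real.rpow_natCast, ← Real.rpow_mul hZ.le]; congr 1; ring
  have e6 : ∀ {Z : ℝ}, 0 < Z → Z ^ (3 / 4 : ℝ) = (Z ^ (1 / 8 : ℝ)) ^ 6 := fun hZ => by
    rw [← e hZ]; norm_num
  have e7 : ∀ {Z : ℝ}, 0 < Z → Z ^ (7 / 8 : ℝ) = (Z ^ (1 / 8 : ℝ)) ^ 7 := fun hZ => by
    rw [← e hZ]; norm_num
  have e8 : ∀ {Z : ℝ}, 0 < Z → Z = (Z ^ (1 / 8 : ℝ)) ^ 8 := fun hZ => by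
    rw [← e hZ]; norm_num
  simp (discharger := positivity) only [← ENNReal.ofReal_mul, ← ENNReal.ofReal_add]
  congr 1
  rw [e6 hx, e6 hy, e7 hx, e7 hy]
  have hx' : 0 < X ^ (1 / 8 : ℝ) := by positivity
  have hy' : 0 < Y ^ (1 / 8 : ℝ) := by positivity
  have h8x := e8 hx
  have h8y := e8 hy
  generalize X ^ (1 / 8 : ℝ) = x at *
  generalize Y ^ (1 / 8 : ℝ) = y at *
  rw [h8x, h8y]
  field_simp
  ring

end FractionalIntegration

section FourierMultiplier
open Set ENNReal FourierTransform ComplexConjugate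

theorem integral_fourier_mul_eq_of_integrable {f g : ℝ → ℂ} (hf : Integrable f)
    (hg : Integrable g) : ∫ ξ, 𝓕 f ξ * g ξ = ∫ x, f x * 𝓕 g x := by
  have h := VectorFourier.integral_fourierIntegral_smul_eq_flip (L := innerₗ ℝ)
    Real.continuous_fourierChar continuous_inner hf hg
  rw [flip_innerₗ] at h
  exact h

theorem continuous_fourier_of_integrable {f : ℝ → ℂ} (hf : Integrable f) :
    Continuous (𝓕 f) :=
  VectorFourier.fourierIntegral_continuous (L := innerₗ ℝ)
    Real.continuous_fourierChar continuous_inner hf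

theorem eLpNorm_fourier_eq {F : ℝ → ℂ} (h1 : Integrable F) (h2 : MemLp F 2) :
    eLpNorm (𝓕 F) 2 volume = eLpNorm F 2 volume := by
  have hae : ∀ᵐ ξ, (𝓕 (h2.toLp F) : Lp ℂ 2 volume) ξ = 𝓕 F ξ := by
    refine ae_eq_of_integral_contDiff_smul_eq
      ((Lp.memLp _).locallyIntegrable (by norm_num))
      (continuous_fourier_of_integrable h1).locallyIntegrable fun g hg hgc => ?_
    have hg' : HasCompactSupport fun x => (g x : ℂ) :=
      hgc.comp_left (g := Complex.ofReal) Complex.ofReal_zero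
    set γ : SchwartzMap ℝ ℂ := hg'.toSchwartzMap (Complex.ofRealCLM.contDiff.comp hg)
    have hγ : ∀ x, γ x = g x := fun x => rfl
    have h := congrArg (fun T => T γ) (Lp.fourier_toTemperedDistribution_eq (h2.toLp F))
    simp only [TemperedDistribution.fourier_apply, Lp.toTemperedDistribution_apply, hγ,
      smul_eq_mul] at h
    simp_rw [Complex.real_smul]
    rw [← h]
    calc _ = ∫ x, 𝓕 γ x * F x := by
          refine integral_congr_ae ?_
          filter_upwards [h2.coeFn_toLp] with x hx
          rw [hx]
      _ = _ := integral_fourier_mul_eq_of_integrable γ.integrable h1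
  rw [← eLpNorm_congr_ae hae, ← eLpNorm_congr_ae h2.coeFn_toLp,
    ← ENNReal.toReal_eq_toReal_iff' (Lp.eLpNorm_ne_top _) (Lp.eLpNorm_ne_top _),
    ← Lp.norm_def, ← Lp.norm_def, Lp.norm_fourier_eq]

theorem lintegral_enorm_fourier_sq_eq {F : ℝ → ℂ} (h1 : Integrable F) (h2 : MemLp F 2) :
    ∫⁻ ξ, ‖𝓕 F ξ‖ₑ ^ (2 : ℝ) = ∫⁻ x, ‖F x‖ₑ ^ (2 : ℝ) := by
  have h := congrArg (fun x : ℝ≥0∞ => x ^ (2 : ℝ)) (eLpNorm_fourier_eq h1 h2)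
  simp only [eLpNorm_eq_lintegral_rpow_enorm_toReal two_ne_zero ENNReal.ofNat_ne_top,
    ← ENNReal.rpow_mul, ENNReal.toReal_ofNat] at h
  norm_num at h
  simpa using h

/-- The sesquilinear form of the Fourier multiplier with symbol `m`. -/
noncomputable def multiplierForm (m F G : ℝ → ℂ) : ℂ := ∫ ξ, m ξ * 𝓕 F ξ * conj (𝓕 G ξ)

theorem enorm_multiplierForm_le_L2 {m F G : ℝ → ℂ} (hm : ∀ ξ, ‖m ξ‖ ≤ 1)
    (hF1 : Integrable F) (hF2 : MemLp F 2) (hG1 : Integrable G) (hG2 : MemLp G 2) :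
    ‖multiplierForm m F G‖ₑ ≤
      (∫⁻ x, ‖F x‖ₑ ^ (2 : ℝ)) ^ (1 / 2 : ℝ) * (∫⁻ x, ‖G x‖ₑ ^ (2 : ℝ)) ^ (1 / 2 : ℝ) := by
  have hcF := continuous_fourier_of_integrable hF1
  have hcG := continuous_fourier_of_integrable hG1
  calc _ ≤ ∫⁻ ξ, ‖m ξ * 𝓕 F ξ * conj (𝓕 G ξ)‖ₑ := enorm_integral_le_lintegral_enorm _
    _ ≤ ∫⁻ ξ, ((fun ξ => ‖𝓕 F ξ‖ₑ) * fun ξ => ‖𝓕 G ξ‖ₑ) ξ := by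
        refine lintegral_mono fun ξ => ?_
        rw [enorm_mul, enorm_mul, RCLike.enorm_conj, Pi.mul_apply]
        gcongr
        refine mul_le_of_le_one_left zero_le ?_
        rw [← ofReal_norm]
        exact (ENNReal.ofReal_le_ofReal (hm ξ)).trans (by simp)
    _ ≤ _ := by
        have hpq : Real.HolderConjugate 2 2 := by
          rw [Real.holderConjugate_iff]; norm_num
        refine (ENNReal.lintegral_mul_le_Lp_mul_Lq volume hpq
          hcF.enorm.aemeasurable hcG.enorm.aemeasurable).trans ?_
        rw [lintegral_enorm_fourier_sq_eq hF1 hF2, lintegral_enorm_fourier_sq_eq hG1 hG2]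

theorem integrable_mul_of_norm_le {m k : ℝ → ℂ} (hm : Integrable m)
    (hk : AEStronglyMeasurable k) {C : ℝ} (hC : ∀ x, ‖k x‖ ≤ C) :
    Integrable fun x => m x * k x :=
  hm.mul_bdd hk (ae_of_all _ hC)

theorem norm_fourier_le {F : ℝ → ℂ} (ξ : ℝ) : ‖𝓕 F ξ‖ ≤ ∫ x, ‖F x‖ :=
  VectorFourier.norm_fourierIntegral_le_integral_norm _ _ _ _ _

theorem multiplierForm_eq_integral_mul {m F G : ℝ → ℂ} (hm : Integrable m)
    (hF : Integrable F) (hG : Integrable G) :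
    multiplierForm m F G = ∫ x, F x * 𝓕 (fun ξ => m ξ * conj (𝓕 G ξ)) x := by
  have hk : Integrable fun ξ => m ξ * conj (𝓕 G ξ) :=
    integrable_mul_of_norm_le hm (Complex.continuous_conj.comp
      (continuous_fourier_of_integrable hG)).aestronglyMeasurable
      (C := ∫ x, ‖G x‖) fun x => by rw [RCLike.norm_conj]; exact norm_fourier_le x
  rw [← integral_fourier_mul_eq_of_integrable hF hk]
  exact integral_congr_ae (ae_of_all _ fun ξ => by ring)

theorem multiplierForm_conj_symm (m F G : ℝ → ℂ) :
    multiplierForm m F G = conj (multiplierForm (fun ξ => conj (m ξ)) G F) := by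
  unfold multiplierForm
  rw [← integral_conj]
  exact integral_congr_ae (ae_of_all _ fun ξ => by simp; ring)

theorem fourier_mul_conj_fourier_eq {m G : ℝ → ℂ} (hm : Integrable m) (hG : Integrable G) (x : ℝ) :
    𝓕 (fun ξ => m ξ * conj (𝓕 G ξ)) x = ∫ y, 𝓕 m (x - y) * conj (G y) := by
  have h1 : ∀ ξ, conj (𝓕 G ξ) = 𝓕 (fun y => conj (G (-y))) ξ := fun ξ => by
    rw [Real.fourier_real_eq, Real.fourier_real_eq, ← integral_conj,
      ← integral_neg_eq_self]
    refine integral_congr_ae (ae_of_all _ fun y => ?_)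
    simp [Circle.smul_def, ← Circle.coe_inv_eq_conj, ← AddChar.map_neg_eq_inv]
  have h2 : ∀ y, 𝓕 (fun ξ => 𝐞 (-(ξ * x)) • m ξ) y = 𝓕 m (y + x) := fun y => by
    rw [Real.fourier_real_eq, Real.fourier_real_eq]
    refine integral_congr_ae (ae_of_all _ fun ξ => ?_)
    simp only [smul_smul, ← AddChar.map_add_eq_mul]
    congr 2; ring
  have h3 : Integrable fun ξ => 𝐞 (-(ξ * x)) • m ξ := by
    have := (Real.fourierIntegral_convergent_iff (μ := volume) (f := m) x).2 hm
    simpa [mul_comm] using this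
  have hG' : Integrable fun y => conj (G (-y)) :=
    (Complex.conjCLE.toContinuousLinearMap.integrable_comp hG).comp_neg
  calc _ = ∫ ξ, (𝐞 (-(ξ * x)) • m ξ) * 𝓕 (fun y => conj (G (-y))) ξ := by
        rw [Real.fourier_real_eq]
        refine integral_congr_ae (ae_of_all _ fun ξ => ?_)
        simp only [h1, smul_mul_assoc]
    _ = ∫ y, 𝓕 m (y + x) * conj (G (-y)) := by
        rw [← integral_fourier_mul_eq_of_integrable h3 hG']
        simp_rw [h2]
    _ = _ := by
        rw [← integral_neg_eq_self]
        refine integral_congr_ae (ae_of_all _ fun ξ => ?_)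
        simp only [neg_neg]
        rw [neg_add_eq_sub]

theorem norm_fourier_mul_conj_fourier_le {m G : ℝ → ℂ} {A : ℝ} (hm : Integrable m)
    (hA : ∀ x, ‖𝓕 m x‖ ≤ A) (hG : Integrable G) (x : ℝ) :
    ‖𝓕 (fun ξ => m ξ * conj (𝓕 G ξ)) x‖ ≤ A * ∫ y, ‖G y‖ := by
  rw [fourier_mul_conj_fourier_eq hm hG, ← integral_const_mul]
  refine norm_integral_le_of_norm_le (hG.norm.const_mul A) (ae_of_all _ fun y => ?_)
  rw [norm_mul, RCLike.norm_conj]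
  gcongr
  exact hA _

theorem norm_multiplierForm_le_L1 {m F G : ℝ → ℂ} {A : ℝ} (hm : Integrable m)
    (hA : ∀ x, ‖𝓕 m x‖ ≤ A) (hF : Integrable F) (hG : Integrable G) :
    ‖multiplierForm m F G‖ ≤ A * ((∫ x, ‖F x‖) * ∫ x, ‖G x‖) := by
  rw [multiplierForm_eq_integral_mul hm hF hG]
  calc _ ≤ ∫ x, ‖F x‖ * (A * ∫ y, ‖G y‖) := by
        refine norm_integral_le_of_norm_le (hF.norm.mul_const _) (ae_of_all _ fun y => ?_)
        rw [norm_mul]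
        gcongr
        exact norm_fourier_mul_conj_fourier_le hm hA hG y
    _ = _ := by rw [integral_mul_const]; ring

end FourierMultiplier

section LevelSlice
open Set ENNReal FourierTransform ComplexConjugate

/-- The phase of `F`, cut off to the superlevel set `{‖F‖ > a}`. -/
noncomputable def levelSlice (F : ℝ → ℂ) (a x : ℝ) : ℂ := if a < ‖F x‖ then F x / ‖F x‖ else 0

theorem measurable_levelSlice {F : ℝ → ℂ} (hF : Measurable F) :
    Measurable fun p : ℝ × ℝ => levelSlice F p.2 p.1 :=
  Measurable.ite (measurableSet_lt (by fun_prop) (by fun_prop)) (by fun_prop) measurable_const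

theorem norm_levelSlice {F : ℝ → ℂ} {a : ℝ} (ha : 0 ≤ a) (x : ℝ) :
    ‖levelSlice F a x‖ = {x | a < ‖F x‖}.indicator (fun _ => 1) x := by
  unfold levelSlice
  split_ifs with h
  · rw [indicator_of_mem (show x ∈ {x | a < ‖F x‖} from h)]
    have : ‖F x‖ ≠ 0 := (ha.trans_lt h).ne'
    simp [this]
  · rw [indicator_of_notMem (show x ∉ {x | a < ‖F x‖} from h), norm_zero]

theorem measurableSet_superlevel_norm {F : ℝ → ℂ} (hF : Measurable F) (a : ℝ) :
    MeasurableSet {x | a < ‖F x‖} := measurableSet_lt measurable_const hF.norm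

theorem integrable_levelSlice {F : ℝ → ℂ} (hF : Measurable F) (hFi : Integrable F) {a : ℝ}
    (ha : 0 < a) : Integrable (levelSlice F a) := by
  refine (hFi.const_mul ((a : ℂ)⁻¹)).mono
    ((measurable_levelSlice hF).comp measurable_prodMk_right).aestronglyMeasurable
    (ae_of_all _ fun x => ?_)
  rw [norm_levelSlice ha.le, norm_mul, norm_inv, Complex.norm_real, Real.norm_of_nonneg ha.le]
  refine indicator_apply_le' (fun h => ?_) fun h => by positivity
  have h : a < ‖F x‖ := h
  rw [← div_eq_inv_mul, one_le_div ha]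
  exact h.le

theorem memLp_two_levelSlice {F : ℝ → ℂ} (hF : Measurable F) (hFi : Integrable F) {a : ℝ}
    (ha : 0 < a) : MemLp (levelSlice F a) 2 := by
  have hm : AEStronglyMeasurable (levelSlice F a) volume :=
    ((measurable_levelSlice hF).comp measurable_prodMk_right).aestronglyMeasurable
  refine (memLp_two_iff_integrable_sq_norm hm).2 ?_
  refine (integrable_levelSlice hF hFi ha).norm.congr (ae_of_all _ fun x => ?_)
  simp only [norm_levelSlice ha.le]
  by_cases h : x ∈ {x | a < ‖F x‖}
  · simp [indicator_of_mem h]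
  · simp [indicator_of_notMem h]

theorem lintegral_enorm_levelSlice {F : ℝ → ℂ} (hF : Measurable F) {a : ℝ} (ha : 0 < a)
    {p : ℝ} (hp : 0 < p) :
    ∫⁻ x, ‖levelSlice F a x‖ₑ ^ p = volume {x | a < ‖F x‖} := by
  have h : ∀ x, ‖levelSlice F a x‖ₑ ^ p = {x | a < ‖F x‖}.indicator (fun _ => 1) x := fun x => by
    rw [← ofReal_norm, norm_levelSlice ha.le]
    by_cases h : x ∈ {x | a < ‖F x‖}
    · simp [indicator_of_mem h]
    · simp [indicator_of_notMem h, hp]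
  simp_rw [h]
  rw [lintegral_indicator (measurableSet_superlevel_norm hF a)]
  simp

theorem enorm_integral_mul_le_lintegral_levelSlice {F k : ℝ → ℂ} (hF : Measurable F)
    (hFi : Integrable F) (hk : Measurable k) {C : ℝ} (hC : ∀ x, ‖k x‖ ≤ C) :
    ‖∫ x, F x * k x‖ₑ ≤ ∫⁻ a in Ioi (0 : ℝ), ‖∫ x, levelSlice F a x * k x‖ₑ := by
  have hmeas : Measurable fun p : ℝ × ℝ => levelSlice F p.2 p.1 * k p.1 :=
    (measurable_levelSlice hF).mul (hk.comp measurable_fst)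
  have hslice : ∀ x a, 0 < a → levelSlice F a x * k x =
      (Iio ‖F x‖).indicator (fun _ => F x / ‖F x‖ * k x) a := fun x a ha => by
    simp only [levelSlice, indicator, mem_Iio]
    split_ifs <;> simp
  have hlayer : ∀ x, F x * k x = ∫ a in Ioi (0 : ℝ), levelSlice F a x * k x := fun x => by
    rw [setIntegral_congr_fun measurableSet_Ioi fun a ha => hslice x a ha,
      setIntegral_indicator measurableSet_Iio, Ioi_inter_Iio, setIntegral_const]
    rcases eq_or_ne (F x) 0 with h | h
    · simp [h]
    · have : (‖F x‖ : ℂ) ≠ 0 := by simpa using h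
      simp
      field_simp
  have hint : Integrable (fun p : ℝ × ℝ => levelSlice F p.2 p.1 * k p.1)
      (volume.prod (volume.restrict (Ioi 0))) := by
    refine ⟨hmeas.aestronglyMeasurable, ?_⟩
    rw [hasFiniteIntegral_iff_enorm, lintegral_prod _ hmeas.enorm.aemeasurable]
    calc _ ≤ ∫⁻ x, ‖F x‖ₑ * ENNReal.ofReal C := by
          refine lintegral_mono fun x => ?_
          calc _ ≤ ∫⁻ a in Ioi (0 : ℝ), (Iio ‖F x‖).indicator (fun _ => ENNReal.ofReal C) a := by
                refine setLIntegral_mono' measurableSet_Ioi fun a ha => ?_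
                have ha : 0 < a := ha
                rw [enorm_mul, ← ofReal_norm, norm_levelSlice ha.le]
                by_cases h : a < ‖F x‖
                · rw [indicator_of_mem (show x ∈ {x | a < ‖F x‖} from h),
                    indicator_of_mem (show a ∈ Iio ‖F x‖ from h), ENNReal.ofReal_one, one_mul,
                    ← ofReal_norm]
                  exact ENNReal.ofReal_le_ofReal (hC x)
                · rw [indicator_of_notMem (show x ∉ {x | a < ‖F x‖} from h)]
                  simp
            _ = _ := by
                rw [setLIntegral_indicator measurableSet_Iio, inter_comm, Ioi_inter_Iio,
                  setLIntegral_const, Real.volume_Ioo, sub_zero, ofReal_norm, mul_comm]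
      _ < ⊤ := by
          rw [lintegral_mul_const _ hF.enorm]
          exact ENNReal.mul_lt_top hFi.2 ENNReal.ofReal_lt_top
  simp_rw [hlayer]
  rw [integral_integral_swap hint]
  exact enorm_integral_le_lintegral_enorm _

theorem enorm_multiplierForm_le_lintegral_left {m F G : ℝ → ℂ} (hm : Integrable m)
    (hF : Measurable F) (hFi : Integrable F) (hG : Integrable G) :
    ‖multiplierForm m F G‖ₑ ≤ ∫⁻ a in Ioi (0 : ℝ), ‖multiplierForm m (levelSlice F a) G‖ₑ := by
  have hk : Integrable fun ξ => m ξ * conj (𝓕 G ξ) :=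
    integrable_mul_of_norm_le hm (Complex.continuous_conj.comp
      (continuous_fourier_of_integrable hG)).aestronglyMeasurable
      (C := ∫ x, ‖G x‖) fun x => by rw [RCLike.norm_conj]; exact norm_fourier_le x
  rw [multiplierForm_eq_integral_mul hm hFi hG]
  refine (enorm_integral_mul_le_lintegral_levelSlice hF hFi
    (continuous_fourier_of_integrable hk).measurable norm_fourier_le).trans (le_of_eq ?_)
  refine setLIntegral_congr_fun measurableSet_Ioi fun a ha => ?_
  rw [multiplierForm_eq_integral_mul hm (integrable_levelSlice hF hFi ha) hG]

theorem enorm_multiplierForm_le_lintegral_right {m F G : ℝ → ℂ} (hm : Integrable m)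
    (hF : Integrable F) (hG : Measurable G) (hGi : Integrable G) :
    ‖multiplierForm m F G‖ₑ ≤ ∫⁻ b in Ioi (0 : ℝ), ‖multiplierForm m F (levelSlice G b)‖ₑ := by
  have hm' : Integrable fun ξ => conj (m ξ) :=
    Complex.conjCLE.toContinuousLinearMap.integrable_comp hm
  rw [multiplierForm_conj_symm, RCLike.enorm_conj]
  refine (enorm_multiplierForm_le_lintegral_left hm' hG hGi hF).trans (le_of_eq ?_)
  refine lintegral_congr fun b => ?_
  rw [multiplierForm_conj_symm m, RCLike.enorm_conj]

theorem ofReal_integral_norm_levelSlice {F : ℝ → ℂ} (hF : Measurable F) (hFi : Integrable F)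
    {a : ℝ} (ha : 0 < a) :
    ENNReal.ofReal (∫ x, ‖levelSlice F a x‖) = volume {x | a < ‖F x‖} := by
  rw [ofReal_integral_norm_eq_lintegral_enorm (integrable_levelSlice hF hFi ha),
    ← lintegral_enorm_levelSlice hF ha one_pos]
  simp

theorem multiplierForm_congr_ae {m F F' G G' : ℝ → ℂ} (hF : F =ᵐ[volume] F')
    (hG : G =ᵐ[volume] G') : multiplierForm m F G = multiplierForm m F' G' := by
  unfold multiplierForm
  simp_rw [Real.fourier_congr_ae hF, Real.fourier_congr_ae hG]

theorem fourier_zero_fun (ξ : ℝ) : 𝓕 (0 : ℝ → ℂ) ξ = 0 := by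
  simp [Real.fourier_real_eq]

theorem ae_eq_zero_of_lintegral_rpow {F : ℝ → ℂ} (hF : Measurable F)
    (h : ∫⁻ x, ENNReal.ofReal (‖F x‖ ^ (8 / 7 : ℝ)) = 0) : F =ᵐ[volume] 0 := by
  rw [lintegral_eq_zero_iff (by fun_prop)] at h
  filter_upwards [h] with x hx
  have hx : ENNReal.ofReal (‖F x‖ ^ (8 / 7 : ℝ)) = 0 := hx
  rw [ENNReal.ofReal_eq_zero] at hx
  have h0 := le_antisymm hx (by positivity)
  rw [Real.rpow_eq_zero (norm_nonneg _) (by norm_num)] at h0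
  simpa using h0

/-- Interpolation between the `L¹ → L^∞` and the `L² → L²` bound of a Fourier multiplier. -/
theorem enorm_multiplierForm_le {m F G : ℝ → ℂ} {α : ℝ} (hα : 0 < α) (hm : Integrable m)
    (hm1 : ∀ ξ, ‖m ξ‖ ≤ 1) (hA : ∀ x, ‖𝓕 m x‖ ≤ α ^ 4)
    (hF : Measurable F) (hFi : Integrable F) (hG : Measurable G) (hGi : Integrable G)
    (hF' : ∫⁻ x, ENNReal.ofReal (‖F x‖ ^ (8 / 7 : ℝ)) ≠ ⊤)
    (hG' : ∫⁻ x, ENNReal.ofReal (‖G x‖ ^ (8 / 7 : ℝ)) ≠ ⊤) :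
    ‖multiplierForm m F G‖ₑ ≤ ENNReal.ofReal (4 * α ^ 3) *
      (∫⁻ x, ENNReal.ofReal (‖F x‖ ^ (8 / 7 : ℝ))) ^ (7 / 8 : ℝ) *
      (∫⁻ x, ENNReal.ofReal (‖G x‖ ^ (8 / 7 : ℝ))) ^ (7 / 8 : ℝ) := by
  rcases eq_or_ne (∫⁻ x, ENNReal.ofReal (‖F x‖ ^ (8 / 7 : ℝ))) 0 with hU0 | hU0
  · rw [multiplierForm_congr_ae (ae_eq_zero_of_lintegral_rpow hF hU0) (ae_eq_refl G)]
    simp [multiplierForm, fourier_zero_fun]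
  rcases eq_or_ne (∫⁻ x, ENNReal.ofReal (‖G x‖ ^ (8 / 7 : ℝ))) 0 with hV0 | hV0
  · rw [multiplierForm_congr_ae (ae_eq_refl F) (ae_eq_zero_of_lintegral_rpow hG hV0)]
    simp [multiplierForm, fourier_zero_fun]
  have hU := lintegral_superlevel_mul_rpow_le hF.norm fun x => norm_nonneg (F x)
  have hV := lintegral_superlevel_mul_rpow_le hG.norm fun x => norm_nonneg (G x)
  set U := ∫⁻ x, ENNReal.ofReal (‖F x‖ ^ (8 / 7 : ℝ))
  set V := ∫⁻ x, ENNReal.ofReal (‖G x‖ ^ (8 / 7 : ℝ))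
  have e7 : ∀ {Z : ℝ≥0∞}, Z ≠ ⊤ →
      ENNReal.ofReal ((Z.toReal ^ (1 / 8 : ℝ)) ^ 7) = Z ^ (7 / 8 : ℝ) := fun {Z} hZ => by
    rw [← Real.rpow_natCast, ← Real.rpow_mul toReal_nonneg, ENNReal.toReal_rpow,
      ENNReal.ofReal_toReal (by finiteness)]
    norm_num
  have e8 : ∀ {Z : ℝ≥0∞}, Z ≠ ⊤ →
      ENNReal.ofReal ((Z.toReal ^ (1 / 8 : ℝ)) ^ 8) = Z := fun {Z} hZ => by
    rw [← Real.rpow_natCast, ← Real.rpow_mul toReal_nonneg]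
    norm_num
    exact hZ
  have hx : 0 < U.toReal ^ (1 / 8 : ℝ) := Real.rpow_pos_of_pos (ENNReal.toReal_pos hU0 hF') _
  have hy : 0 < V.toReal ^ (1 / 8 : ℝ) := Real.rpow_pos_of_pos (ENNReal.toReal_pos hV0 hG') _
  calc _ ≤ ∫⁻ a in Ioi (0 : ℝ), ∫⁻ b in Ioi (0 : ℝ),
        min (ENNReal.ofReal (α ^ 4) * (volume {x | a < ‖F x‖} * volume {x | b < ‖G x‖}))
          (volume {x | a < ‖F x‖} ^ (1 / 2 : ℝ) * volume {x | b < ‖G x‖} ^ (1 / 2 : ℝ)) := by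
        refine (enorm_multiplierForm_le_lintegral_left hm hF hFi hGi).trans
          (setLIntegral_mono' measurableSet_Ioi fun a ha => ?_)
        have hFa := integrable_levelSlice hF hFi ha
        refine (enorm_multiplierForm_le_lintegral_right hm hFa hG hGi).trans
          (setLIntegral_mono' measurableSet_Ioi fun b hb => ?_)
        have hGb := integrable_levelSlice hG hGi hb
        refine le_min ?_ ?_
        · rw [← ofReal_integral_norm_levelSlice hF hFi ha,
            ← ofReal_integral_norm_levelSlice hG hGi hb, ← ofReal_norm,
            ← ENNReal.ofReal_mul (by positivity), ← ENNReal.ofReal_mul (by positivity)]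
          exact ENNReal.ofReal_le_ofReal (norm_multiplierForm_le_L1 hm hA hFa hGb)
        · rw [← lintegral_enorm_levelSlice hF ha two_pos,
            ← lintegral_enorm_levelSlice hG hb two_pos]
          exact enorm_multiplierForm_le_L2 hm1 hFa (memLp_two_levelSlice hF hFi ha) hGb
            (memLp_two_levelSlice hG hGi hb)
    _ ≤ _ := lintegral_lintegral_min_le_of_le (measurable_volume_superlevel fun x => ‖F x‖)
        (measurable_volume_superlevel fun x => ‖G x‖) hα hx hy
        (hU.trans_eq (e8 hF').symm) (hV.trans_eq (e8 hG').symm)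
    _ = _ := by
        rw [ENNReal.ofReal_mul (by positivity), ENNReal.ofReal_mul (by positivity), e7 hF', e7 hG']

end LevelSlice

section AirySymbol
open Set ENNReal FourierTransform ComplexConjugate

/-- The symbol of `(∂ₓ - l)³`. -/
noncomputable def airySymbol (l ξ : ℝ) : ℂ := (2 * Real.pi * ξ * Complex.I - l) ^ 3

theorem airySymbol_re (l ξ : ℝ) :
    (airySymbol l ξ).re = l * (3 * (2 * Real.pi * ξ) ^ 2 - l ^ 2) := by
  have : airySymbol l ξ = ((2 * Real.pi * ξ : ℝ) * Complex.I - (l : ℝ)) ^ 3 := by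
    simp [airySymbol]
  rw [this]
  generalize 2 * Real.pi * ξ = y
  simp [pow_succ]
  ring

theorem airySymbol_im (l ξ : ℝ) :
    (airySymbol l ξ).im = -(2 * Real.pi * ξ) ^ 3 + 3 * l ^ 2 * (2 * Real.pi * ξ) := by
  have : airySymbol l ξ = ((2 * Real.pi * ξ : ℝ) * Complex.I - (l : ℝ)) ^ 3 := by
    simp [airySymbol]
  rw [this]
  generalize 2 * Real.pi * ξ = y
  simp [pow_succ]
  ring

theorem continuous_airySymbol (l : ℝ) : Continuous (airySymbol l) := by
  unfold airySymbol; fun_prop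

/-- The bounded fundamental solution of `∂ₜ + airySymbol l ξ` at time `τ`. -/
noncomputable def airyPropagator (l τ ξ : ℝ) : ℂ :=
  if 0 < τ * (airySymbol l ξ).re then SignType.sign τ * Complex.exp (-(τ * airySymbol l ξ)) else 0

theorem measurable_airyPropagator (l : ℝ) :
    Measurable fun p : ℝ × ℝ => airyPropagator l p.1 p.2 := by
  have h := (continuous_airySymbol l).measurable
  have hs : Measurable fun τ : ℝ => ((SignType.sign τ : SignType) : ℂ) := by
    have : (fun τ : ℝ => ((SignType.sign τ : SignType) : ℂ)) =
        fun τ => if 0 < τ then 1 else if τ < 0 then -1 else 0 := by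
      ext τ
      rcases lt_trichotomy τ 0 with h | h | h
      · simp [h, h.not_gt]
      · simp [h]
      · simp [h]
    rw [this]
    exact Measurable.ite measurableSet_Ioi measurable_const
      (Measurable.ite measurableSet_Iio measurable_const measurable_const)
  refine Measurable.ite (measurableSet_lt measurable_const ?_) ?_ measurable_const
  · exact measurable_fst.mul (Complex.measurable_re.comp (h.comp measurable_snd))
  · exact (hs.comp measurable_fst).mul (by fun_prop)

theorem norm_coe_sign_le (τ : ℝ) : ‖((SignType.sign τ : SignType) : ℂ)‖ ≤ 1 := by
  rcases lt_trichotomy τ 0 with h | h | h <;> simp [h]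

theorem norm_airyPropagator_le (l τ ξ : ℝ) :
    ‖airyPropagator l τ ξ‖ ≤
      if 0 < τ * (airySymbol l ξ).re then Real.exp (-(τ * (airySymbol l ξ).re)) else 0 := by
  unfold airyPropagator
  split_ifs with h
  · rw [norm_mul, Complex.norm_exp]
    simpa using mul_le_mul_of_nonneg_right (norm_coe_sign_le τ) (Real.exp_pos _).le
  · simp

theorem norm_airyPropagator_le_one (l τ ξ : ℝ) : ‖airyPropagator l τ ξ‖ ≤ 1 := by
  refine (norm_airyPropagator_le l τ ξ).trans ?_
  split_ifs with h
  · rw [Real.exp_le_one_iff]; linarith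
  · norm_num

theorem integrable_exp_neg_airySymbol {l τ : ℝ} (hl : l ≠ 0) (hτ : τ ≠ 0) :
    Integrable fun ξ => if 0 < τ * (airySymbol l ξ).re then
      Real.exp (-(τ * (airySymbol l ξ).re)) else 0 := by
  have h0 : 0 < |τ * l| := abs_pos.2 (mul_ne_zero hτ hl)
  have hg := (integrable_exp_neg_mul_sq (b := 3 * |τ * l| * (2 * Real.pi) ^ 2)
    (by positivity)).const_mul (Real.exp (|τ * l| * l ^ 2))
  have hc := (continuous_airySymbol l)
  refine hg.mono' (Measurable.ite (measurableSet_lt measurable_const (by fun_prop)) (by fun_prop)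
    measurable_const).aestronglyMeasurable (ae_of_all _ fun ξ => ?_)
  rw [← Real.exp_add]
  split_ifs with h
  · rw [Real.norm_of_nonneg (Real.exp_pos _).le, Real.exp_le_exp]
    rw [airySymbol_re] at h ⊢
    rcases abs_cases (τ * l) with ⟨h1, h2⟩ | ⟨h1, h2⟩ <;> rw [h1] <;> nlinarith
  · simpa using (Real.exp_pos _).le

theorem integrable_airyPropagator {l τ : ℝ} (hl : l ≠ 0) (hτ : τ ≠ 0) :
    Integrable (airyPropagator l τ) :=
  (integrable_exp_neg_airySymbol hl hτ).mono'
    ((measurable_airyPropagator l).comp measurable_prodMk_left).aestronglyMeasurable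
    (ae_of_all _ (norm_airyPropagator_le l τ))

theorem exists_sq_annulus_eq {l τ : ℝ} (hl : l ≠ 0) (hτ : τ ≠ 0) (w : ℝ) :
    ∃ a b : ℝ, {ξ : ℝ | 0 < τ * (airySymbol l ξ).re ∧ τ * (airySymbol l ξ).re < w} =
      {ξ | a < ξ ^ 2 ∧ ξ ^ 2 < b} := by
  have hpi := Real.pi_pos
  have key : ∀ ξ : ℝ, τ * (airySymbol l ξ).re =
      τ * l * (12 * Real.pi ^ 2) * (ξ ^ 2 - l ^ 2 / (12 * Real.pi ^ 2)) := fun ξ => by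
    rw [airySymbol_re]; field_simp; ring
  have hq : τ * l * (12 * Real.pi ^ 2) ≠ 0 := by positivity
  simp_rw [key]
  generalize l ^ 2 / (12 * Real.pi ^ 2) = r
  generalize τ * l * (12 * Real.pi ^ 2) = q at hq
  rcases lt_or_gt_of_ne hq with h | h
  · refine ⟨r + w / q, r, ?_⟩
    ext ξ
    simp only [mem_ofPred_eq]
    rw [and_comm, ← lt_sub_iff_add_lt', div_lt_iff_of_neg' h]
    refine and_congr_right fun _ => ?_
    constructor <;> intro h1 <;> nlinarith
  · refine ⟨r, r + w / q, ?_⟩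
    ext ξ
    simp only [mem_ofPred_eq]
    rw [← sub_lt_iff_lt_add' (a := ξ ^ 2), lt_div_iff₀' h]
    refine and_congr_left fun _ => ?_
    constructor <;> intro h1 <;> nlinarith

theorem setIntegral_Ioi_exp_neg_indicator {V : Type*} [NormedAddCommGroup V] [NormedSpace ℝ V]
    [CompleteSpace V] {p : ℝ} (E : V) :
    ∫ w in Ioi (0 : ℝ), (if 0 < p ∧ p < w then Real.exp (-w) • E else 0) =
      if 0 < p then Real.exp (-p) • E else 0 := by
  split_ifs with hp
  · have : ∀ w, (if 0 < p ∧ p < w then Real.exp (-w) • E else 0) =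
        (Ioi p).indicator (fun w => Real.exp (-w) • E) w := fun w => by
      simp [indicator, hp]
    simp_rw [this]
    rw [setIntegral_indicator measurableSet_Ioi, inter_eq_right.2 (Ioi_subset_Ioi hp.le),
      integral_smul_const, integral_exp_neg_Ioi]
  · simp [hp]

theorem norm_fourier_airyPropagator_le {l τ : ℝ} (hl : l ≠ 0) (hτ : τ ≠ 0) (x : ℝ) :
    ‖𝓕 (airyPropagator l τ) x‖ ≤ 36 * |τ| ^ (-1 / 3 : ℝ) := by
  have hpi := Real.pi_pos
  set t : ℝ := τ * (2 * Real.pi) ^ 3 with ht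
  set c : ℝ := -(τ * (3 * l ^ 2 * (2 * Real.pi))) - 2 * Real.pi * x with hc
  set p : ℝ → ℝ := fun ξ => τ * (airySymbol l ξ).re with hp
  set E : ℝ → ℂ := fun ξ => Complex.exp (Complex.I * (t * ξ ^ 3 + c * ξ : ℝ)) with hE
  have hEc : Continuous E := continuous_cexp_cubic t c
  have hE1 : ∀ ξ, ‖E ξ‖ = 1 := fun ξ => norm_cexp_I_mul_ofReal _
  have hpc : Continuous p :=
    continuous_const.mul (Complex.continuous_re.comp (continuous_airySymbol l))
  have hint : ∀ ξ, 𝐞 (-(ξ * x)) • airyPropagator l τ ξ = SignType.sign τ *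
      (if 0 < p ξ then Real.exp (-p ξ) • E ξ else 0) := fun ξ => by
    simp only [airyPropagator, hp, hE]
    split_ifs with h
    · rw [Circle.smul_def, Real.fourierChar_apply, smul_eq_mul, mul_left_comm, ← Complex.exp_add,
        Complex.real_smul, Complex.ofReal_exp, ← Complex.exp_add]
      congr 2
      conv_lhs => rw [← Complex.re_add_im (airySymbol l ξ), airySymbol_im]
      rw [ht, hc]
      push_cast
      ring
    · simp
  set Φ : ℝ × ℝ → ℂ := fun q =>
    if 0 < p q.1 ∧ p q.1 < q.2 then Real.exp (-q.2) • E q.1 else 0 with hΦ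
  have hΦm : Measurable Φ := by
    have hp1 : Measurable fun q : ℝ × ℝ => p q.1 := hpc.measurable.comp measurable_fst
    refine Measurable.ite ((measurableSet_lt measurable_const hp1).inter
      (measurableSet_lt hp1 measurable_snd)) ?_ measurable_const
    exact (Real.measurable_exp.comp measurable_snd.neg).smul (hEc.measurable.comp measurable_fst)
  have hΦn : ∀ ξ w, ‖Φ (ξ, w)‖ = if 0 < p ξ ∧ p ξ < w then Real.exp (-w) • (1 : ℝ) else 0 :=
    fun ξ w => by
      simp only [hΦ]
      split_ifs
      · rw [norm_smul, hE1, Real.norm_of_nonneg (Real.exp_pos _).le, smul_eq_mul]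
      · exact norm_zero
  have hΦi : Integrable Φ (volume.prod (volume.restrict (Ioi 0))) := by
    rw [integrable_prod_iff hΦm.aestronglyMeasurable]
    refine ⟨ae_of_all _ fun ξ => ?_, ?_⟩
    · refine (integrableOn_exp_neg_Ioi 0).mono'
        (hΦm.comp measurable_prodMk_left).aestronglyMeasurable (ae_of_all _ fun w => ?_)
      rw [hΦn]
      split_ifs
      · simp
      · exact (Real.exp_pos _).le
    · simp_rw [hΦn, setIntegral_Ioi_exp_neg_indicator, smul_eq_mul, mul_one]
      exact integrable_exp_neg_airySymbol hl hτ
  have hw : ∀ w, ‖∫ ξ, Φ (ξ, w)‖ ≤ Real.exp (-w) * (36 * |τ| ^ (-1 / 3 : ℝ)) := fun w => by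
    obtain ⟨a, b, hab⟩ := exists_sq_annulus_eq hl hτ w
    have h1 : ∀ ξ, Φ (ξ, w) = {ξ | a < ξ ^ 2 ∧ ξ ^ 2 < b}.indicator
        (fun ξ => Real.exp (-w) • E ξ) ξ := fun ξ => by
      rw [← hab]; simp [hΦ, indicator, hp]
    simp_rw [h1]
    rw [integral_indicator (measurableSet_sq_annulus a b), integral_smul, norm_smul,
      Real.norm_of_nonneg (Real.exp_pos _).le]
    gcongr
    refine (norm_setIntegral_annulus_cexp_cubic_le (mul_ne_zero hτ (by positivity)) c a b).trans ?_
    gcongr 36 * ?_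
    refine Real.rpow_le_rpow_of_nonpos (abs_pos.2 hτ) ?_ (by norm_num)
    rw [abs_mul]
    refine le_mul_of_one_le_right (abs_nonneg _) ?_
    rw [abs_of_pos (by positivity)]
    exact one_le_pow₀ (by linarith [Real.pi_gt_three])
  rw [Real.fourier_real_eq]
  simp_rw [hint]
  rw [integral_const_mul, norm_mul]
  refine (mul_le_of_le_one_left (norm_nonneg _) (norm_coe_sign_le τ)).trans ?_
  have h2 : ∀ ξ, (if 0 < p ξ then Real.exp (-p ξ) • E ξ else 0) =
      ∫ w in Ioi (0 : ℝ), Φ (ξ, w) := fun ξ => (setIntegral_Ioi_exp_neg_indicator (E ξ)).symm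
  simp_rw [h2]
  rw [integral_integral_swap (f := fun ξ w => Φ (ξ, w)) hΦi]
  calc _ ≤ ∫ w in Ioi (0 : ℝ), Real.exp (-w) * (36 * |τ| ^ (-1 / 3 : ℝ)) :=
        norm_integral_le_of_norm_le ((integrableOn_exp_neg_Ioi 0).mul_const _)
          (ae_of_all _ hw)
    _ = _ := by rw [integral_mul_const, integral_exp_neg_Ioi]; simp

theorem enorm_multiplierForm_airyPropagator_le {l τ : ℝ} (hl : l ≠ 0) (hτ : τ ≠ 0) {F G : ℝ → ℂ}
    (hF : Measurable F) (hFi : Integrable F) (hG : Measurable G) (hGi : Integrable G)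
    (hF' : ∫⁻ x, ENNReal.ofReal (‖F x‖ ^ (8 / 7 : ℝ)) ≠ ⊤)
    (hG' : ∫⁻ x, ENNReal.ofReal (‖G x‖ ^ (8 / 7 : ℝ)) ≠ ⊤) :
    ‖multiplierForm (airyPropagator l τ) F G‖ₑ ≤ ENNReal.ofReal (144 * |τ| ^ (-1 / 4 : ℝ)) *
      (∫⁻ x, ENNReal.ofReal (‖F x‖ ^ (8 / 7 : ℝ))) ^ (7 / 8 : ℝ) *
      (∫⁻ x, ENNReal.ofReal (‖G x‖ ^ (8 / 7 : ℝ))) ^ (7 / 8 : ℝ) := by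
  have hA : 0 < 36 * |τ| ^ (-1 / 3 : ℝ) := by positivity
  have hA4 : ((36 * |τ| ^ (-1 / 3 : ℝ)) ^ (1 / 4 : ℝ)) ^ 4 = 36 * |τ| ^ (-1 / 3 : ℝ) := by
    rw [← Real.rpow_natCast, ← Real.rpow_mul hA.le]; norm_num
  refine (enorm_multiplierForm_le (α := (36 * |τ| ^ (-1 / 3 : ℝ)) ^ (1 / 4 : ℝ)) (by positivity)
    (integrable_airyPropagator hl hτ) (norm_airyPropagator_le_one l τ)
    (fun x => (norm_fourier_airyPropagator_le hl hτ x).trans_eq hA4.symm)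
    hF hFi hG hGi hF' hG').trans ?_
  gcongr ENNReal.ofReal ?_ * _ * _
  rw [← Real.rpow_natCast, ← Real.rpow_mul hA.le, Real.mul_rpow (by norm_num) (by positivity),
    ← Real.rpow_mul (abs_nonneg _)]
  norm_num
  have : (36 : ℝ) ^ (3 / 4 : ℝ) ≤ 36 ^ (1 : ℝ) :=
    Real.rpow_le_rpow_of_exponent_le (by norm_num) (by norm_num)
  rw [Real.rpow_one] at this
  have h2 : 0 < |τ| ^ (-(1 / 4) : ℝ) := by positivity
  nlinarith

end AirySymbol

section PartialFourier
open Set ENNReal FourierTransform ComplexConjugate ContDiff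

theorem hasDerivAt_fst_slice {u : ℝ × ℝ → ℝ} (hu : ContDiff ℝ ∞ u) (x t : ℝ) :
    HasDerivAt (fun x => u (x, t)) (fderiv ℝ u (x, t) (1, 0)) x := by
  have h := (hu.differentiable (by simp) (x, t)).hasFDerivAt
  exact h.comp_hasDerivAt x ((hasDerivAt_id x).prodMk (hasDerivAt_const x t))

theorem hasDerivAt_snd_slice {u : ℝ × ℝ → ℝ} (hu : ContDiff ℝ ∞ u) (x t : ℝ) :
    HasDerivAt (fun t => u (x, t)) (fderiv ℝ u (x, t) (0, 1)) t := by
  have h := (hu.differentiable (by simp) (x, t)).hasFDerivAt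
  exact h.comp_hasDerivAt t ((hasDerivAt_const t x).prodMk (hasDerivAt_id t))

theorem pdx_eq_fderiv {u : ℝ × ℝ → ℝ} (hu : ContDiff ℝ ∞ u) :
    pdx u = fun p => fderiv ℝ u p (1, 0) :=
  funext fun p => (hasDerivAt_fst_slice hu p.1 p.2).deriv

theorem pdt_eq_fderiv {u : ℝ × ℝ → ℝ} (hu : ContDiff ℝ ∞ u) :
    pdt u = fun p => fderiv ℝ u p (0, 1) :=
  funext fun p => (hasDerivAt_snd_slice hu p.1 p.2).deriv

theorem contDiff_pdx {u : ℝ × ℝ → ℝ} (hu : ContDiff ℝ ∞ u) : ContDiff ℝ ∞ (pdx u) := by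
  rw [pdx_eq_fderiv hu]
  exact (hu.fderiv_right (m := ∞) (by simp)).clm_apply contDiff_const

theorem contDiff_pdt {u : ℝ × ℝ → ℝ} (hu : ContDiff ℝ ∞ u) : ContDiff ℝ ∞ (pdt u) := by
  rw [pdt_eq_fderiv hu]
  exact (hu.fderiv_right (m := ∞) (by simp)).clm_apply contDiff_const

theorem hasCompactSupport_pdx {u : ℝ × ℝ → ℝ} (hu : ContDiff ℝ ∞ u) (hc : HasCompactSupport u) :
    HasCompactSupport (pdx u) := by
  rw [pdx_eq_fderiv hu]
  exact hc.fderiv_apply ℝ _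

theorem hasCompactSupport_pdt {u : ℝ × ℝ → ℝ} (hu : ContDiff ℝ ∞ u) (hc : HasCompactSupport u) :
    HasCompactSupport (pdt u) := by
  rw [pdt_eq_fderiv hu]
  exact hc.fderiv_apply ℝ _

theorem exists_eq_zero_of_lt_abs {u : ℝ × ℝ → ℝ} (hc : HasCompactSupport u) :
    ∃ M : ℝ, 0 < M ∧ (∀ x t, M < |x| → u (x, t) = 0) ∧ ∀ x t, M < |t| → u (x, t) = 0 := by
  obtain ⟨M, hM0, hM⟩ := hc.isCompact.isBounded.exists_pos_norm_le
  refine ⟨M, hM0, fun x t h => ?_, fun x t h => ?_⟩ <;>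
  · by_contra h0
    have := hM _ (subset_tsupport u h0)
    rw [Prod.norm_def, sup_le_iff, Real.norm_eq_abs, Real.norm_eq_abs] at this
    linarith [this.1, this.2]

/-- The restriction of `u` to a fixed time, as a complex-valued function. -/
noncomputable def timeSlice (u : ℝ × ℝ → ℝ) (t x : ℝ) : ℂ := u (x, t)

theorem contDiff_timeSlice {u : ℝ × ℝ → ℝ} (hu : ContDiff ℝ ∞ u) (t : ℝ) :
    ContDiff ℝ ∞ (timeSlice u t) :=
  Complex.ofRealCLM.contDiff.comp (hu.comp (contDiff_prodMk_left t))

theorem hasCompactSupport_timeSlice {u : ℝ × ℝ → ℝ} (hc : HasCompactSupport u) (t : ℝ) :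
    HasCompactSupport (timeSlice u t) := by
  obtain ⟨M, -, hM, -⟩ := exists_eq_zero_of_lt_abs hc
  refine HasCompactSupport.intro (isCompact_Icc (a := -M) (b := M)) fun x hx => ?_
  have : M < |x| := by
    by_contra h
    exact hx (abs_le.1 (not_lt.1 h))
  simp [timeSlice, hM x t this]

theorem integrable_timeSlice {u : ℝ × ℝ → ℝ} (hu : ContDiff ℝ ∞ u) (hc : HasCompactSupport u)
    (t : ℝ) : Integrable (timeSlice u t) :=
  (contDiff_timeSlice hu t).continuous.integrable_of_hasCompactSupport
    (hasCompactSupport_timeSlice hc t)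

theorem fourier_timeSlice_pdx {u : ℝ × ℝ → ℝ} (hu : ContDiff ℝ ∞ u) (hc : HasCompactSupport u)
    (t ξ : ℝ) :
    𝓕 (timeSlice (pdx u) t) ξ = 2 * Real.pi * ξ * Complex.I * 𝓕 (timeSlice u t) ξ := by
  have hd : deriv (timeSlice u t) = timeSlice (pdx u) t := funext fun x => by
    rw [pdx_eq_fderiv hu]
    exact (hasDerivAt_fst_slice hu x t).ofReal_comp.deriv
  have := Real.fourier_deriv (integrable_timeSlice hu hc t)
    ((contDiff_timeSlice hu t).differentiable (by simp))
    (by rw [hd]; exact integrable_timeSlice (contDiff_pdx hu) (hasCompactSupport_pdx hu hc) t)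
  rw [← hd, this]
  simp only [smul_eq_mul]
  ring

theorem fourier_timeSlice_eq (u : ℝ × ℝ → ℝ) (t ξ : ℝ) :
    𝓕 (timeSlice u t) ξ = ∫ x, 𝐞 (-(x * ξ)) • (u (x, t) : ℂ) :=
  Real.fourier_real_eq _ _

theorem exists_norm_fourier_timeSlice_le {u : ℝ × ℝ → ℝ} (hu : ContDiff ℝ ∞ u)
    (hc : HasCompactSupport u) :
    ∃ C M : ℝ, ∀ t ξ, ‖𝓕 (timeSlice u t) ξ‖ ≤ (Icc (-M) M).indicator (fun _ => C) t := by
  obtain ⟨M, hM0, hMx, hMt⟩ := exists_eq_zero_of_lt_abs hc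
  obtain ⟨B, hB⟩ := hc.exists_bound_of_continuous hu.continuous
  have hC : ∀ t ξ, ‖𝓕 (timeSlice u t) ξ‖ ≤ ∫ x, (Icc (-M) M).indicator (fun _ => B) x :=
    fun t ξ => by
      refine norm_fourier_le ξ |>.trans (integral_mono (integrable_timeSlice hu hc t).norm
        ((integrable_indicator_iff measurableSet_Icc).2 (by simp)) fun x => ?_)
      refine le_indicator_apply (fun _ => ?_) fun hx => ?_
      · simpa [timeSlice] using hB (x, t)
      · have : M < |x| := by
          by_contra h
          exact hx (abs_le.1 (not_lt.1 h))
        simp [timeSlice, hMx x t this]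
  refine ⟨_, M, fun t ξ => le_indicator_apply (fun _ => hC t ξ) fun ht => ?_⟩
  have : M < |t| := by
    by_contra h
    exact ht (abs_le.1 (not_lt.1 h))
  have h0 : timeSlice u t = 0 := funext fun x => by simp [timeSlice, hMt x t this]
  rw [h0, fourier_zero_fun, norm_zero]

theorem stronglyMeasurable_fourier_timeSlice {u : ℝ × ℝ → ℝ} (hu : Continuous u) :
    StronglyMeasurable fun p : ℝ × ℝ => 𝓕 (timeSlice u p.2) p.1 := by
  simp_rw [fourier_timeSlice_eq]
  refine StronglyMeasurable.integral_prod_right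
    (f := fun (p : ℝ × ℝ) (x : ℝ) => 𝐞 (-(x * p.1)) • (u (x, p.2) : ℂ)) ?_
  refine Continuous.stronglyMeasurable ?_
  have := Real.continuous_fourierChar
  simp only [Function.uncurry_def]
  fun_prop

theorem hasDerivAt_fourier_timeSlice {u : ℝ × ℝ → ℝ} (hu : ContDiff ℝ ∞ u)
    (hc : HasCompactSupport u) (t ξ : ℝ) :
    HasDerivAt (fun t => 𝓕 (timeSlice u t) ξ) (𝓕 (timeSlice (pdt u) t) ξ) t := by
  have hc' := hasCompactSupport_pdt hu hc
  obtain ⟨M, hM0, hMx, -⟩ := exists_eq_zero_of_lt_abs hc'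
  obtain ⟨B, hB⟩ := hc'.exists_bound_of_continuous (contDiff_pdt hu).continuous
  simp_rw [fourier_timeSlice_eq]
  have hcont : ∀ {v : ℝ × ℝ → ℝ}, Continuous v → ∀ t,
      Continuous fun x => 𝐞 (-(x * ξ)) • (v (x, t) : ℂ) := fun {v} hv t => by
    have := Real.continuous_fourierChar
    fun_prop
  refine (hasDerivAt_integral_of_dominated_loc_of_deriv_le
    (F := fun t x => 𝐞 (-(x * ξ)) • (u (x, t) : ℂ))
    (F' := fun t x => 𝐞 (-(x * ξ)) • (pdt u (x, t) : ℂ))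
    (bound := (Icc (-M) M).indicator fun _ => B) Filter.univ_mem
    (Filter.Eventually.of_forall fun t => (hcont hu.continuous t).aestronglyMeasurable) ?_
    (hcont (contDiff_pdt hu).continuous t).aestronglyMeasurable ?_ ?_ ?_).2
  · have := (Real.fourierIntegral_convergent_iff (μ := volume) (f := timeSlice u t) ξ).2
      (integrable_timeSlice hu hc t)
    simpa [mul_comm, timeSlice] using this
  · refine ae_of_all _ fun x s _ => ?_
    rw [Circle.norm_smul]
    refine le_indicator_apply (fun _ => ?_) fun hx => ?_
    · simpa using hB (x, s)
    · have : M < |x| := by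
        by_contra h
        exact hx (abs_le.1 (not_lt.1 h))
      simp [hMx x s this]
  · exact (integrable_indicator_iff measurableSet_Icc).2 (by simp)
  · refine ae_of_all _ fun x s _ => ?_
    have h := (hasDerivAt_snd_slice hu x s).ofReal_comp
    rw [pdt_eq_fderiv hu]
    exact h.const_smul (𝐞 (-(x * ξ)) : Circle)

/-- Multiplication by the exponential weight in the space variable. -/
noncomputable def expWeight (l : ℝ) (u : ℝ × ℝ → ℝ) (p : ℝ × ℝ) : ℝ := Real.exp (l * p.1) * u p

theorem contDiff_expWeight {u : ℝ × ℝ → ℝ} (hu : ContDiff ℝ ∞ u) (l : ℝ) :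
    ContDiff ℝ ∞ (expWeight l u) :=
  (Real.contDiff_exp.comp (contDiff_const.mul contDiff_fst)).mul hu

theorem hasCompactSupport_expWeight {u : ℝ × ℝ → ℝ} (hc : HasCompactSupport u) (l : ℝ) :
    HasCompactSupport (expWeight l u) := hc.mul_left

theorem pdt_expWeight {u : ℝ × ℝ → ℝ} (hu : ContDiff ℝ ∞ u) (l : ℝ) :
    pdt (expWeight l u) = expWeight l (pdt u) := by
  funext p
  rw [pdt_eq_fderiv hu]
  exact ((hasDerivAt_snd_slice hu p.1 p.2).const_mul (Real.exp (l * p.1))).deriv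

theorem expWeight_pdx {u : ℝ × ℝ → ℝ} (hu : ContDiff ℝ ∞ u) (l : ℝ) (p : ℝ × ℝ) :
    expWeight l (pdx u) p = pdx (expWeight l u) p - l * expWeight l u p := by
  have h1 : HasDerivAt (fun x => Real.exp (l * x)) (Real.exp (l * p.1) * l) p.1 := by
    simpa using ((hasDerivAt_id p.1).const_mul l).exp
  have h := (h1.mul (hasDerivAt_fst_slice hu p.1 p.2)).deriv
  have h' : pdx (expWeight l u) p = Real.exp (l * p.1) * l * u (p.1, p.2) +
    Real.exp (l * p.1) * fderiv ℝ u (p.1, p.2) (1, 0) := h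
  rw [h', pdx_eq_fderiv hu]
  simp only [expWeight]
  ring

theorem fourier_timeSlice_add {u v : ℝ × ℝ → ℝ} (hu : ContDiff ℝ ∞ u) (hc : HasCompactSupport u)
    (hv : ContDiff ℝ ∞ v) (hcv : HasCompactSupport v) (a b t ξ : ℝ) :
    𝓕 (timeSlice (fun p => a * u p + b * v p) t) ξ =
      a * 𝓕 (timeSlice u t) ξ + b * 𝓕 (timeSlice v t) ξ := by
  have h1 := (Real.fourierIntegral_convergent_iff (μ := volume) ξ).2 (integrable_timeSlice hu hc t)
  have h2 := (Real.fourierIntegral_convergent_iff (μ := volume) ξ).2 (integrable_timeSlice hv hcv t)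
  simp only [Real.fourier_eq]
  rw [← integral_const_mul, ← integral_const_mul,
    ← integral_add (h1.const_mul _) (h2.const_mul _)]
  refine integral_congr_ae (ae_of_all _ fun x => ?_)
  simp only [timeSlice, Circle.smul_def, smul_eq_mul]
  push_cast
  ring

theorem fourier_timeSlice_expWeight_pdx {u : ℝ × ℝ → ℝ} (hu : ContDiff ℝ ∞ u)
    (hc : HasCompactSupport u) (l t ξ : ℝ) :
    𝓕 (timeSlice (expWeight l (pdx u)) t) ξ =
      (2 * Real.pi * ξ * Complex.I - l) * 𝓕 (timeSlice (expWeight l u) t) ξ := by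
  have hw := contDiff_expWeight hu l
  have hwc := hasCompactSupport_expWeight hc l
  have h : expWeight l (pdx u) = fun p => 1 * pdx (expWeight l u) p + -l * expWeight l u p :=
    funext fun p => by rw [expWeight_pdx hu]; ring
  rw [h, fourier_timeSlice_add (contDiff_pdx hw) (hasCompactSupport_pdx hw hwc) hw hwc,
    fourier_timeSlice_pdx hw hwc]
  push_cast
  ring

theorem fourier_timeSlice_airy {u : ℝ × ℝ → ℝ} (hu : ContDiff ℝ ∞ u)
    (hc : HasCompactSupport u) (l t ξ : ℝ) :
    𝓕 (timeSlice (expWeight l fun p => pdt u p + pdx (pdx (pdx u)) p) t) ξ =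
      𝓕 (timeSlice (pdt (expWeight l u)) t) ξ +
        airySymbol l ξ * 𝓕 (timeSlice (expWeight l u) t) ξ := by
  have h1 := contDiff_pdx hu
  have hc1 := hasCompactSupport_pdx hu hc
  have h2 := contDiff_pdx h1
  have hc2 := hasCompactSupport_pdx h1 hc1
  have h3 := contDiff_pdx h2
  have hc3 := hasCompactSupport_pdx h2 hc2
  have ht := contDiff_pdt hu
  have hct := hasCompactSupport_pdt hu hc
  have h : (expWeight l fun p => pdt u p + pdx (pdx (pdx u)) p) =
      fun p => 1 * expWeight l (pdt u) p + 1 * expWeight l (pdx (pdx (pdx u))) p :=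
    funext fun p => by simp only [expWeight]; ring
  rw [h, fourier_timeSlice_add (contDiff_expWeight ht l) (hasCompactSupport_expWeight hct l)
    (contDiff_expWeight h3 l) (hasCompactSupport_expWeight hc3 l),
    fourier_timeSlice_expWeight_pdx h2 hc2, fourier_timeSlice_expWeight_pdx h1 hc1,
    fourier_timeSlice_expWeight_pdx hu hc, pdt_expWeight hu, airySymbol]
  push_cast
  ring

end PartialFourier

section Duhamel
open Set ENNReal FourierTransform ComplexConjugate ContDiff

theorem eq_integral_airyPropagator_mul {l ξ : ℝ} (ha : (airySymbol l ξ).re ≠ 0) {φ η : ℝ → ℂ}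
    {φ' : ℝ → ℂ} (hφ : ∀ s, HasDerivAt φ (φ' s) s) (hφ' : Continuous φ')
    (hc : HasCompactSupport φ) (hη : ∀ s, η s = φ' s + airySymbol l ξ * φ s) (t : ℝ) :
    φ t = ∫ s, airyPropagator l (t - s) ξ * η s := by
  set z := airySymbol l ξ with hz
  set ψ : ℝ → ℂ := fun s => Complex.exp (s * z) * φ s with hψ
  have hψd : ∀ s : ℝ, HasDerivAt ψ (Complex.exp (s * z) * η s) s := fun s => by
    have h1 : HasDerivAt (fun s : ℝ => Complex.exp (s * z)) (Complex.exp (s * z) * z) s := by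
      simpa using ((hasDerivAt_id s).ofReal_comp.mul_const z).cexp
    exact (h1.mul (hφ s)).congr_deriv (by rw [hη]; ring)
  have hφc : Continuous φ := continuous_iff_continuousAt.2 fun s => (hφ s).continuousAt
  have hderiv : deriv ψ = fun s : ℝ => Complex.exp (s * z) * η s := funext fun s => (hψd s).deriv
  have hψ1 : ContDiff ℝ 1 ψ := by
    rw [contDiff_one_iff_deriv]
    refine ⟨fun s => (hψd s).differentiableAt, ?_⟩
    rw [hderiv]
    simp_rw [hη]
    fun_prop
  have hψc : HasCompactSupport ψ := hc.mul_left
  have hexp : Complex.exp (-(t * z)) * ψ t = φ t := by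
    rw [hψ, ← mul_assoc, ← Complex.exp_add]; simp
  have hterm : ∀ s, Complex.exp (-((t - s : ℝ) * z)) * η s =
      Complex.exp (-(t * z)) * deriv ψ s := fun s => by
    rw [hderiv, ← mul_assoc, ← Complex.exp_add]
    congr 2; push_cast; ring
  rcases lt_or_gt_of_ne ha with ha | ha
  · have h : ∀ s, airyPropagator l (t - s) ξ * η s =
        (Ioi t).indicator (fun s => -(Complex.exp (-(t * z)) * deriv ψ s)) s := fun s => by
      simp only [airyPropagator, ← hz]
      by_cases hs : t < s
      · have h0 : t - s < 0 := sub_neg.2 hs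
        rw [if_pos (mul_pos_of_neg_of_neg h0 ha), indicator_of_mem (mem_Ioi.2 hs), ← hterm]
        simp [h0]
      · rw [if_neg (by nlinarith), indicator_of_notMem (by simpa using hs), zero_mul]
    simp_rw [h]
    rw [integral_indicator measurableSet_Ioi, integral_neg, integral_const_mul,
      hψc.integral_Ioi_deriv_eq hψ1, ← hexp]
    ring
  · have h : ∀ s, airyPropagator l (t - s) ξ * η s =
        (Iio t).indicator (fun s => Complex.exp (-(t * z)) * deriv ψ s) s := fun s => by
      simp only [airyPropagator, ← hz]
      by_cases hs : s < t
      · have h0 : 0 < t - s := sub_pos.2 hs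
        rw [if_pos (mul_pos h0 ha), indicator_of_mem (mem_Iio.2 hs), ← hterm]
        simp [h0]
      · rw [if_neg (by nlinarith), indicator_of_notMem (by simpa using hs), zero_mul]
    simp_rw [h]
    rw [integral_indicator measurableSet_Iio, integral_const_mul, ← integral_Iic_eq_integral_Iio,
      hψc.integral_Iic_deriv_eq hψ1, ← hexp]

theorem ae_airySymbol_re_ne_zero {l : ℝ} (hl : l ≠ 0) : ∀ᵐ ξ : ℝ, (airySymbol l ξ).re ≠ 0 := by
  have hpi := Real.pi_pos
  have hfin : {ξ : ℝ | (airySymbol l ξ).re = 0} ⊆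
      {|l| / √12 / Real.pi, -(|l| / √12 / Real.pi)} := by
    intro ξ hξ
    have hξ : (airySymbol l ξ).re = 0 := hξ
    rw [airySymbol_re, mul_eq_zero, or_iff_right hl] at hξ
    have h : ξ ^ 2 = (|l| / √12 / Real.pi) ^ 2 := by
      rw [div_pow, div_pow, sq_abs, Real.sq_sqrt (by norm_num)]
      field_simp
      linarith
    simpa using sq_eq_sq_iff_eq_or_eq_neg.1 h
  rw [ae_iff]
  simp only [ne_eq, not_not]
  exact measure_mono_null hfin ((Set.toFinite _).measure_zero _)

theorem integral_mul_eq_integral_fourier {u v : ℝ × ℝ → ℝ} (hu : ContDiff ℝ ∞ u)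
    (hcu : HasCompactSupport u) (hv : ContDiff ℝ ∞ v) (hcv : HasCompactSupport v) (t : ℝ) :
    ((∫ x, u (x, t) * v (x, t) : ℝ) : ℂ) =
      ∫ ξ, 𝓕 (timeSlice u t) ξ * conj (𝓕 (timeSlice v t) ξ) := by
  have h := SchwartzMap.integral_inner_fourier_fourier
    ((hasCompactSupport_timeSlice hcv t).toSchwartzMap (contDiff_timeSlice hv t))
    ((hasCompactSupport_timeSlice hcu t).toSchwartzMap (contDiff_timeSlice hu t))
  refine Eq.trans ?_ (Eq.trans h.symm ?_)
  · rw [← integral_complex_ofReal]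
    refine integral_congr_ae (ae_of_all _ fun x => ?_)
    change _ = inner ℂ (timeSlice v t x) (timeSlice u t x)
    simp [timeSlice]
  · refine integral_congr_ae (ae_of_all _ fun x => ?_)
    change inner ℂ (𝓕 (timeSlice v t) x) (𝓕 (timeSlice u t) x) = _
    simp

theorem integrable_fourier_timeSlice {u : ℝ × ℝ → ℝ} (hu : ContDiff ℝ ∞ u)
    (hc : HasCompactSupport u) (t : ℝ) : Integrable (𝓕 (timeSlice u t)) :=
  (𝓕 ((hasCompactSupport_timeSlice hc t).toSchwartzMap (contDiff_timeSlice hu t))).integrable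

theorem integral_expWeight_mul_eq {f v : ℝ × ℝ → ℝ} (hf : ContDiff ℝ ∞ f)
    (hcf : HasCompactSupport f) (hv : ContDiff ℝ ∞ v) (hcv : HasCompactSupport v) {l : ℝ}
    (hl : l ≠ 0) (t : ℝ) :
    ((∫ x, expWeight l f (x, t) * v (x, t) : ℝ) : ℂ) =
      ∫ s, multiplierForm (airyPropagator l (t - s))
        (timeSlice (expWeight l fun p => pdt f p + pdx (pdx (pdx f)) p) s) (timeSlice v t) := by
  have hg := contDiff_expWeight hf l
  have hcg := hasCompactSupport_expWeight hcf l
  set h := expWeight l fun p => pdt f p + pdx (pdx (pdx f)) p with hh_def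
  have hh : ContDiff ℝ ∞ h := contDiff_expWeight
    ((contDiff_pdt hf).add (contDiff_pdx (contDiff_pdx (contDiff_pdx hf)))) l
  have hch : HasCompactSupport h := hasCompactSupport_expWeight
    ((hasCompactSupport_pdt hf hcf).add (hasCompactSupport_pdx (contDiff_pdx (contDiff_pdx hf))
      (hasCompactSupport_pdx (contDiff_pdx hf) (hasCompactSupport_pdx hf hcf)))) l
  rw [integral_mul_eq_integral_fourier hg hcg hv hcv]
  have hduh : ∀ᵐ ξ : ℝ, 𝓕 (timeSlice (expWeight l f) t) ξ * conj (𝓕 (timeSlice v t) ξ) =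
      ∫ s, airyPropagator l (t - s) ξ * 𝓕 (timeSlice h s) ξ * conj (𝓕 (timeSlice v t) ξ) := by
    filter_upwards [ae_airySymbol_re_ne_zero hl] with ξ hξ
    rw [integral_mul_const]
    congr 1
    refine eq_integral_airyPropagator_mul hξ (φ := fun s => 𝓕 (timeSlice (expWeight l f) s) ξ)
      (fun s => hasDerivAt_fourier_timeSlice hg hcg s ξ) ?_ ?_
      (fun s => fourier_timeSlice_airy hf hcf l s ξ) t
    · exact continuous_iff_continuousAt.2 fun s => (hasDerivAt_fourier_timeSlice
        (contDiff_pdt hg) (hasCompactSupport_pdt hg hcg) s ξ).continuousAt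
    · obtain ⟨C, M, hCM⟩ := exists_norm_fourier_timeSlice_le hg hcg
      refine HasCompactSupport.intro (isCompact_Icc (a := -M) (b := M)) fun s hs => ?_
      simpa [indicator_of_notMem hs] using hCM s ξ
  rw [integral_congr_ae hduh]
  refine integral_integral_swap (f := fun ξ s =>
    airyPropagator l (t - s) ξ * 𝓕 (timeSlice h s) ξ * conj (𝓕 (timeSlice v t) ξ)) ?_
  obtain ⟨C, M, hCM⟩ := exists_norm_fourier_timeSlice_le hh hch
  have hdom : Integrable fun p : ℝ × ℝ => ‖𝓕 (timeSlice v t) p.1‖ *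
      (Icc (-M) M).indicator (fun _ => C) p.2 :=
    (integrable_fourier_timeSlice hv hcv t).norm.mul_prod
      ((integrable_indicator_iff measurableSet_Icc).2 (by simp))
  refine hdom.mono' ?_ (ae_of_all _ fun p => ?_)
  · refine AEStronglyMeasurable.mul (AEStronglyMeasurable.mul ?_ ?_) ?_
    · exact ((measurable_airyPropagator l).comp
        ((measurable_const.sub measurable_snd).prodMk measurable_fst)).aestronglyMeasurable
    · exact (stronglyMeasurable_fourier_timeSlice hh.continuous).aestronglyMeasurable
    · exact (Complex.continuous_conj.comp ((continuous_fourier_of_integrable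
        (integrable_timeSlice hv hcv t)).comp continuous_fst)).aestronglyMeasurable
  · simp only [Function.uncurry]
    rw [norm_mul, norm_mul, RCLike.norm_conj, mul_comm]
    gcongr
    exact (mul_le_of_le_one_left (norm_nonneg _) (norm_airyPropagator_le_one _ _ _)).trans (hCM _ _)

end Duhamel

section SpaceTime
open Set ENNReal FourierTransform ComplexConjugate ContDiff

theorem lintegral_timeSlice_rpow_ne_top {u : ℝ × ℝ → ℝ} (hu : ContDiff ℝ ∞ u)
    (hc : HasCompactSupport u) (t : ℝ) :
    ∫⁻ x, ENNReal.ofReal (‖timeSlice u t x‖ ^ (8 / 7 : ℝ)) ≠ ⊤ := by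
  have h1 : Continuous fun x => ‖timeSlice u t x‖ ^ (8 / 7 : ℝ) :=
    (contDiff_timeSlice hu t).continuous.norm.rpow_const fun _ => Or.inr (by norm_num)
  have h2 : HasCompactSupport fun x => ‖timeSlice u t x‖ ^ (8 / 7 : ℝ) :=
    (hasCompactSupport_timeSlice hc t).comp_left (g := fun z : ℂ => ‖z‖ ^ (8 / 7 : ℝ)) (by simp)
  exact (h1.integrable_of_hasCompactSupport h2).lintegral_lt_top.ne

/-- The `L^{8/7}` norm of `u (·, t)`. -/
noncomputable def sliceNorm (u : ℝ × ℝ → ℝ) (t : ℝ) : ℝ :=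
  ((∫⁻ x, ENNReal.ofReal (‖timeSlice u t x‖ ^ (8 / 7 : ℝ))) ^ (7 / 8 : ℝ)).toReal

theorem ofReal_sliceNorm {u : ℝ × ℝ → ℝ} (hu : ContDiff ℝ ∞ u) (hc : HasCompactSupport u) (t : ℝ) :
    ENNReal.ofReal (sliceNorm u t) =
      (∫⁻ x, ENNReal.ofReal (‖timeSlice u t x‖ ^ (8 / 7 : ℝ))) ^ (7 / 8 : ℝ) :=
  ofReal_toReal (rpow_ne_top_of_nonneg (by norm_num) (lintegral_timeSlice_rpow_ne_top hu hc t))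

theorem measurable_sliceNorm {u : ℝ × ℝ → ℝ} (hu : Continuous u) : Measurable (sliceNorm u) := by
  have h : Measurable fun p : ℝ × ℝ => ENNReal.ofReal (‖timeSlice u p.2 p.1‖ ^ (8 / 7 : ℝ)) := by
    have := hu.measurable
    unfold timeSlice
    fun_prop
  exact (h.lintegral_prod_left'.pow_const _).ennreal_toReal

theorem lintegral_sliceNorm_rpow {u : ℝ × ℝ → ℝ} (hu : ContDiff ℝ ∞ u)
    (hc : HasCompactSupport u) :
    ∫⁻ t, ENNReal.ofReal (sliceNorm u t ^ (8 / 7 : ℝ)) =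
      ∫⁻ p, ENNReal.ofReal (|u p| ^ (8 / 7 : ℝ)) := by
  have hm : Measurable fun p => ENNReal.ofReal (|u p| ^ (8 / 7 : ℝ)) := by
    have := hu.continuous.measurable
    fun_prop
  rw [Measure.volume_eq_prod, lintegral_prod_symm _ hm.aemeasurable]
  refine lintegral_congr fun t => ?_
  rw [← ENNReal.ofReal_rpow_of_nonneg (p := 8 / 7) (x := sliceNorm u t) toReal_nonneg (by norm_num),
    ofReal_sliceNorm hu hc,
    ← ENNReal.rpow_mul]
  norm_num [timeSlice]

theorem lintegral_abs_rpow_ne_top {u : ℝ × ℝ → ℝ} (hu : Continuous u) (hc : HasCompactSupport u)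
    {a : ℝ} (ha : 0 < a) : ∫⁻ p, ENNReal.ofReal (|u p| ^ a) ≠ ⊤ := by
  have h1 : Continuous fun p => |u p| ^ a := hu.abs.rpow_const fun _ => Or.inr ha.le
  have h2 : HasCompactSupport fun p => |u p| ^ a :=
    hc.comp_left (g := fun z : ℝ => |z| ^ a) (by simp [ha.ne'])
  exact (h1.integrable_of_hasCompactSupport h2).lintegral_lt_top.ne

theorem enorm_integral_multiplierForm_airyPropagator_le {u v : ℝ × ℝ → ℝ} (hu : ContDiff ℝ ∞ u)
    (hcu : HasCompactSupport u) (hv : ContDiff ℝ ∞ v) (hcv : HasCompactSupport v) {l : ℝ}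
    (hl : l ≠ 0) (t : ℝ) :
    ‖∫ s, multiplierForm (airyPropagator l (t - s)) (timeSlice u s) (timeSlice v t)‖ₑ ≤
      144 * ((∫⁻ s, ENNReal.ofReal (|t - s| ^ (-1 / 4 : ℝ)) * ENNReal.ofReal (sliceNorm u s)) *
        ENNReal.ofReal (sliceNorm v t)) := by
  have hmeas : Measurable fun s => ENNReal.ofReal (|t - s| ^ (-1 / 4 : ℝ)) *
      ENNReal.ofReal (sliceNorm u s) := by
    have := measurable_sliceNorm hu.continuous
    fun_prop
  rw [← lintegral_mul_const _ hmeas, ← lintegral_const_mul _ (hmeas.mul_const _)]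
  refine (enorm_integral_le_lintegral_enorm _).trans (lintegral_mono fun s => ?_)
  rcases eq_or_ne (t - s) 0 with hts | hts
  · simp [hts, multiplierForm, airyPropagator]
  refine (enorm_multiplierForm_airyPropagator_le hl hts
    (contDiff_timeSlice hu s).continuous.measurable (integrable_timeSlice hu hcu s)
    (contDiff_timeSlice hv t).continuous.measurable (integrable_timeSlice hv hcv t)
    (lintegral_timeSlice_rpow_ne_top hu hcu s) (lintegral_timeSlice_rpow_ne_top hv hcv t)).trans
    (le_of_eq ?_)
  rw [ofReal_sliceNorm hu hcu, ofReal_sliceNorm hv hcv, ENNReal.ofReal_mul (by norm_num)]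
  norm_num [mul_assoc]

theorem lintegral_expWeight_pow_eight_le {f : ℝ × ℝ → ℝ} (hf : ContDiff ℝ ∞ f)
    (hcf : HasCompactSupport f) {l : ℝ} (hl : l ≠ 0) :
    (∫⁻ p, ENNReal.ofReal (|expWeight l f p| ^ (8 : ℝ))) ^ (1 / 8 : ℝ) ≤ 2304 *
      (∫⁻ p, ENNReal.ofReal (|expWeight l (fun p => pdt f p + pdx (pdx (pdx f)) p) p| ^
        (8 / 7 : ℝ))) ^ (7 / 8 : ℝ) := by
  have hg := contDiff_expWeight hf l
  have hcg := hasCompactSupport_expWeight hcf l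
  set g := expWeight l f with hg_def
  set h := expWeight l fun p => pdt f p + pdx (pdx (pdx f)) p with hh_def
  have hh : ContDiff ℝ ∞ h := contDiff_expWeight
    ((contDiff_pdt hf).add (contDiff_pdx (contDiff_pdx (contDiff_pdx hf)))) l
  have hch : HasCompactSupport h := hasCompactSupport_expWeight
    ((hasCompactSupport_pdt hf hcf).add (hasCompactSupport_pdx (contDiff_pdx (contDiff_pdx hf))
      (hasCompactSupport_pdx (contDiff_pdx hf) (hasCompactSupport_pdx hf hcf)))) l
  have hv : ContDiff ℝ ∞ fun p => g p ^ 7 := hg.pow 7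
  have hcv : HasCompactSupport fun p => g p ^ 7 :=
    hcg.comp_left (g := fun z : ℝ => z ^ 7) (by norm_num)
  set S := ∫⁻ p, ENNReal.ofReal (|g p| ^ (8 : ℝ)) with hS
  set H := ∫⁻ p, ENNReal.ofReal (|h p| ^ (8 / 7 : ℝ)) with hH
  have hS_top : S ≠ ⊤ := lintegral_abs_rpow_ne_top hg.continuous hcg (by norm_num)
  have hSv : ∫⁻ t, ENNReal.ofReal (sliceNorm (fun p => g p ^ 7) t ^ (8 / 7 : ℝ)) = S := by
    rw [lintegral_sliceNorm_rpow hv hcv]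
    refine lintegral_congr fun p => ?_
    rw [abs_pow, ← Real.rpow_natCast, ← Real.rpow_mul (abs_nonneg _)]
    norm_num
  have hHu : ∫⁻ t, ENNReal.ofReal (sliceNorm h t ^ (8 / 7 : ℝ)) = H :=
    lintegral_sliceNorm_rpow hh hch
  have hslice : ∀ t, ∫⁻ x, ENNReal.ofReal (|g (x, t)| ^ (8 : ℝ)) =
      ‖∫ s, multiplierForm (airyPropagator l (t - s)) (timeSlice h s)
        (timeSlice (fun p => g p ^ 7) t)‖ₑ := fun t => by
    rw [← integral_expWeight_mul_eq hf hcf hv hcv hl t]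
    have hpow : ∀ x, |g (x, t)| ^ (8 : ℝ) = g (x, t) * g (x, t) ^ 7 := fun x => by
      rw [show (8 : ℝ) = (8 : ℕ) by norm_num, Real.rpow_natCast, Even.pow_abs (by decide)]
      ring
    have hnn : ∀ x, 0 ≤ g (x, t) * g (x, t) ^ 7 := fun x => by
      rw [← hpow]; positivity
    have hint : Integrable fun x => g (x, t) * g (x, t) ^ 7 := by
      have h1 := integrable_timeSlice (hg.pow 8)
        (hcg.comp_left (g := fun z : ℝ => z ^ 8) (by norm_num)) t
      refine (integrable_congr (ae_of_all _ fun x => ?_)).1 h1.re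
      simp only [timeSlice, RCLike.re_to_complex, Complex.ofReal_re]
      ring
    simp_rw [hpow]
    rw [← ofReal_integral_eq_lintegral_ofReal hint (ae_of_all _ hnn), ← ofReal_norm,
      Complex.norm_real, Real.norm_of_nonneg (integral_nonneg hnn)]
  have hmain : S ≤ 2304 * H ^ (7 / 8 : ℝ) * S ^ (7 / 8 : ℝ) := by
    have hmS : Measurable fun p => ENNReal.ofReal (|g p| ^ (8 : ℝ)) := by
      have := hg.continuous.measurable
      fun_prop
    have hHLS := lintegral_lintegral_abs_sub_rpow_mul_le (measurable_sliceNorm hh.continuous)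
      (measurable_sliceNorm hv.continuous) (fun _ => toReal_nonneg) (fun _ => toReal_nonneg)
      (by rw [hHu]; exact lintegral_abs_rpow_ne_top hh.continuous hch (by norm_num))
      (by rwa [hSv])
    rw [hHu, hSv] at hHLS
    calc S = ∫⁻ t, ∫⁻ x, ENNReal.ofReal (|g (x, t)| ^ (8 : ℝ)) := by
          rw [hS, Measure.volume_eq_prod, lintegral_prod_symm _ hmS.aemeasurable]
      _ ≤ ∫⁻ t, 144 * ((∫⁻ s, ENNReal.ofReal (|t - s| ^ (-1 / 4 : ℝ)) *
            ENNReal.ofReal (sliceNorm h s)) *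
            ENNReal.ofReal (sliceNorm (fun p => g p ^ 7) t)) :=
          lintegral_mono fun t => (hslice t).trans_le
            (enorm_integral_multiplierForm_airyPropagator_le hh hch hv hcv hl t)
      _ ≤ 144 * (16 * H ^ (7 / 8 : ℝ) * S ^ (7 / 8 : ℝ)) := by
          rw [lintegral_const_mul' _ _ (by norm_num)]
          gcongr
      _ = 2304 * H ^ (7 / 8 : ℝ) * S ^ (7 / 8 : ℝ) := by
          rw [← mul_assoc, ← mul_assoc]; norm_num
  rcases eq_or_ne S 0 with hS0 | hS0
  · simp [hS0]
  have hne : S ^ (7 / 8 : ℝ) ≠ 0 := by simp [hS0, hS_top]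
  have hne' : S ^ (7 / 8 : ℝ) ≠ ⊤ := rpow_ne_top_of_nonneg (by norm_num) hS_top
  refine (ENNReal.mul_le_mul_iff_left hne hne').1 (le_trans (le_of_eq ?_) hmain)
  rw [← ENNReal.rpow_add _ _ hS0 hS_top]
  norm_num

theorem eLpNorm_eight_eq (u : ℝ × ℝ → ℝ) :
    eLpNorm u 8 volume = (∫⁻ p, ENNReal.ofReal (|u p| ^ (8 : ℝ))) ^ (1 / 8 : ℝ) := by
  rw [eLpNorm_eq_lintegral_rpow_enorm_toReal (by norm_num) (by norm_num)]
  simp only [← ofReal_norm, Real.norm_eq_abs, toReal_ofNat,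
    ENNReal.ofReal_rpow_of_nonneg (abs_nonneg _) (show (0 : ℝ) ≤ 8 by norm_num)]

theorem eLpNorm_eight_sevenths_eq (u : ℝ × ℝ → ℝ) :
    eLpNorm u (8 / 7) volume =
      (∫⁻ p, ENNReal.ofReal (|u p| ^ (8 / 7 : ℝ))) ^ (7 / 8 : ℝ) := by
  have htop : (8 / 7 : ℝ≥0∞) ≠ ⊤ := (ENNReal.div_lt_top (by norm_num) (by norm_num)).ne
  rw [eLpNorm_eq_lintegral_rpow_enorm_toReal (by simp) htop]
  simp only [← ofReal_norm, Real.norm_eq_abs, toReal_div, toReal_ofNat,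
    ENNReal.ofReal_rpow_of_nonneg (abs_nonneg _) (show (0 : ℝ) ≤ 8 / 7 by norm_num)]
  norm_num

theorem eLpNorm_expWeight_le {f : ℝ × ℝ → ℝ} (hf : ContDiff ℝ ∞ f)
    (hcf : HasCompactSupport f) {l : ℝ} (hl : l ≠ 0) :
    eLpNorm (expWeight l f) 8 volume ≤ 2304 *
      eLpNorm (expWeight l fun p => pdt f p + pdx (pdx (pdx f)) p) (8 / 7) volume := by
  rw [eLpNorm_eight_eq, eLpNorm_eight_sevenths_eq]
  exact lintegral_expWeight_pow_eight_le hf hcf hl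

theorem norm_le_exp_mul_norm_expWeight {u : ℝ × ℝ → ℝ} {M : ℝ}
    (hM : ∀ x t, M < |x| → u (x, t) = 0) {l : ℝ} (hl : 0 ≤ l) (p : ℝ × ℝ) :
    ‖u p‖ ≤ Real.exp (l * M) * ‖expWeight l u p‖ ∧ ‖expWeight l u p‖ ≤ Real.exp (l * M) * ‖u p‖ := by
  by_cases hp : M < |p.1|
  · simp [expWeight, hM p.1 p.2 hp]
  have hx := abs_le.1 (not_lt.1 hp)
  rw [expWeight, norm_mul, Real.norm_of_nonneg (Real.exp_pos _).le]
  refine ⟨?_, by gcongr; exact hx.2⟩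
  rw [← mul_assoc, ← Real.exp_add]
  exact le_mul_of_one_le_left (norm_nonneg _) (Real.one_le_exp (by nlinarith))

theorem eLpNorm_le_eLpNorm_pdt_add_pdx {f : ℝ × ℝ → ℝ} (hf : ContDiff ℝ ∞ f)
    (hcf : HasCompactSupport f) :
    eLpNorm f 8 volume ≤ 4608 *
      eLpNorm (fun p => pdt f p + pdx (pdx (pdx f)) p) (8 / 7) volume := by
  have hch : HasCompactSupport fun p => pdt f p + pdx (pdx (pdx f)) p :=
    (hasCompactSupport_pdt hf hcf).add (hasCompactSupport_pdx (contDiff_pdx (contDiff_pdx hf))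
      (hasCompactSupport_pdx (contDiff_pdx hf) (hasCompactSupport_pdx hf hcf)))
  obtain ⟨M₁, hM₁, hf0, -⟩ := exists_eq_zero_of_lt_abs hcf
  obtain ⟨M₂, hM₂, hh0, -⟩ := exists_eq_zero_of_lt_abs hch
  set M := max M₁ M₂
  have hM : 0 < M := hM₁.trans_le (le_max_left _ _)
  set δ := 1 / (4 * M)
  have hδ : 0 < δ := by positivity
  have hδM : δ * M = 1 / 4 := by simp only [δ]; field_simp
  have h1 := fun p => (norm_le_exp_mul_norm_expWeight (M := M)
    (fun x t hx => hf0 x t ((le_max_left _ _).trans_lt hx)) hδ.le p).1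
  have h2 := fun p => (norm_le_exp_mul_norm_expWeight (M := M)
    (u := fun p => pdt f p + pdx (pdx (pdx f)) p)
    (fun x t hx => hh0 x t ((le_max_right _ _).trans_lt hx)) hδ.le p).2
  have hexp : Real.exp (1 / 4) * Real.exp (1 / 4) ≤ 2 := by
    rw [← Real.exp_add, ← Real.le_log_iff_exp_le (by norm_num)]
    linarith [Real.log_two_gt_d9]
  rw [hδM] at h1 h2
  calc eLpNorm f 8 volume
      ≤ ENNReal.ofReal (Real.exp (1 / 4)) * (2304 * (ENNReal.ofReal (Real.exp (1 / 4)) *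
        eLpNorm (fun p => pdt f p + pdx (pdx (pdx f)) p) (8 / 7) volume)) := by
        refine (eLpNorm_le_mul_eLpNorm_of_ae_le_mul (ae_of_all _ h1) 8).trans ?_
        gcongr
        refine (eLpNorm_expWeight_le hf hcf hδ.ne').trans ?_
        gcongr
        exact eLpNorm_le_mul_eLpNorm_of_ae_le_mul (ae_of_all _ h2) _
    _ = ENNReal.ofReal (Real.exp (1 / 4) * Real.exp (1 / 4)) * 2304 *
        eLpNorm (fun p => pdt f p + pdx (pdx (pdx f)) p) (8 / 7) volume := by
        rw [ENNReal.ofReal_mul (Real.exp_pos _).le]; ring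
    _ ≤ 2 * 2304 * eLpNorm (fun p => pdt f p + pdx (pdx (pdx f)) p) (8 / 7) volume := by
        gcongr
        simpa using ENNReal.ofReal_le_ofReal hexp
    _ = _ := by norm_num

end SpaceTime

theorem stmt2 : ∃ c : ℝ, 0 < c ∧ ∀ f : ℝ × ℝ → ℝ, ContDiff ℝ (⊤ : ℕ∞) f → HasCompactSupport f →
    ∀ lam : ℝ,
      eLpNorm (fun p => Real.exp (lam * p.1) * f p) 8 volume ≤
        ENNReal.ofReal c *
          eLpNorm (fun p => Real.exp (lam * p.1) * (pdt f p + pdx (pdx (pdx f)) p))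
            (8/7) volume := by
  refine ⟨4608, by norm_num, fun f hf hcf l => ?_⟩
  rw [ENNReal.ofReal_ofNat]
  rcases eq_or_ne l 0 with rfl | hl
  · simpa using eLpNorm_le_eLpNorm_pdt_add_pdx hf hcf
  · refine (eLpNorm_expWeight_le hf hcf hl).trans ?_
    gcongr
    · norm_num
    · rfl
end

section
/- There exists a constant c such that for all compactly supported C^{3,1} functions h on ℝ² and all a ∈ ℝ, ‖h‖_{L⁸(ℝ²)} ≤ c ‖∂_t h + ∂_x³ h + a h‖_{L^{8/7}(ℝ²)}, with c independent of a. -/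
open MeasureTheory

/-- `f ∈ C^{3,1}`: three continuous spatial derivatives and one continuous time derivative. -/
def C31 (f : ℝ × ℝ → ℝ) : Prop :=
  (∀ t, ContDiff ℝ 3 (fun x => f (x, t))) ∧ (∀ x, Differentiable ℝ (fun t => f (x, t))) ∧
  Continuous f ∧ Continuous (pdx f) ∧ Continuous (pdx (pdx f)) ∧
  Continuous (pdx (pdx (pdx f))) ∧ Continuous (pdt f)

open Filter Topology FourierTransform ENNReal

theorem hasDerivAt_comp_neg {f : ℝ → ℝ} {f' x : ℝ} (h : HasDerivAt f f' (-x)) :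
    HasDerivAt (fun y => f (-y)) (-f') x := by
  simpa using! h.comp x (hasDerivAt_neg x)

/-- The van der Corput first derivative estimate for a convex phase with positive slope. -/
theorem norm_integral_exp_le_of_le_deriv {φ φ' φ'' : ℝ → ℝ} {a b μ : ℝ} (hab : a ≤ b) (hμ : 0 < μ)
    (hφ : ∀ x, HasDerivAt φ (φ' x) x) (hφ' : ∀ x, HasDerivAt φ' (φ'' x) x)
    (hφ'' : Continuous φ'') (hconv : ∀ x ∈ Set.Icc a b, 0 ≤ φ'' x)
    (hslope : ∀ x ∈ Set.Icc a b, μ ≤ φ' x) :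
    ‖∫ x in a..b, Complex.exp (φ x * Complex.I)‖ ≤ 3 / μ := by
  have hφc : Continuous φ := continuous_iff_continuousAt.2 fun x => (hφ x).continuousAt
  have hφ'c : Continuous φ' := continuous_iff_continuousAt.2 fun x => (hφ' x).continuousAt
  have huI : Set.uIcc a b = Set.Icc a b := Set.uIcc_of_le hab
  have hpos : ∀ x ∈ Set.Icc a b, 0 < φ' x := fun x hx => hμ.trans_le (hslope x hx)
  have hu : ∀ x ∈ Set.uIcc a b, HasDerivAt (fun x => (φ' x)⁻¹) (-φ'' x / φ' x ^ 2) x :=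
    fun x hx => (hφ' x).inv (hpos x (huI ▸ hx)).ne'
  have hu' : ∀ x ∈ Set.uIcc a b,
      HasDerivAt (fun x => (((φ' x)⁻¹ : ℝ) : ℂ)) ((-φ'' x / φ' x ^ 2 : ℝ) : ℂ) x :=
    fun x hx => (hu x hx).ofReal_comp
  have hv : ∀ x ∈ Set.uIcc a b, HasDerivAt (fun x => -Complex.I * Complex.exp (φ x * Complex.I))
      (φ' x * Complex.exp (φ x * Complex.I)) x := by
    intro x _
    have := (((hφ x).ofReal_comp.mul_const Complex.I).cexp).const_mul (-Complex.I)
    refine this.congr_deriv ?_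
    linear_combination (φ' x * Complex.exp (φ x * Complex.I)) * (-Complex.I_mul_I)
  have hcont : ContinuousOn (fun x => -φ'' x / φ' x ^ 2) (Set.uIcc a b) :=
    hφ''.neg.continuousOn.div (hφ'c.pow 2).continuousOn
      fun x hx => pow_ne_zero 2 (hpos x (huI ▸ hx)).ne'
  have hint := hcont.intervalIntegrable (μ := volume)
  have hparts := intervalIntegral.integral_mul_deriv_eq_deriv_mul hu' hv
    (Complex.continuous_ofReal.comp_continuousOn hcont).intervalIntegrable
    (by apply Continuous.intervalIntegrable; fun_prop)
  have hcongr : ∫ x in a..b, (((φ' x)⁻¹ : ℝ) : ℂ) * (φ' x * Complex.exp (φ x * Complex.I)) =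
      ∫ x in a..b, Complex.exp (φ x * Complex.I) := by
    refine intervalIntegral.integral_congr fun x hx => ?_
    have : (φ' x : ℂ) ≠ 0 := by exact_mod_cast (hpos x (huI ▸ hx)).ne'
    simp only [Complex.ofReal_inv]
    field_simp
  have hft := intervalIntegral.integral_eq_sub_of_hasDerivAt hu hint
  have hE : ∀ x, ‖-Complex.I * Complex.exp (φ x * Complex.I)‖ = 1 := fun x => by
    rw [norm_mul, Complex.norm_exp_ofReal_mul_I]; simp
  have hrem : ‖∫ x in a..b, ((-φ'' x / φ' x ^ 2 : ℝ) : ℂ) *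
      (-Complex.I * Complex.exp (φ x * Complex.I))‖ ≤ (φ' a)⁻¹ - (φ' b)⁻¹ := by
    have : ∫ x in a..b, -(-φ'' x / φ' x ^ 2) = (φ' a)⁻¹ - (φ' b)⁻¹ := by
      rw [intervalIntegral.integral_neg, hft]; ring
    rw [← this]
    refine intervalIntegral.norm_integral_le_of_norm_le hab (.of_forall fun x hx => ?_) hint.neg
    rw [norm_mul, hE, mul_one, Complex.norm_real, Real.norm_eq_abs, abs_of_nonpos]
    rw [neg_div]
    exact neg_nonpos.2 (div_nonneg (hconv x (Set.Ioc_subset_Icc_self hx)) (sq_nonneg _))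
  have ha := hslope a (Set.left_mem_Icc.2 hab)
  have hb := hslope b (Set.right_mem_Icc.2 hab)
  have ha' : (φ' a)⁻¹ ≤ μ⁻¹ := inv_anti₀ hμ ha
  have hb' : (φ' b)⁻¹ ≤ μ⁻¹ := inv_anti₀ hμ hb
  have hb0 : 0 < (φ' b)⁻¹ := inv_pos.2 (hμ.trans_le hb)
  have ha0 : 0 < (φ' a)⁻¹ := inv_pos.2 (hμ.trans_le ha)
  rw [← hcongr, hparts]
  refine (norm_sub_le _ _).trans ((add_le_add (norm_sub_le _ _) hrem).trans ?_)
  rw [norm_mul _ (-Complex.I * _), norm_mul _ (-Complex.I * _), hE, hE,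
    Complex.norm_real, Complex.norm_real, Real.norm_of_nonneg hb0.le,
    Real.norm_of_nonneg ha0.le, div_eq_mul_inv]
  linarith

/-- The van der Corput first derivative estimate for a convex phase with negative slope. -/
theorem norm_integral_exp_le_of_deriv_le {φ φ' φ'' : ℝ → ℝ} {a b μ : ℝ} (hab : a ≤ b) (hμ : 0 < μ)
    (hφ : ∀ x, HasDerivAt φ (φ' x) x) (hφ' : ∀ x, HasDerivAt φ' (φ'' x) x)
    (hφ'' : Continuous φ'') (hconv : ∀ x ∈ Set.Icc a b, 0 ≤ φ'' x)
    (hslope : ∀ x ∈ Set.Icc a b, φ' x ≤ -μ) :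
    ‖∫ x in a..b, Complex.exp (φ x * Complex.I)‖ ≤ 3 / μ := by
  have := norm_integral_exp_le_of_le_deriv (φ := fun x => φ (-x)) (φ' := fun x => -φ' (-x))
    (φ'' := fun x => φ'' (-x)) (neg_le_neg hab) hμ
    (fun x => hasDerivAt_comp_neg (hφ (-x)))
    (fun x => by simpa using! (hasDerivAt_comp_neg (hφ' (-x))).neg)
    (hφ''.comp continuous_neg)
    (fun x hx => hconv _ ⟨by linarith [hx.2], by linarith [hx.1]⟩)
    (fun x hx => by linarith [hslope (-x) ⟨by linarith [hx.2], by linarith [hx.1]⟩])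
  rwa [intervalIntegral.integral_comp_neg (fun x => Complex.exp (φ x * Complex.I)), neg_neg,
    neg_neg] at this

theorem norm_integral_exp_le_length (φ : ℝ → ℝ) {a b : ℝ} (hab : a ≤ b) :
    ‖∫ x in a..b, Complex.exp (φ x * Complex.I)‖ ≤ b - a := by
  have := intervalIntegral.norm_integral_le_of_norm_le_const (a := a) (b := b) (C := 1)
    fun x _ => (Complex.norm_exp_ofReal_mul_I (φ x)).le
  rwa [one_mul, abs_of_nonneg (sub_nonneg.2 hab)] at this

/-- The van der Corput second derivative estimate for a phase with nonnegative slope. -/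
theorem norm_integral_exp_le_of_le_deriv_two_of_nonneg {φ φ' φ'' : ℝ → ℝ} {a b δ : ℝ} (hab : a ≤ b)
    (hδ : 0 < δ) (hφ : ∀ x, HasDerivAt φ (φ' x) x) (hφ' : ∀ x, HasDerivAt φ' (φ'' x) x)
    (hφ'' : Continuous φ'') (hconv : ∀ x ∈ Set.Icc a b, (δ ^ 2)⁻¹ ≤ φ'' x) (hslope : 0 ≤ φ' a) :
    ‖∫ x in a..b, Complex.exp (φ x * Complex.I)‖ ≤ 4 * δ := by
  have hφc : Continuous φ := continuous_iff_continuousAt.2 fun x => (hφ x).continuousAt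
  have hδ2 : 0 < (δ ^ 2)⁻¹ := by positivity
  rcases le_total b (a + δ) with hb | hb
  · linarith [norm_integral_exp_le_length φ hab]
  have hi : ∀ c d, IntervalIntegrable (fun x => Complex.exp (φ x * Complex.I)) volume c d :=
    fun c d => by apply Continuous.intervalIntegrable; fun_prop
  rw [← intervalIntegral.integral_add_adjacent_intervals (hi a (a + δ)) (hi _ _)]
  have h1 := norm_integral_exp_le_length φ (a := a) (b := a + δ) (by linarith)
  have h2 : ‖∫ x in (a + δ)..b, Complex.exp (φ x * Complex.I)‖ ≤ 3 / δ⁻¹ := by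
    refine norm_integral_exp_le_of_le_deriv hb (inv_pos.2 hδ) hφ hφ' hφ''
      (fun x hx => hδ2.le.trans (hconv x ⟨by linarith [hx.1], hx.2⟩)) fun x hx => ?_
    have hax : a ≤ x := by linarith [hx.1]
    have := Convex.mul_sub_le_image_sub_of_le_deriv (convex_Icc a b)
      (f := φ') (C := (δ ^ 2)⁻¹) (fun x _ => (hφ' x).continuousAt.continuousWithinAt)
      (fun x _ => (hφ' x).differentiableAt.differentiableWithinAt)
      (fun x hx => by rw [(hφ' x).deriv]; exact hconv x (interior_subset hx))
      a (Set.left_mem_Icc.2 hab) x ⟨hax, hx.2⟩ hax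
    have h3 : δ⁻¹ = (δ ^ 2)⁻¹ * δ := by field_simp
    have h4 : (δ ^ 2)⁻¹ * δ ≤ (δ ^ 2)⁻¹ * (x - a) :=
      mul_le_mul_of_nonneg_left (by linarith [hx.1]) hδ2.le
    linarith
  rw [div_inv_eq_mul] at h2
  refine (norm_add_le _ _).trans ?_
  linarith

/-- The van der Corput second derivative estimate. -/
theorem norm_integral_exp_le_of_le_deriv_two {φ φ' φ'' : ℝ → ℝ} {a b δ : ℝ} (hab : a ≤ b)
    (hδ : 0 < δ) (hφ : ∀ x, HasDerivAt φ (φ' x) x) (hφ' : ∀ x, HasDerivAt φ' (φ'' x) x)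
    (hφ'' : Continuous φ'') (hconv : ∀ x ∈ Set.Icc a b, (δ ^ 2)⁻¹ ≤ φ'' x) :
    ‖∫ x in a..b, Complex.exp (φ x * Complex.I)‖ ≤ 8 * δ := by
  have hφc : Continuous φ := continuous_iff_continuousAt.2 fun x => (hφ x).continuousAt
  have hφ'c : Continuous φ' := continuous_iff_continuousAt.2 fun x => (hφ' x).continuousAt
  have hleft : ∀ c, a ≤ c → c ≤ b → φ' c ≤ 0 →
      ‖∫ x in a..c, Complex.exp (φ x * Complex.I)‖ ≤ 4 * δ := by
    intro c hac hcb hc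
    have := norm_integral_exp_le_of_le_deriv_two_of_nonneg (φ := fun x => φ (-x))
      (φ' := fun x => -φ' (-x)) (φ'' := fun x => φ'' (-x)) (neg_le_neg hac) hδ
      (fun x => hasDerivAt_comp_neg (hφ (-x)))
      (fun x => by simpa using! (hasDerivAt_comp_neg (hφ' (-x))).neg)
      (hφ''.comp continuous_neg)
      (fun x hx => hconv _ ⟨by linarith [hx.2], by linarith [hx.1]⟩)
      (by simpa using hc)
    rwa [intervalIntegral.integral_comp_neg (fun x => Complex.exp (φ x * Complex.I)), neg_neg,
      neg_neg] at this
  have hright : ∀ c, a ≤ c → c ≤ b → 0 ≤ φ' c →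
      ‖∫ x in c..b, Complex.exp (φ x * Complex.I)‖ ≤ 4 * δ := fun c hac hcb hc =>
    norm_integral_exp_le_of_le_deriv_two_of_nonneg hcb hδ hφ hφ' hφ''
      (fun x hx => hconv x ⟨hac.trans hx.1, hx.2⟩) hc
  rcases le_total 0 (φ' a) with ha | ha
  · linarith [hright a le_rfl hab ha]
  rcases le_total (φ' b) 0 with hb | hb
  · linarith [hleft b hab le_rfl hb]
  obtain ⟨c, hc, hc0⟩ := intermediate_value_Icc hab hφ'c.continuousOn ⟨ha, hb⟩
  have hi : ∀ c d, IntervalIntegrable (fun x => Complex.exp (φ x * Complex.I)) volume c d :=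
    fun c d => by apply Continuous.intervalIntegrable; fun_prop
  rw [← intervalIntegral.integral_add_adjacent_intervals (hi a c) (hi _ _)]
  refine (norm_add_le _ _).trans ?_
  linarith [hleft c hc.1 hc.2 hc0.le, hright c hc.1 hc.2 hc0.ge]

/-- Uniform decay of the truncated Airy integral over a half line, for positive cubic part. -/
theorem norm_integral_exp_cubic_half_le {A B N : ℝ} (hA : 0 < A) (hB : B ≠ 0) (hN : 0 ≤ N) :
    ‖∫ ξ in (0 : ℝ)..N, Complex.exp ((A * ξ ^ 3 + B * ξ : ℝ) * Complex.I)‖ ≤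
      13 * (A * |B|) ^ (-(1 / 4) : ℝ) := by
  have hB' : 0 < |B| := abs_pos.2 hB
  set δ := (A * |B|) ^ (-(1 / 4) : ℝ) with hδdef
  have hδ : 0 < δ := by positivity
  set r := |B| * δ ^ 2 with hr
  have hδ4 : δ ^ 4 * (A * |B|) = 1 := by
    rw [hδdef, ← Real.rpow_natCast, ← Real.rpow_mul (by positivity)]
    norm_num
    rw [Real.rpow_neg_one]
    field_simp
  have hrpos : 0 < r := by positivity
  have hAr : A * r = (δ ^ 2)⁻¹ := by
    refine eq_inv_of_mul_eq_one_left ?_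
    rw [hr]; linear_combination hδ4
  have hAr2 : A * r ^ 2 = |B| := by
    have : A * r ^ 2 = (A * r) * (|B| * δ ^ 2) := by rw [hr]; ring
    rw [this, hAr]; field_simp
  have hφ : ∀ x : ℝ, HasDerivAt (fun ξ : ℝ => A * ξ ^ 3 + B * ξ) (3 * A * x ^ 2 + B) x := by
    intro x
    have := ((hasDerivAt_pow 3 x).const_mul A).add ((hasDerivAt_id x).const_mul B)
    refine this.congr_deriv ?_
    norm_num; ring
  have hφ' : ∀ x : ℝ, HasDerivAt (fun ξ : ℝ => 3 * A * ξ ^ 2 + B) (6 * A * x) x := by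
    intro x
    have := ((hasDerivAt_pow 2 x).const_mul (3 * A)).add_const B
    refine this.congr_deriv ?_
    norm_num; ring
  have hφ'' : Continuous fun x : ℝ => 6 * A * x := by fun_prop
  have hlow : ∀ m, 0 ≤ m → m ≤ r / 3 →
      ‖∫ ξ in (0 : ℝ)..m, Complex.exp ((A * ξ ^ 3 + B * ξ : ℝ) * Complex.I)‖ ≤ 5 * δ := by
    intro m hm hmr
    have hsq : ∀ x ∈ Set.Icc 0 m, 3 * A * x ^ 2 ≤ |B| / 3 := by
      intro x hx
      have : x ^ 2 ≤ (r / 3) ^ 2 := pow_le_pow_left₀ hx.1 (hx.2.trans hmr) 2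
      have := mul_le_mul_of_nonneg_left this (by positivity : 0 ≤ 3 * A)
      linarith
    have hconv : ∀ x ∈ Set.Icc 0 m, 0 ≤ 6 * A * x := fun x hx => by
      have := hx.1; positivity
    have hμ : 0 < 2 / 3 * |B| := by positivity
    have h1 : ‖∫ ξ in (0 : ℝ)..m, Complex.exp ((A * ξ ^ 3 + B * ξ : ℝ) * Complex.I)‖ ≤
        3 / (2 / 3 * |B|) := by
      rcases hB.lt_or_gt with hneg | hpos
      · refine norm_integral_exp_le_of_deriv_le hm hμ hφ hφ' hφ'' hconv fun x hx => ?_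
        have := hsq x hx
        rw [abs_of_neg hneg] at this ⊢
        linarith
      · refine norm_integral_exp_le_of_le_deriv hm hμ hφ hφ' hφ'' hconv fun x hx => ?_
        have : 0 ≤ 3 * A * x ^ 2 := by positivity
        rw [abs_of_pos hpos]
        linarith
    have h2 := norm_integral_exp_le_length (fun ξ => A * ξ ^ 3 + B * ξ) hm
    rcases le_total (|B| * δ) 1 with hc | hc
    · have : r ≤ δ := by
        have := mul_le_mul_of_nonneg_right hc hδ.le
        rw [hr]; linarith
      linarith
    · refine h1.trans ?_
      rw [div_le_iff₀ hμ]
      linarith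
  have hhigh : ∀ m n, r / 3 ≤ m → m ≤ n →
      ‖∫ ξ in m..n, Complex.exp ((A * ξ ^ 3 + B * ξ : ℝ) * Complex.I)‖ ≤ 8 * δ := by
    intro m n hm hmn
    refine norm_integral_exp_le_of_le_deriv_two hmn hδ hφ hφ' hφ'' fun x hx => ?_
    have : A * (r / 3) ≤ A * x := mul_le_mul_of_nonneg_left (hm.trans hx.1) hA.le
    have : 0 < (δ ^ 2)⁻¹ := by positivity
    linarith
  rcases le_total N (r / 3) with hc | hc
  · linarith [hlow N hN hc]
  have hi : ∀ c d, IntervalIntegrable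
      (fun ξ : ℝ => Complex.exp ((A * ξ ^ 3 + B * ξ : ℝ) * Complex.I)) volume c d :=
    fun c d => by apply Continuous.intervalIntegrable; fun_prop
  rw [← intervalIntegral.integral_add_adjacent_intervals (hi 0 (r / 3)) (hi _ _)]
  refine (norm_add_le _ _).trans ?_
  linarith [hlow (r / 3) (by positivity) le_rfl, hhigh (r / 3) N le_rfl hc]

theorem norm_integral_exp_neg (φ : ℝ → ℝ) (a b : ℝ) :
    ‖∫ x in a..b, Complex.exp ((-φ x : ℝ) * Complex.I)‖ =
      ‖∫ x in a..b, Complex.exp (φ x * Complex.I)‖ := by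
  have : ∀ x, Complex.exp ((-φ x : ℝ) * Complex.I) =
      (starRingEnd ℂ) (Complex.exp (φ x * Complex.I)) := fun x => by
    rw [← Complex.exp_conj]; simp
  simp_rw [this, intervalIntegral.intervalIntegral_eq_integral_uIoc, integral_conj, norm_smul,
    RCLike.norm_conj]

/-- Uniform decay of the truncated Airy integral. -/
theorem norm_integral_exp_cubic_le {A B N : ℝ} (hA : A ≠ 0) (hB : B ≠ 0) (hN : 0 ≤ N) :
    ‖∫ ξ in (-N)..N, Complex.exp ((A * ξ ^ 3 + B * ξ : ℝ) * Complex.I)‖ ≤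
      26 * (|A| * |B|) ^ (-(1 / 4) : ℝ) := by
  have hhalf : ‖∫ ξ in (0 : ℝ)..N, Complex.exp ((A * ξ ^ 3 + B * ξ : ℝ) * Complex.I)‖ ≤
      13 * (|A| * |B|) ^ (-(1 / 4) : ℝ) := by
    rcases hA.lt_or_gt with hneg | hpos
    · have := norm_integral_exp_cubic_half_le (neg_pos.2 hneg) (neg_ne_zero.2 hB) hN
      rw [abs_neg, ← abs_of_neg hneg] at this
      rw [← norm_integral_exp_neg]
      convert this using 6
      rw [abs_of_neg hneg]; push_cast; ring
    · rw [abs_of_pos hpos]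
      exact norm_integral_exp_cubic_half_le hpos hB hN
  have hi : ∀ c d, IntervalIntegrable
      (fun ξ : ℝ => Complex.exp ((A * ξ ^ 3 + B * ξ : ℝ) * Complex.I)) volume c d :=
    fun c d => by apply Continuous.intervalIntegrable; fun_prop
  have hrefl : ‖∫ ξ in (-N)..0, Complex.exp ((A * ξ ^ 3 + B * ξ : ℝ) * Complex.I)‖ =
      ‖∫ ξ in (0 : ℝ)..N, Complex.exp ((A * ξ ^ 3 + B * ξ : ℝ) * Complex.I)‖ := by
    rw [← norm_integral_exp_neg (fun ξ => A * ξ ^ 3 + B * ξ) 0 N]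
    have := intervalIntegral.integral_comp_neg (a := 0) (b := N)
      (fun ξ : ℝ => Complex.exp ((A * ξ ^ 3 + B * ξ : ℝ) * Complex.I))
    rw [neg_zero] at this
    rw [← this]
    congr 3 with ξ
    congr 3; ring
  rw [← intervalIntegral.integral_add_adjacent_intervals (hi (-N) 0) (hi _ _)]
  refine (norm_add_le _ _).trans ?_
  rw [hrefl]
  linarith

/-- The Riesz kernel `|z|^(-1/4)` on the line. -/
noncomputable def rieszKernel (z : ℝ) : ℝ≥0∞ := ‖z‖ₑ ^ (-(1 / 4) : ℝ)

@[fun_prop]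
theorem measurable_rieszKernel : Measurable rieszKernel := by
  unfold rieszKernel; fun_prop

theorem rieszKernel_neg (z : ℝ) : rieszKernel (-z) = rieszKernel z := by simp [rieszKernel]

theorem rieszKernel_sub_comm (x y : ℝ) : rieszKernel (x - y) = rieszKernel (y - x) := by
  rw [← rieszKernel_neg, neg_sub]

theorem rieszKernel_of_ne_zero {z : ℝ} (hz : z ≠ 0) :
    rieszKernel z = ENNReal.ofReal (|z| ^ (-(1 / 4) : ℝ)) := by
  rw [rieszKernel, Real.enorm_eq_ofReal_abs, ENNReal.ofReal_rpow_of_pos (abs_pos.2 hz)]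

theorem rieszKernel_ne_zero (z : ℝ) : rieszKernel z ≠ 0 := by
  simp [rieszKernel, ENNReal.rpow_eq_zero_iff]

theorem rieszKernel_zero : rieszKernel 0 = ∞ := by simp [rieszKernel]

theorem lintegral_rieszKernel_near {r : ℝ} (hr : 0 < r) :
    ∫⁻ z, (Set.Ioo (-r) r).indicator rieszKernel z ≤ 3 * ENNReal.ofReal (r ^ (3 / 4 : ℝ)) := by
  have hcover : ∀ z, (Set.Ioo (-r) r).indicator rieszKernel z ≤
      (Set.Ioc 0 r).indicator rieszKernel z + ((Set.Ioc 0 r).indicator rieszKernel (-z) +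
        ({0} : Set ℝ).indicator (fun _ => ∞) z) := by
    intro z
    by_cases hz : z ∈ Set.Ioo (-r) r
    · rw [Set.indicator_of_mem hz]
      rcases lt_trichotomy z 0 with h | h | h
      · rw [Set.indicator_of_mem (s := Set.Ioc 0 r) (a := -z)
          ⟨by linarith, by linarith [hz.1]⟩, rieszKernel_neg]
        exact le_add_self.trans' le_self_add
      · simp [h]
      · rw [Set.indicator_of_mem (s := Set.Ioc 0 r) (a := z) ⟨h, hz.2.le⟩]
        exact le_self_add
    · simp [Set.indicator_of_notMem hz]
  have hhalf : ∫⁻ z, (Set.Ioc 0 r).indicator rieszKernel z =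
      ENNReal.ofReal (4 / 3 * r ^ (3 / 4 : ℝ)) := by
    rw [lintegral_indicator measurableSet_Ioc, setLIntegral_congr_fun measurableSet_Ioc
      (g := fun z => ENNReal.ofReal (z ^ (-(1 / 4) : ℝ)))
      (fun z hz => by rw [rieszKernel_of_ne_zero hz.1.ne', abs_of_pos hz.1]),
      ← ofReal_integral_eq_lintegral_ofReal, ← intervalIntegral.integral_of_le hr.le,
      integral_rpow (by norm_num)]
    · congr 1
      norm_num
      ring
    · exact (intervalIntegrable_iff_integrableOn_Ioc_of_le hr.le).1
        (intervalIntegral.intervalIntegrable_rpow' (by norm_num))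
    · filter_upwards [ae_restrict_mem measurableSet_Ioc] with z hz
      exact Real.rpow_nonneg hz.1.le _
  have hm : Measurable fun z => (Set.Ioc 0 r).indicator rieszKernel z :=
    measurable_rieszKernel.indicator measurableSet_Ioc
  refine (lintegral_mono hcover).trans ?_
  rw [lintegral_add_left hm, lintegral_add_left (by exact hm.comp measurable_neg),
    lintegral_neg_eq_self (fun z => (Set.Ioc 0 r).indicator rieszKernel z), hhalf,
    lintegral_indicator (measurableSet_singleton 0)]
  simp only [lintegral_const, Measure.restrict_apply_univ, Real.volume_singleton, mul_zero,
    add_zero]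
  rw [← ENNReal.ofReal_add (by positivity) (by positivity), ← ENNReal.ofReal_ofNat,
    ← ENNReal.ofReal_mul (by norm_num)]
  refine ENNReal.ofReal_le_ofReal ?_
  have : 0 ≤ r ^ (3 / 4 : ℝ) := by positivity
  linarith

theorem lintegral_rpow_neg_two_far {r : ℝ} (hr : 0 < r) :
    ∫⁻ z, (Set.Ioo (-r) r)ᶜ.indicator (fun z : ℝ => ‖z‖ₑ ^ (-2 : ℝ)) z ≤
      2 * ENNReal.ofReal r⁻¹ := by
  set k : ℝ → ℝ≥0∞ := fun z : ℝ => ‖z‖ₑ ^ (-2 : ℝ) with hk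
  have hkm : Measurable k := by rw [hk]; fun_prop
  have hcover : ∀ z, (Set.Ioo (-r) r)ᶜ.indicator k z ≤
      (Set.Ici r).indicator k z + (Set.Ici r).indicator k (-z) := by
    intro z
    by_cases hz : z ∈ Set.Ioo (-r) r
    · rw [Set.indicator_of_notMem (by exact not_not_intro hz)]; exact zero_le
    · rw [Set.indicator_of_mem (by exact hz)]
      rcases le_or_gt r z with h | h
      · rw [Set.indicator_of_mem (s := Set.Ici r) (a := z) h]
        exact le_self_add
      · rw [Set.indicator_of_mem (s := Set.Ici r) (a := -z)
          (le_neg_of_le_neg (not_lt.1 fun h' => hz ⟨h', h⟩))]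
        simp [hk]
  have hhalf : ∫⁻ z, (Set.Ici r).indicator k z = ENNReal.ofReal r⁻¹ := by
    rw [lintegral_indicator measurableSet_Ici, setLIntegral_congr Ioi_ae_eq_Ici.symm,
      setLIntegral_congr_fun measurableSet_Ioi (g := fun z => ENNReal.ofReal (z ^ (-2 : ℝ)))
      (fun z hz => by
        have hz0 : 0 < z := hr.trans hz
        simp only [hk]
        rw [Real.enorm_eq_ofReal_abs, abs_of_pos hz0, ENNReal.ofReal_rpow_of_pos hz0]),
      ← ofReal_integral_eq_lintegral_ofReal, integral_Ioi_rpow_of_lt (by norm_num) hr]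
    · norm_num [Real.rpow_neg_one]
    · exact integrableOn_Ioi_rpow_of_lt (by norm_num) hr
    · filter_upwards [ae_restrict_mem measurableSet_Ioi] with z hz
      exact Real.rpow_nonneg (hr.trans hz).le _
  have hm : Measurable fun z => (Set.Ici r).indicator k z := hkm.indicator measurableSet_Ici
  refine (lintegral_mono hcover).trans ?_
  rw [lintegral_add_left hm, lintegral_neg_eq_self (fun z => (Set.Ici r).indicator k z), hhalf,
    two_mul]

theorem rpow_mul_rieszKernel_le_add (u : ℝ≥0∞) (z : ℝ) :
    u ^ (7 / 8 : ℝ) * rieszKernel z ≤ u + ‖z‖ₑ ^ (-2 : ℝ) := by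
  set v := ‖z‖ₑ ^ (-2 : ℝ) with hv
  have h1 : rieszKernel z = v ^ (1 / 8 : ℝ) := by
    rw [rieszKernel, hv, ← ENNReal.rpow_mul]; norm_num
  have h2 : ∀ w : ℝ≥0∞, w ^ (7 / 8 : ℝ) * w ^ (1 / 8 : ℝ) = w := fun w => by
    rw [← ENNReal.rpow_add_of_nonneg _ _ (by norm_num) (by norm_num)]; norm_num
  rw [h1]
  rcases le_total u v with h | h
  · exact (mul_le_mul_left (ENNReal.rpow_le_rpow h (by norm_num)) _).trans
      ((h2 v).le.trans le_add_self)
  · exact (mul_le_mul_right (ENNReal.rpow_le_rpow h (by norm_num)) _).trans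
      ((h2 u).le.trans le_self_add)

/-- Hedberg-type splitting: the part of the potential where `G` does not exceed the level `M`. -/
theorem lintegral_truncated_riesz_le {G : ℝ → ℝ≥0∞} (hG : Measurable G) (hG1 : ∫⁻ y, G y ≤ 1)
    (M : ℝ≥0∞) (x : ℝ) :
    ∫⁻ y, {y | G y ≤ M}.indicator
      (fun y => M ^ (7 / 8 : ℝ) * G y ^ (7 / 8 : ℝ) * rieszKernel (x - y)) y ≤ 6 * M := by
  rcases eq_or_ne M ∞ with rfl | hM
  · simp
  rcases eq_or_ne M 0 with rfl | hM0
  · simp [ENNReal.zero_rpow_of_pos]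
  have hm0 : 0 < M.toReal := ENNReal.toReal_pos hM0 hM
  set r := M.toReal⁻¹ with hr
  have hr0 : 0 < r := inv_pos.2 hm0
  have hpt : ∀ y, {y | G y ≤ M}.indicator
      (fun y => M ^ (7 / 8 : ℝ) * G y ^ (7 / 8 : ℝ) * rieszKernel (x - y)) y ≤
      M ^ (7 / 4 : ℝ) * (Set.Ioo (-r) r).indicator rieszKernel (x - y) +
      (M * G y + (Set.Ioo (-r) r)ᶜ.indicator (fun z : ℝ => ‖z‖ₑ ^ (-2 : ℝ)) (x - y)) := by
    intro y
    by_cases hy : G y ≤ M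
    swap
    · rw [Set.indicator_of_notMem (by exact hy)]; exact zero_le
    rw [Set.indicator_of_mem (by exact hy)]
    by_cases hz : x - y ∈ Set.Ioo (-r) r
    · rw [Set.indicator_of_mem hz]
      refine le_trans ?_ le_self_add
      refine mul_le_mul_left ?_ _
      calc M ^ (7 / 8 : ℝ) * G y ^ (7 / 8 : ℝ) ≤ M ^ (7 / 8 : ℝ) * M ^ (7 / 8 : ℝ) :=
            mul_le_mul_right (ENNReal.rpow_le_rpow hy (by norm_num)) _
        _ = M ^ (7 / 4 : ℝ) := by
            rw [← ENNReal.rpow_add_of_nonneg _ _ (by norm_num) (by norm_num)]; norm_num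
    · rw [Set.indicator_of_mem (s := (Set.Ioo (-r) r)ᶜ) hz, ← ENNReal.mul_rpow_of_nonneg _ _
        (by norm_num)]
      exact (rpow_mul_rieszKernel_le_add _ _).trans le_add_self
  have hm1 : Measurable fun z => (Set.Ioo (-r) r).indicator rieszKernel z :=
    measurable_rieszKernel.indicator measurableSet_Ioo
  refine (lintegral_mono hpt).trans ?_
  rw [lintegral_add_left (by fun_prop), lintegral_add_left (by fun_prop),
    lintegral_const_mul _ (by fun_prop), lintegral_const_mul _ hG,
    lintegral_sub_left_eq_self (fun z => (Set.Ioo (-r) r).indicator rieszKernel z),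
    lintegral_sub_left_eq_self
      (fun z => (Set.Ioo (-r) r)ᶜ.indicator (fun z : ℝ => ‖z‖ₑ ^ (-2 : ℝ)) z)]
  have hMr : M = ENNReal.ofReal M.toReal := (ENNReal.ofReal_toReal hM).symm
  have h1 : M ^ (7 / 4 : ℝ) * (3 * ENNReal.ofReal (r ^ (3 / 4 : ℝ))) = 3 * M := by
    rw [mul_left_comm]
    congr 1
    conv_lhs => rw [hMr]
    conv_rhs => rw [hMr]
    rw [ENNReal.ofReal_rpow_of_pos hm0, ← ENNReal.ofReal_mul (by positivity), hr,
      Real.inv_rpow hm0.le, ← Real.rpow_neg hm0.le, ← Real.rpow_add hm0]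
    norm_num
  have h2 : ENNReal.ofReal r⁻¹ = M := by rw [hr, inv_inv, ← hMr]
  calc _ ≤ 3 * M + (M * 1 + 2 * M) :=
        add_le_add ((mul_le_mul_right (lintegral_rieszKernel_near hr0) _).trans_eq h1)
          (add_le_add (mul_le_mul_right hG1 _)
            ((lintegral_rpow_neg_two_far hr0).trans_eq (by rw [h2])))
    _ = 6 * M := by ring

theorem lintegral_lintegral_le_of_le_add {K A B : ℝ → ℝ → ℝ≥0∞}
    (hA : Measurable (Function.uncurry A)) (hB : Measurable (Function.uncurry B))
    (hK : ∀ x y, K x y ≤ A x y + B x y) :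
    ∫⁻ x, ∫⁻ y, K x y ≤ (∫⁻ x, ∫⁻ y, A x y) + ∫⁻ y, ∫⁻ x, B x y := by
  have hAx : ∀ x, Measurable (A x) := fun x => hA.comp measurable_prodMk_left
  have hAi : Measurable fun x => ∫⁻ y, A x y := hA.lintegral_prod_right'
  rw [lintegral_lintegral_swap (f := fun y x => B x y)
      (by exact (hB.comp measurable_swap).aemeasurable),
    ← lintegral_add_left hAi]
  refine lintegral_mono fun x => ?_
  rw [← lintegral_add_left (hAx x)]
  exact lintegral_mono fun y => hK x y

theorem hardyLittlewoodSobolev_normalized {F G : ℝ → ℝ≥0∞} (hF : Measurable F) (hG : Measurable G)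
    (hF1 : ∫⁻ x, F x ≤ 1) (hG1 : ∫⁻ y, G y ≤ 1) :
    ∫⁻ x, ∫⁻ y, F x ^ (7 / 8 : ℝ) * G y ^ (7 / 8 : ℝ) * rieszKernel (x - y) ≤ 12 := by
  have hpt : ∀ x y, F x ^ (7 / 8 : ℝ) * G y ^ (7 / 8 : ℝ) * rieszKernel (x - y) ≤
      {y | G y ≤ F x}.indicator
        (fun y => F x ^ (7 / 8 : ℝ) * G y ^ (7 / 8 : ℝ) * rieszKernel (x - y)) y +
      {x | F x ≤ G y}.indicator
        (fun x => G y ^ (7 / 8 : ℝ) * F x ^ (7 / 8 : ℝ) * rieszKernel (y - x)) x := by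
    intro x y
    rcases le_total (G y) (F x) with h | h
    · rw [Set.indicator_of_mem (by exact h)]; exact le_self_add
    · rw [Set.indicator_of_mem (s := {x | F x ≤ G y}) (by exact h), rieszKernel_sub_comm y x,
        mul_comm (G y ^ _)]
      exact le_add_self
  have hm1 : Measurable (Function.uncurry fun x y => {y | G y ≤ F x}.indicator
        (fun y => F x ^ (7 / 8 : ℝ) * G y ^ (7 / 8 : ℝ) * rieszKernel (x - y)) y) := by
    have : Measurable fun p : ℝ × ℝ =>
      F p.1 ^ (7 / 8 : ℝ) * G p.2 ^ (7 / 8 : ℝ) * rieszKernel (p.1 - p.2) := by fun_prop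
    exact this.indicator (measurableSet_le (hG.comp measurable_snd) (hF.comp measurable_fst))
  have hm2 : Measurable (Function.uncurry fun x y => {x | F x ≤ G y}.indicator
        (fun x => G y ^ (7 / 8 : ℝ) * F x ^ (7 / 8 : ℝ) * rieszKernel (y - x)) x) := by
    have : Measurable fun p : ℝ × ℝ =>
      G p.2 ^ (7 / 8 : ℝ) * F p.1 ^ (7 / 8 : ℝ) * rieszKernel (p.2 - p.1) := by fun_prop
    exact this.indicator (measurableSet_le (hF.comp measurable_fst) (hG.comp measurable_snd))
  calc _ ≤ _ := lintegral_lintegral_le_of_le_add hm1 hm2 hpt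
    _ ≤ (∫⁻ x, 6 * F x) + ∫⁻ y, 6 * G y :=
        add_le_add (lintegral_mono fun x => lintegral_truncated_riesz_le hG hG1 (F x) x)
          (lintegral_mono fun y => lintegral_truncated_riesz_le hF hF1 (G y) y)
    _ ≤ 6 * 1 + 6 * 1 := by
        rw [lintegral_const_mul _ hF, lintegral_const_mul _ hG]
        gcongr
    _ = 12 := by norm_num

/-- The diagonal Hardy-Littlewood-Sobolev inequality on the line with exponent `1/4`. -/
theorem hardyLittlewoodSobolev {F G : ℝ → ℝ≥0∞} (hF : Measurable F) (hG : Measurable G) :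
    ∫⁻ x, ∫⁻ y, F x ^ (7 / 8 : ℝ) * G y ^ (7 / 8 : ℝ) * rieszKernel (x - y) ≤
      12 * ((∫⁻ x, F x) ^ (7 / 8 : ℝ) * (∫⁻ y, G y) ^ (7 / 8 : ℝ)) := by
  have h78 : (0 : ℝ) < 7 / 8 := by norm_num
  set I := ∫⁻ x, F x with hI
  set J := ∫⁻ y, G y with hJ
  rcases eq_or_ne I 0 with hI0 | hI0
  · have : ∀ᵐ x, F x = 0 := (lintegral_eq_zero_iff hF).1 hI0
    refine le_of_eq_of_le ?_ (zero_le)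
    rw [lintegral_congr_ae (g := fun _ => 0), lintegral_zero]
    filter_upwards [this] with x hx
    simp [hx, ENNReal.zero_rpow_of_pos h78]
  rcases eq_or_ne J 0 with hJ0 | hJ0
  · have : ∀ᵐ x, G x = 0 := (lintegral_eq_zero_iff hG).1 hJ0
    refine le_of_eq_of_le ?_ (zero_le)
    rw [← lintegral_zero]
    refine lintegral_congr fun x => ?_
    rw [lintegral_congr_ae (g := fun _ => 0), lintegral_zero]
    filter_upwards [this] with y hy
    simp [hy, ENNReal.zero_rpow_of_pos h78]
  have hI0' : I ^ (7 / 8 : ℝ) ≠ 0 := by simp [ENNReal.rpow_eq_zero_iff, hI0, h78.not_gt]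
  have hJ0' : J ^ (7 / 8 : ℝ) ≠ 0 := by simp [ENNReal.rpow_eq_zero_iff, hJ0, h78.not_gt]
  rcases eq_or_ne I ∞ with hIt | hIt
  · rw [hIt, ENNReal.top_rpow_of_pos h78, ENNReal.top_mul hJ0', ENNReal.mul_top (by norm_num)]
    exact le_top
  rcases eq_or_ne J ∞ with hJt | hJt
  · rw [hJt, ENNReal.top_rpow_of_pos h78, ENNReal.mul_top hI0', ENNReal.mul_top (by norm_num)]
    exact le_top
  have key := hardyLittlewoodSobolev_normalized (F := fun x => I⁻¹ * F x) (G := fun y => J⁻¹ * G y)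
    (by fun_prop) (by fun_prop)
    (by rw [lintegral_const_mul _ hF, ← hI, ENNReal.inv_mul_cancel hI0 hIt])
    (by rw [lintegral_const_mul _ hG, ← hJ, ENNReal.inv_mul_cancel hJ0 hJt])
  have hscale : ∀ (c u : ℝ≥0∞), c ≠ 0 → c ≠ ∞ →
      u ^ (7 / 8 : ℝ) = c ^ (7 / 8 : ℝ) * (c⁻¹ * u) ^ (7 / 8 : ℝ) := by
    intro c u h0 ht
    rw [← ENNReal.mul_rpow_of_nonneg _ _ h78.le, ← mul_assoc, ENNReal.mul_inv_cancel h0 ht, one_mul]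
  calc _ = ∫⁻ x, ∫⁻ y, I ^ (7 / 8 : ℝ) * J ^ (7 / 8 : ℝ) *
        ((I⁻¹ * F x) ^ (7 / 8 : ℝ) * (J⁻¹ * G y) ^ (7 / 8 : ℝ) * rieszKernel (x - y)) := by
        refine lintegral_congr fun x => lintegral_congr fun y => ?_
        rw [hscale I (F x) hI0 hIt, hscale J (G y) hJ0 hJt]
        ring
    _ = I ^ (7 / 8 : ℝ) * J ^ (7 / 8 : ℝ) * ∫⁻ x, ∫⁻ y,
        ((I⁻¹ * F x) ^ (7 / 8 : ℝ) * (J⁻¹ * G y) ^ (7 / 8 : ℝ) * rieszKernel (x - y)) := by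
        rw [← lintegral_const_mul' _ _ (ENNReal.mul_ne_top
          (ENNReal.rpow_ne_top_of_nonneg h78.le hIt) (ENNReal.rpow_ne_top_of_nonneg h78.le hJt))]
        refine lintegral_congr fun x => ?_
        rw [lintegral_const_mul _ (by fun_prop)]
    _ ≤ I ^ (7 / 8 : ℝ) * J ^ (7 / 8 : ℝ) * 12 := mul_le_mul_right key _
    _ = _ := mul_comm _ _

/-- The product-kernel Hardy-Littlewood-Sobolev inequality on the plane. -/
theorem hardyLittlewoodSobolev_prod {F G : ℝ × ℝ → ℝ≥0∞} (hF : Measurable F) (hG : Measurable G) :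
    ∫⁻ p, ∫⁻ q, F p ^ (7 / 8 : ℝ) * G q ^ (7 / 8 : ℝ) *
      (rieszKernel (p.1 - q.1) * rieszKernel (p.2 - q.2)) ≤
      144 * ((∫⁻ p, F p) ^ (7 / 8 : ℝ) * (∫⁻ q, G q) ^ (7 / 8 : ℝ)) := by
  set Φ : ℝ → ℝ → ℝ≥0∞ := fun t s => ∫⁻ x, ∫⁻ y, F (x, t) ^ (7 / 8 : ℝ) * G (y, s) ^ (7 / 8 : ℝ) *
      rieszKernel (x - y) with hΦ
  have hF' : Measurable fun t => ∫⁻ x, F (x, t) := hF.lintegral_prod_left'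
  have hG' : Measurable fun t => ∫⁻ x, G (x, t) := hG.lintegral_prod_left'
  have hslice : ∀ t s, Φ t s ≤
      12 * ((∫⁻ x, F (x, t)) ^ (7 / 8 : ℝ) * (∫⁻ y, G (y, s)) ^ (7 / 8 : ℝ)) := fun t s =>
    hardyLittlewoodSobolev (F := fun x => F (x, t)) (G := fun y => G (y, s)) (by fun_prop)
      (by fun_prop)
  calc _ = ∫⁻ t, ∫⁻ s, Φ t s * rieszKernel (t - s) := by
        rw [Measure.volume_eq_prod, lintegral_prod_symm _ (by
          apply AEMeasurable.lintegral_prod_right'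
            (f := fun z : (ℝ × ℝ) × (ℝ × ℝ) => F z.1 ^ (7 / 8 : ℝ) * G z.2 ^ (7 / 8 : ℝ) *
              (rieszKernel (z.1.1 - z.2.1) * rieszKernel (z.1.2 - z.2.2)))
          fun_prop)]
        refine lintegral_congr fun t => ?_
        have : ∀ x, ∫⁻ q, F (x, t) ^ (7 / 8 : ℝ) * G q ^ (7 / 8 : ℝ) *
            (rieszKernel (x - q.1) * rieszKernel (t - q.2)) ∂(volume.prod volume) =
            ∫⁻ s, ∫⁻ y, F (x, t) ^ (7 / 8 : ℝ) * G (y, s) ^ (7 / 8 : ℝ) * rieszKernel (x - y) *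
              rieszKernel (t - s) := fun x => by
          rw [lintegral_prod_symm _ (by fun_prop)]
          simp only [mul_assoc]
        simp only [this]
        rw [lintegral_lintegral_swap]
        · refine lintegral_congr fun s => ?_
          rw [hΦ, ← lintegral_mul_const]
          · refine lintegral_congr fun x => ?_
            rw [lintegral_mul_const _ (by fun_prop)]
          · apply Measurable.lintegral_prod_right'
              (f := fun z : ℝ × ℝ => F (z.1, t) ^ (7 / 8 : ℝ) * G (z.2, s) ^ (7 / 8 : ℝ) *
                rieszKernel (z.1 - z.2))
            fun_prop
        · apply AEMeasurable.lintegral_prod_right'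
            (f := fun z : (ℝ × ℝ) × ℝ => F (z.1.1, t) ^ (7 / 8 : ℝ) * G (z.2, z.1.2) ^ (7 / 8 : ℝ) *
              rieszKernel (z.1.1 - z.2) * rieszKernel (t - z.1.2))
          fun_prop
    _ ≤ ∫⁻ t, ∫⁻ s, 12 * ((∫⁻ x, F (x, t)) ^ (7 / 8 : ℝ) * (∫⁻ y, G (y, s)) ^ (7 / 8 : ℝ) *
          rieszKernel (t - s)) := by
        refine lintegral_mono fun t => lintegral_mono fun s => ?_
        rw [← mul_assoc]
        exact mul_le_mul_left (hslice t s) _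
    _ = 12 * ∫⁻ t, ∫⁻ s, ((∫⁻ x, F (x, t)) ^ (7 / 8 : ℝ) * (∫⁻ y, G (y, s)) ^ (7 / 8 : ℝ) *
          rieszKernel (t - s)) := by
        rw [← lintegral_const_mul' _ _ (by norm_num)]
        refine lintegral_congr fun t => ?_
        rw [lintegral_const_mul' _ _ (by norm_num)]
    _ ≤ 12 * (12 * ((∫⁻ t, ∫⁻ x, F (x, t)) ^ (7 / 8 : ℝ) *
          (∫⁻ s, ∫⁻ y, G (y, s)) ^ (7 / 8 : ℝ))) :=
        mul_le_mul_right (hardyLittlewoodSobolev hF' hG') _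
    _ = _ := by
        rw [Measure.volume_eq_prod, lintegral_prod_symm _ hF.aemeasurable,
          lintegral_prod_symm _ hG.aemeasurable, ← mul_assoc]
        norm_num

theorem enorm_integral_exp_cubic_le (z τ : ℝ) {N : ℝ} (hN : 0 ≤ N) :
    ‖∫ ξ in (-N)..N, Complex.exp
      (((2 * Real.pi) ^ 3 * τ * ξ ^ 3 + 2 * Real.pi * z * ξ : ℝ) * Complex.I)‖ₑ ≤
      26 * (rieszKernel z * rieszKernel τ) := by
  rcases eq_or_ne z 0 with rfl | hz
  · rw [rieszKernel_zero, ENNReal.top_mul (rieszKernel_ne_zero τ),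
      ENNReal.mul_top (by norm_num)]
    exact le_top
  rcases eq_or_ne τ 0 with rfl | hτ
  · rw [rieszKernel_zero, ENNReal.mul_top (rieszKernel_ne_zero z),
      ENNReal.mul_top (by norm_num)]
    exact le_top
  have hπ : 1 ≤ 2 * Real.pi := by linarith [Real.pi_gt_three]
  have hz' := abs_pos.2 hz
  have hτ' := abs_pos.2 hτ
  rw [rieszKernel_of_ne_zero hz, rieszKernel_of_ne_zero hτ,
    ← ENNReal.ofReal_mul (by positivity), ← ENNReal.ofReal_ofNat,
    ← ENNReal.ofReal_mul (by norm_num), ← ofReal_norm]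
  refine ENNReal.ofReal_le_ofReal ?_
  refine (norm_integral_exp_cubic_le (mul_ne_zero (by positivity) hτ)
    (mul_ne_zero (by positivity) hz) hN).trans ?_
  rw [← Real.mul_rpow hz'.le hτ'.le]
  refine mul_le_mul_of_nonneg_left ?_ (by norm_num)
  refine Real.rpow_le_rpow_of_nonpos (by positivity) ?_ (by norm_num)
  rw [abs_mul, abs_mul, abs_of_nonneg (by positivity : 0 ≤ (2 * Real.pi) ^ 3),
    abs_of_nonneg (by positivity : 0 ≤ 2 * Real.pi)]
  have h4 : 1 ≤ (2 * Real.pi) ^ 4 := one_le_pow₀ hπ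
  have : 0 < |z| * |τ| := by positivity
  nlinarith

theorem intervalIntegral_swap_of_continuous {F : ℝ → ℝ → ℂ} (hF : Continuous F.uncurry)
    (a b c d : ℝ) :
    ∫ x in a..b, ∫ y in c..d, F x y = ∫ y in c..d, ∫ x in a..b, F x y :=
  intervalIntegral_intervalIntegral_swap <|
    (hF.continuousOn.integrableOn_compact (isCompact_uIcc.prod isCompact_uIcc)).mono_set
      (Set.prod_mono Set.uIoc_subset_uIcc Set.uIoc_subset_uIcc)

theorem enorm_intervalIntegral_le {g : ℝ → ℂ} {G : ℝ → ℝ≥0∞} {a b : ℝ}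
    (h : ∀ x ∈ Set.uIoc a b, ‖g x‖ₑ ≤ G x) : ‖∫ x in a..b, g x‖ₑ ≤ ∫⁻ x, G x := by
  have : ‖∫ x in a..b, g x‖ₑ = ‖∫ x in Set.uIoc a b, g x‖ₑ := by
    rw [← ofReal_norm, intervalIntegral.norm_integral_eq_norm_integral_uIoc, ofReal_norm]
  rw [this]
  exact (enorm_integral_le_lintegral_enorm _).trans
    ((setLIntegral_mono' measurableSet_uIoc h).trans (setLIntegral_le_lintegral _ _))

theorem support_pdx_subset (g : ℝ × ℝ → ℝ) : Function.support (pdx g) ⊆ tsupport g := by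
  intro p hp
  by_contra hpt
  refine hp ?_
  have h0 : g =ᶠ[𝓝 p] 0 := notMem_tsupport_iff_eventuallyEq.1 hpt
  have hc : Tendsto (fun x : ℝ => (x, p.2)) (𝓝 p.1) (𝓝 p) :=
    Continuous.tendsto' (by fun_prop) _ _ rfl
  have : (fun x => g (x, p.2)) =ᶠ[𝓝 p.1] fun _ => 0 := hc.eventually h0
  simp [pdx, this.deriv_eq]

theorem support_pdt_subset (g : ℝ × ℝ → ℝ) : Function.support (pdt g) ⊆ tsupport g := by
  intro p hp
  by_contra hpt
  refine hp ?_
  have h0 : g =ᶠ[𝓝 p] 0 := notMem_tsupport_iff_eventuallyEq.1 hpt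
  have hc : Tendsto (fun t : ℝ => (p.1, t)) (𝓝 p.2) (𝓝 p) :=
    Continuous.tendsto' (by fun_prop) _ _ rfl
  have : (fun t => g (p.1, t)) =ᶠ[𝓝 p.2] fun _ => 0 := hc.eventually h0
  simp [pdt, this.deriv_eq]

theorem HasCompactSupport.pdx {g : ℝ × ℝ → ℝ} (hg : HasCompactSupport g) :
    HasCompactSupport (pdx g) := hg.mono' (support_pdx_subset g)

theorem HasCompactSupport.pdt {g : ℝ × ℝ → ℝ} (hg : HasCompactSupport g) :
    HasCompactSupport (pdt g) := hg.mono' (support_pdt_subset g)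

theorem HasCompactSupport.exists_eq_zero_of_lt_abs {g : ℝ × ℝ → ℝ} (hg : HasCompactSupport g) :
    ∃ R > 0, ∀ x t, (R ≤ |x| ∨ R ≤ |t|) → g (x, t) = 0 := by
  obtain ⟨R, hR, h⟩ := hg.isCompact.isBounded.exists_pos_norm_lt
  refine ⟨R, hR, fun x t hxt => ?_⟩
  by_contra hne
  have := h (x, t) (subset_tsupport g hne)
  rw [Prod.norm_mk, max_lt_iff, Real.norm_eq_abs, Real.norm_eq_abs] at this
  rcases hxt with h | h <;> linarith

/-- The slice at time `t`, as a complex-valued function. -/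
noncomputable def slice (g : ℝ × ℝ → ℝ) (t : ℝ) : ℝ → ℂ := fun y => (g (y, t) : ℂ)

theorem continuous_slice {g : ℝ × ℝ → ℝ} (hg : Continuous g) (t : ℝ) : Continuous (slice g t) := by
  unfold slice; fun_prop

theorem hasCompactSupport_slice {g : ℝ × ℝ → ℝ} (hg : HasCompactSupport g) (t : ℝ) :
    HasCompactSupport (slice g t) := by
  obtain ⟨R, -, h⟩ := hg.exists_eq_zero_of_lt_abs
  refine HasCompactSupport.intro (isCompact_Icc (a := -R) (b := R)) fun x hx => ?_
  rw [slice, h x t (Or.inl (le_of_not_ge fun h' => hx (abs_le.1 h'))), Complex.ofReal_zero]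

theorem integrable_slice {g : ℝ × ℝ → ℝ} (hg : Continuous g) (hs : HasCompactSupport g) (t : ℝ) :
    Integrable (slice g t) :=
  (continuous_slice hg t).integrable_of_hasCompactSupport (hasCompactSupport_slice hs t)

theorem fourier_slice_eq_intervalIntegral {g : ℝ × ℝ → ℝ} {R : ℝ} (hR : 0 < R)
    (hg : ∀ x t, (R ≤ |x| ∨ R ≤ |t|) → g (x, t) = 0) (t ξ : ℝ) :
    𝓕 (slice g t) ξ =
      ∫ y in (-R)..R, Complex.exp ((-2 * Real.pi * y * ξ : ℝ) * Complex.I) * g (y, t) := by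
  rw [Real.fourier_real_eq_integral_exp_smul, intervalIntegral.integral_of_le (by linarith),
    setIntegral_eq_integral_of_forall_compl_eq_zero]
  · simp [slice]
  · intro y hy
    rw [hg y t (Or.inl _), Complex.ofReal_zero, mul_zero]
    by_contra! h
    exact hy ⟨(abs_lt.1 h).1, (abs_lt.1 h).2.le⟩

theorem fourier_slice_pdx {g : ℝ × ℝ → ℝ} (hg : Continuous g) (hs : HasCompactSupport g)
    (hg' : Continuous (pdx g)) {t : ℝ} (hd : Differentiable ℝ fun x => g (x, t)) (ξ : ℝ) :
    𝓕 (slice (pdx g) t) ξ = (2 * Real.pi * Complex.I * ξ) * 𝓕 (slice g t) ξ := by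
  have hD : ∀ x, HasDerivAt (slice g t) (slice (pdx g) t x) x := fun x =>
    (hd x).hasDerivAt.ofReal_comp
  have hderiv : deriv (slice g t) = slice (pdx g) t := funext fun x => (hD x).deriv
  have := Real.fourier_deriv (integrable_slice hg hs t) (fun x => (hD x).differentiableAt)
    (by rw [hderiv]; exact integrable_slice hg' hs.pdx t)
  rw [hderiv] at this
  simpa only [smul_eq_mul] using congrFun this ξ

theorem continuous_fourier_slice {g : ℝ × ℝ → ℝ} (hg : Continuous g) (hs : HasCompactSupport g)
    (ξ : ℝ) : Continuous fun t => 𝓕 (slice g t) ξ := by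
  obtain ⟨R, hR, h⟩ := hs.exists_eq_zero_of_lt_abs
  simp_rw [fourier_slice_eq_intervalIntegral hR h]
  exact intervalIntegral.continuous_parametric_intervalIntegral_of_continuous' (by fun_prop) _ _

theorem hasDerivAt_fourier_slice {g : ℝ × ℝ → ℝ} (hg : Continuous g) (hs : HasCompactSupport g)
    (hd : ∀ x, Differentiable ℝ fun t => g (x, t)) (hg' : Continuous (pdt g)) (t ξ : ℝ) :
    HasDerivAt (fun t => 𝓕 (slice g t) ξ) (𝓕 (slice (pdt g) t) ξ) t := by
  obtain ⟨R₁, hR₁, h₁⟩ := hs.exists_eq_zero_of_lt_abs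
  obtain ⟨R₂, hR₂, h₂⟩ := hs.pdt.exists_eq_zero_of_lt_abs
  obtain ⟨C, hC⟩ := hs.pdt.exists_bound_of_continuous hg'
  have hR : 0 < max R₁ R₂ := hR₁.trans_le (le_max_left _ _)
  have e₁ := fourier_slice_eq_intervalIntegral (g := g) hR fun x t hxt => h₁ x t
    (hxt.imp (le_max_left _ _).trans (le_max_left _ _).trans)
  have e₂ := fourier_slice_eq_intervalIntegral (g := pdt g) hR fun x t hxt => h₂ x t
    (hxt.imp (le_max_right _ _).trans (le_max_right _ _).trans)
  simp_rw [e₁, e₂]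
  refine (intervalIntegral.hasDerivAt_integral_of_dominated_loc_of_deriv_le (bound := fun _ => C)
    (F := fun s y => Complex.exp ((-2 * Real.pi * y * ξ : ℝ) * Complex.I) * g (y, s))
    (F' := fun s y => Complex.exp ((-2 * Real.pi * y * ξ : ℝ) * Complex.I) * pdt g (y, s))
    (s := Set.univ) Filter.univ_mem
    (.of_forall fun s => Continuous.aestronglyMeasurable (by fun_prop))
    (Continuous.intervalIntegrable (by fun_prop) _ _)
    (Continuous.aestronglyMeasurable (by fun_prop)) (.of_forall fun y _ s _ => ?_)
    intervalIntegrable_const (.of_forall fun y _ s _ => ?_)).2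
  · rw [norm_mul, Complex.norm_exp_ofReal_mul_I, one_mul, Complex.norm_real]
    exact hC (y, s)
  · exact ((hd y s).hasDerivAt.ofReal_comp).const_mul _

/-- The damped Airy operator `∂ₜ + ∂ₓ³ + a`. -/
noncomputable def dampedAiry (a : ℝ) (h : ℝ × ℝ → ℝ) : ℝ × ℝ → ℝ :=
  fun p => pdt h p + pdx (pdx (pdx h)) p + a * h p

theorem HasCompactSupport.dampedAiry {h : ℝ × ℝ → ℝ} (hs : HasCompactSupport h) (a : ℝ) :
    HasCompactSupport (dampedAiry a h) :=
  (hs.pdt.add hs.pdx.pdx.pdx).add hs.mul_left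

namespace C31

variable {h : ℝ × ℝ → ℝ}

theorem differentiable_slice_pdx (hh : C31 h) (t : ℝ) : Differentiable ℝ fun x => pdx h (x, t) :=
  ((hh.1 t).iterate_deriv' 2 1).differentiable (by norm_num)

theorem differentiable_slice_pdx_pdx (hh : C31 h) (t : ℝ) :
    Differentiable ℝ fun x => pdx (pdx h) (x, t) :=
  ((hh.1 t).iterate_deriv' 1 2).differentiable (by norm_num)

theorem differentiable_slice (hh : C31 h) (t : ℝ) : Differentiable ℝ fun x => h (x, t) :=
  (hh.1 t).differentiable (by norm_num)

theorem fourier_slice_pdx_pdx (hh : C31 h) (hs : HasCompactSupport h) (t ξ : ℝ) :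
    𝓕 (slice (pdx (pdx h)) t) ξ = (2 * Real.pi * Complex.I * ξ) ^ 2 * 𝓕 (slice h t) ξ := by
  have ⟨_, _, h0, h1, h2, _, _⟩ := hh
  rw [fourier_slice_pdx h1 hs.pdx h2 (hh.differentiable_slice_pdx t),
    fourier_slice_pdx h0 hs h1 (hh.differentiable_slice t)]
  ring

theorem fourier_slice_pdx_pdx_pdx (hh : C31 h) (hs : HasCompactSupport h) (t ξ : ℝ) :
    𝓕 (slice (pdx (pdx (pdx h))) t) ξ =
      (2 * Real.pi * Complex.I * ξ) ^ 3 * 𝓕 (slice h t) ξ := by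
  have ⟨_, _, _, _, h2, h3, _⟩ := hh
  rw [fourier_slice_pdx h2 hs.pdx.pdx h3 (hh.differentiable_slice_pdx_pdx t),
    hh.fourier_slice_pdx_pdx hs]
  ring

theorem integrable_fourier_slice (hh : C31 h) (hs : HasCompactSupport h) (t : ℝ) :
    Integrable (𝓕 (slice h t)) := by
  have ⟨_, _, h0, _, h2, _, _⟩ := hh
  have hb : ∀ (g : ℝ → ℂ) (ξ : ℝ), ‖𝓕 g ξ‖ ≤ ∫ y, ‖g y‖ := fun g ξ =>
    VectorFourier.norm_fourierIntegral_le_integral_norm _ _ _ _ _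
  refine Integrable.mono' (g := fun ξ : ℝ => ((∫ y, ‖slice h t y‖) +
    ∫ y, ‖slice (pdx (pdx h)) t y‖) * (1 + ξ ^ 2)⁻¹) (integrable_inv_one_add_sq.const_mul _)
    (Continuous.aestronglyMeasurable ?_) (.of_forall fun ξ => ?_)
  · exact VectorFourier.fourierIntegral_continuous Real.continuous_fourierChar
      (by exact continuous_inner) (integrable_slice h0 hs t)
  · have e0 := hb (slice h t) ξ
    have e2 := hb (slice (pdx (pdx h)) t) ξ
    rw [hh.fourier_slice_pdx_pdx hs, norm_mul] at e2
    have : ‖(2 * Real.pi * Complex.I * ξ : ℂ) ^ 2‖ = (2 * Real.pi) ^ 2 * ξ ^ 2 := by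
      simp [mul_pow, abs_of_pos Real.pi_pos]
    rw [this] at e2
    have hle : ξ ^ 2 * ‖𝓕 (slice h t) ξ‖ ≤ (2 * Real.pi) ^ 2 * ξ ^ 2 * ‖𝓕 (slice h t) ξ‖ := by
      refine mul_le_mul_of_nonneg_right (le_mul_of_one_le_left (sq_nonneg _) ?_) (norm_nonneg _)
      exact one_le_pow₀ (by linarith [Real.pi_gt_three])
    rw [← div_eq_mul_inv, le_div_iff₀ (by positivity)]
    linarith

theorem continuous_dampedAiry (hh : C31 h) (a : ℝ) : Continuous (dampedAiry a h) := by
  have ⟨_, _, h0, _, _, h3, ht⟩ := hh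
  unfold dampedAiry; fun_prop

theorem fourier_slice_dampedAiry (hh : C31 h) (hs : HasCompactSupport h) (a t ξ : ℝ) :
    𝓕 (slice (dampedAiry a h) t) ξ = 𝓕 (slice (pdt h) t) ξ +
      (a + (2 * Real.pi * Complex.I * ξ) ^ 3) * 𝓕 (slice h t) ξ := by
  have ⟨_, _, h0, _, _, h3, ht⟩ := hh
  have hsum : slice (dampedAiry a h) t =
      (slice (pdt h) t + slice (pdx (pdx (pdx h))) t) + (a : ℂ) • slice h t := by
    ext y; simp [slice, dampedAiry]
  have i1 := integrable_slice ht hs.pdt t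
  have i3 := integrable_slice h3 hs.pdx.pdx.pdx t
  have i0 := integrable_slice h0 hs t
  have hadd : ∀ {u v : ℝ → ℂ}, Integrable u → Integrable v → 𝓕 (u + v) = 𝓕 u + 𝓕 v :=
    fun hu hv => VectorFourier.fourierIntegral_add Real.continuous_fourierChar
      (by exact continuous_inner) hu hv
  have hsmul : 𝓕 ((a : ℂ) • slice h t) = (a : ℂ) • 𝓕 (slice h t) :=
    VectorFourier.fourierIntegral_const_smul _ _ _ _ _
  rw [hsum, hadd (i1.add i3) (i0.smul _), hadd i1 i3, hsmul]
  simp only [Pi.add_apply, Pi.smul_apply, smul_eq_mul]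
  rw [hh.fourier_slice_pdx_pdx_pdx hs]
  ring

/-- Duhamel's formula on the Fourier side, from a time `T` where the solution vanishes. -/
theorem fourier_slice_eq_duhamel (hh : C31 h) (hs : HasCompactSupport h) (a ξ t : ℝ) {T : ℝ}
    (hT : ∀ x, h (x, T) = 0) :
    𝓕 (slice h t) ξ = ∫ s in T..t,
      Complex.exp (-(t - s) * (a + (2 * Real.pi * Complex.I * ξ) ^ 3)) *
        𝓕 (slice (dampedAiry a h) s) ξ := by
  have ⟨_, hd, h0, _, _, _, ht⟩ := hh
  set c : ℂ := a + (2 * Real.pi * Complex.I * ξ) ^ 3 with hc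
  have hder : ∀ s ∈ Set.uIcc T t, HasDerivAt
      (fun s : ℝ => Complex.exp (-(t - s) * c) * 𝓕 (slice h s) ξ)
      (Complex.exp (-(t - s) * c) * 𝓕 (slice (dampedAiry a h) s) ξ) s := by
    intro s _
    have he : HasDerivAt (fun s : ℝ => Complex.exp (-(t - s) * c))
        (Complex.exp (-(t - s) * c) * c) s := by
      have : HasDerivAt (fun s : ℝ => -((t : ℂ) - (s : ℂ)) * c) (1 * c) s := by
        refine HasDerivAt.mul_const ?_ c
        exact (((hasDerivAt_id s).ofReal_comp).const_sub (t : ℂ)).neg.congr_deriv (by simp)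
      simpa using this.cexp
    refine (he.mul (hasDerivAt_fourier_slice h0 hs hd ht s ξ)).congr_deriv ?_
    rw [hh.fourier_slice_dampedAiry hs]
    ring
  have hcont := continuous_fourier_slice (hh.continuous_dampedAiry a) (hs.dampedAiry a) ξ
  have hexp : Continuous fun s : ℝ => Complex.exp (-(t - s) * c) := by fun_prop
  rw [intervalIntegral.integral_eq_sub_of_hasDerivAt hder
    ((hexp.mul hcont).intervalIntegrable _ _)]
  have hFT : 𝓕 (slice h T) ξ = 0 := by
    simp [Real.fourier_real_eq_integral_exp_smul, slice, hT]
  simp [hFT]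

theorem tendsto_truncated_fourierInv (hh : C31 h) (hs : HasCompactSupport h) (x t : ℝ) :
    Tendsto (fun N : ℝ => ∫ ξ in (-N)..N,
      Complex.exp ((2 * Real.pi * ξ * x : ℝ) * Complex.I) * 𝓕 (slice h t) ξ) atTop
      (𝓝 (h (x, t) : ℂ)) := by
  have hc := continuous_slice hh.2.2.1 t
  have hi := hh.integrable_fourier_slice hs t
  have hinv := congrFun (hc.fourierInv_fourier_eq (integrable_slice hh.2.2.1 hs t) hi) x
  rw [Real.fourierInv_eq'] at hinv
  change _ = (h (x, t) : ℂ) at hinv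
  have hint : Integrable fun ξ : ℝ =>
      Complex.exp ((2 * Real.pi * ξ * x : ℝ) * Complex.I) * 𝓕 (slice h t) ξ := by
    refine hi.bdd_mul (c := 1) (Continuous.aestronglyMeasurable (by fun_prop))
      (.of_forall fun ξ => (Complex.norm_exp_ofReal_mul_I _).le)
  have heq : ∫ ξ : ℝ, Complex.exp ((2 * Real.pi * ξ * x : ℝ) * Complex.I) * 𝓕 (slice h t) ξ =
      h (x, t) := by
    rw [← hinv]
    refine integral_congr_ae (.of_forall fun ξ => ?_)
    simp only [RCLike.inner_apply, conj_trivial, smul_eq_mul]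
    ring_nf
  rw [← heq]
  exact intervalIntegral_tendsto_integral hint tendsto_neg_atTop_atBot tendsto_id

theorem enorm_truncated_fourierInv_le (hh : C31 h) (hs : HasCompactSupport h) (a x t : ℝ) {N : ℝ}
    (hN : 0 ≤ N) :
    ‖∫ ξ in (-N)..N, Complex.exp ((2 * Real.pi * ξ * x : ℝ) * Complex.I) * 𝓕 (slice h t) ξ‖ₑ ≤
      26 * ∫⁻ q, ‖dampedAiry a h q‖ₑ * (rieszKernel (x - q.1) * rieszKernel (t - q.2)) := by
  obtain ⟨T, hT, hexp⟩ : ∃ T, (∀ x, h (x, T) = 0) ∧ ∀ s ∈ Set.uIoc T t, 0 ≤ a * (t - s) := by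
    obtain ⟨R, -, hR⟩ := hs.exists_eq_zero_of_lt_abs
    rcases le_total 0 a with ha | ha
    · have hle : min (-R) t ≤ t := min_le_right _ _
      refine ⟨min (-R) t, fun x => hR _ _ (Or.inr (le_abs.2 (Or.inr ?_))), fun s hs => ?_⟩
      · linarith [min_le_left (-R) t]
      · rw [Set.uIoc_of_le hle] at hs
        exact mul_nonneg ha (sub_nonneg.2 hs.2)
    · have hle : t ≤ max R t := le_max_right _ _
      refine ⟨max R t, fun x => hR _ _ (Or.inr (le_abs.2 (Or.inl (le_max_left _ _)))),
        fun s hs => ?_⟩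
      rw [Set.uIoc_of_ge hle] at hs
      exact mul_nonneg_of_nonpos_of_nonpos ha (sub_nonpos.2 hs.1.le)
  have hfc := hh.continuous_dampedAiry a
  obtain ⟨R, hR0, hR⟩ := (hs.dampedAiry a).exists_eq_zero_of_lt_abs
  set f := dampedAiry a h with hf
  set Φ : ℝ → ℝ → ℝ → ℂ := fun ξ s y => Complex.exp ((2 * Real.pi * ξ * x : ℝ) * Complex.I) *
    (Complex.exp (-(t - s) * (a + (2 * Real.pi * Complex.I * ξ) ^ 3)) *
      (Complex.exp ((-2 * Real.pi * y * ξ : ℝ) * Complex.I) * f (y, s))) with hΦ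
  have hΦc : Continuous fun p : ℝ × ℝ × ℝ => Φ p.1 p.2.1 p.2.2 := by
    rw [hΦ]; fun_prop
  have hΦ₁ : Continuous (Function.uncurry fun ξ s => ∫ y in (-R)..R, Φ ξ s y) :=
    intervalIntegral.continuous_parametric_intervalIntegral_of_continuous'
      (f := fun (p : ℝ × ℝ) y => Φ p.1 p.2 y)
      (hΦc.comp (by fun_prop : Continuous fun z : (ℝ × ℝ) × ℝ => (z.1.1, z.1.2, z.2))) _ _
  have hΦ₂ : ∀ s, Continuous (Function.uncurry fun ξ y => Φ ξ s y) := fun s =>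
    hΦc.comp (by fun_prop : Continuous fun z : ℝ × ℝ => (z.1, s, z.2))
  have hrep : ∫ ξ in (-N)..N,
      Complex.exp ((2 * Real.pi * ξ * x : ℝ) * Complex.I) * 𝓕 (slice h t) ξ =
      ∫ s in T..t, ∫ y in (-R)..R, ∫ ξ in (-N)..N, Φ ξ s y := by
    simp_rw [hh.fourier_slice_eq_duhamel hs a _ t hT, ← hf,
      fourier_slice_eq_intervalIntegral hR0 hR, ← intervalIntegral.integral_const_mul]
    rw [intervalIntegral_swap_of_continuous hΦ₁]
    exact intervalIntegral.integral_congr fun s _ =>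
      intervalIntegral_swap_of_continuous (hΦ₂ s) _ _ _ _
  have hker : ∀ s y, ∫ ξ in (-N)..N, Φ ξ s y = (Real.exp (-(a * (t - s))) * f (y, s) : ℝ) *
      ∫ ξ in (-N)..N, Complex.exp (((2 * Real.pi) ^ 3 * (t - s) * ξ ^ 3 +
        2 * Real.pi * (x - y) * ξ : ℝ) * Complex.I) := by
    intro s y
    rw [← intervalIntegral.integral_const_mul]
    refine intervalIntegral.integral_congr fun ξ _ => ?_
    simp only [hΦ]
    have hexp : Complex.exp ((2 * Real.pi * ξ * x : ℝ) * Complex.I) *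
        (Complex.exp (-(t - s) * (a + (2 * Real.pi * Complex.I * ξ) ^ 3)) *
          Complex.exp ((-2 * Real.pi * y * ξ : ℝ) * Complex.I)) =
        (Real.exp (-(a * (t - s))) : ℝ) * Complex.exp (((2 * Real.pi) ^ 3 * (t - s) * ξ ^ 3 +
          2 * Real.pi * (x - y) * ξ : ℝ) * Complex.I) := by
      rw [Complex.ofReal_exp, ← Complex.exp_add, ← Complex.exp_add, ← Complex.exp_add]
      congr 1
      push_cast
      linear_combination (-(t - s) * (2 * Real.pi * ξ) ^ 3 * Complex.I : ℂ) * Complex.I_sq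
    rw [Complex.ofReal_mul (Real.exp _)]
    linear_combination (f (y, s) : ℂ) * hexp
  have hbound : ∀ s ∈ Set.uIoc T t, ∀ y, ‖∫ ξ in (-N)..N, Φ ξ s y‖ₑ ≤
      26 * (‖f (y, s)‖ₑ * (rieszKernel (x - y) * rieszKernel (t - s))) := by
    intro s hs y
    rw [hker, enorm_mul, mul_left_comm]
    refine mul_le_mul' ?_ (enorm_integral_exp_cubic_le _ _ hN)
    rw [← ofReal_norm, ← ofReal_norm, Complex.norm_real, norm_mul,
      Real.norm_of_nonneg (Real.exp_pos _).le]
    refine ENNReal.ofReal_le_ofReal (mul_le_of_le_one_left (norm_nonneg _) ?_)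
    exact Real.exp_le_one_iff.2 (neg_nonpos.2 (hexp s hs))
  rw [hrep]
  refine (enorm_intervalIntegral_le fun s hs =>
    enorm_intervalIntegral_le fun y _ => hbound s hs y).trans_eq ?_
  have hm : Measurable fun q : ℝ × ℝ =>
      ‖f q‖ₑ * (rieszKernel (x - q.1) * rieszKernel (t - q.2)) := by
    have := hfc.measurable
    fun_prop
  rw [Measure.volume_eq_prod, lintegral_prod_symm _ hm.aemeasurable,
    ← lintegral_const_mul' _ _ (by norm_num)]
  refine lintegral_congr fun s => ?_
  rw [lintegral_const_mul' _ _ (by norm_num)]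

theorem enorm_le_riesz_potential (hh : C31 h) (hs : HasCompactSupport h) (a : ℝ) (p : ℝ × ℝ) :
    ‖h p‖ₑ ≤ 26 * ∫⁻ q, ‖dampedAiry a h q‖ₑ *
      (rieszKernel (p.1 - q.1) * rieszKernel (p.2 - q.2)) := by
  have hlim := (hh.tendsto_truncated_fourierInv hs p.1 p.2).enorm
  have hcast : ‖(h (p.1, p.2) : ℂ)‖ₑ = ‖h p‖ₑ := by
    rw [← ofReal_norm, Complex.norm_real, ofReal_norm]
  rw [hcast] at hlim
  refine le_of_tendsto hlim ?_
  filter_upwards [eventually_ge_atTop 0] with N hN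
  exact hh.enorm_truncated_fourierInv_le hs a p.1 p.2 hN

end C31

theorem stmt5 : ∃ c : ℝ, 0 < c ∧ ∀ h : ℝ × ℝ → ℝ, C31 h → HasCompactSupport h → ∀ a : ℝ,
    eLpNorm h 8 volume ≤
      ENNReal.ofReal c *
        eLpNorm (fun p => pdt h p + pdx (pdx (pdx h)) p + a * h p) (8/7) volume := by
  refine ⟨26 * 144, by norm_num, fun h hh hs a => ?_⟩
  change _ ≤ _ * eLpNorm (dampedAiry a h) (8 / 7) volume
  have hhc : Continuous h := hh.2.2.1
  have hfc := hh.continuous_dampedAiry a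
  have hhm := hhc.measurable
  have hfm := hfc.measurable
  set f := dampedAiry a h with hf
  have hp : ((8 / 7 : ℝ≥0∞)).toReal = 8 / 7 := by simp
  have hp0 : (8 / 7 : ℝ≥0∞) ≠ 0 := by simp
  have hpt : (8 / 7 : ℝ≥0∞) ≠ ∞ := ENNReal.div_ne_top (by norm_num) (by norm_num)
  have hfin : eLpNorm h 8 volume ≠ ∞ := (hhc.memLp_of_hasCompactSupport hs).eLpNorm_ne_top
  rw [eLpNorm_eq_lintegral_rpow_enorm_toReal (by norm_num) (by norm_num)] at hfin ⊢
  rw [eLpNorm_eq_lintegral_rpow_enorm_toReal hp0 hpt, hp]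
  simp only [ENNReal.toReal_ofNat] at hfin ⊢
  set X := ∫⁻ p, ‖h p‖ₑ ^ (8 : ℝ) with hX
  set Y := ∫⁻ p, ‖f p‖ₑ ^ (8 / 7 : ℝ) with hY
  have hkey : X ≤ 26 * (144 * (X ^ (7 / 8 : ℝ) * Y ^ (7 / 8 : ℝ))) := by
    refine le_trans ?_ (mul_le_mul_right (hardyLittlewoodSobolev_prod
      (F := fun p => ‖h p‖ₑ ^ (8 : ℝ)) (G := fun p => ‖f p‖ₑ ^ (8 / 7 : ℝ))
      (by fun_prop) (by fun_prop)) _)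
    rw [← lintegral_const_mul' _ _ (by norm_num)]
    refine lintegral_mono fun p => ?_
    have h8 : ‖h p‖ₑ ^ (8 : ℝ) = ‖h p‖ₑ ^ (7 : ℝ) * ‖h p‖ₑ := by
      rw [show (8 : ℝ) = 7 + 1 by norm_num,
        ENNReal.rpow_add_of_nonneg _ _ (by norm_num) (by norm_num), ENNReal.rpow_one]
    calc ‖h p‖ₑ ^ (8 : ℝ) ≤ ‖h p‖ₑ ^ (7 : ℝ) * (26 * ∫⁻ q, ‖f q‖ₑ *
          (rieszKernel (p.1 - q.1) * rieszKernel (p.2 - q.2))) := by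
          rw [h8]; exact mul_le_mul_right (hh.enorm_le_riesz_potential hs a p) _
      _ = _ := by
          rw [mul_left_comm, ← lintegral_const_mul' _ _ (by simp)]
          congr 1
          refine lintegral_congr fun q => ?_
          rw [← ENNReal.rpow_mul, ← ENNReal.rpow_mul]
          norm_num [mul_assoc]
  have hY78 : Y ^ (1 / (8 / 7) : ℝ) = Y ^ (7 / 8 : ℝ) := by norm_num
  rw [hY78]
  have hXt : X ≠ ∞ := by
    intro h'
    rw [h', ENNReal.top_rpow_of_pos (by norm_num)] at hfin
    exact hfin rfl
  rcases eq_or_ne X 0 with hX0 | hX0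
  · rw [hX0, ENNReal.zero_rpow_of_pos (by norm_num)]; exact zero_le
  have hX7 : X ^ (7 / 8 : ℝ) ≠ 0 := by simp [ENNReal.rpow_eq_zero_iff, hX0, hXt]
  have hX7t : X ^ (7 / 8 : ℝ) ≠ ∞ := ENNReal.rpow_ne_top_of_nonneg (by norm_num) hXt
  rw [← ENNReal.mul_le_mul_iff_right hX7 hX7t, ← ENNReal.rpow_add_of_nonneg _ _ (by norm_num)
    (by norm_num)]
  norm_num
  refine hkey.trans_eq ?_
  rw [← mul_assoc 26 144]
  norm_num
  ring
end
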